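/- Let L be an even unimodular lattice of dimension 48 with minimum 6, and let σ ∈ Aut(L) be an automorphism of order 2 with σ ≠ −1 (and σ ≠ 1). Then the fixed lattices of σ and of −σ are both 24-dimensional, each with discriminant group (ℤ/2ℤ)^{24}. -/

import Mathlib

open scoped RealInnerProductSpace

noncomputable section

abbrev Eu (n : ℕ) := EuclideanSpace ℝ (Fin n)

/-- The dual of a set of lattice vectors: all vectors pairing integrally with the set. -/
def dualSet {n : ℕ} (L : Set (Eu n)) : Set (Eu n) :=
  {x | ∀ y ∈ L, ∃ k : ℤ, ⟪x, y⟫ = (k : ℝ)}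

/-- A set of vectors is even if all norms are even integers. -/
def IsEvenLat {n : ℕ} (L : Set (Eu n)) : Prop :=
  ∀ x ∈ L, ∃ k : ℤ, ⟪x, x⟫ = 2 * (k : ℝ)

/-- σ is an automorphism of the lattice L: an orthogonal map preserving L. -/
def IsAutoOf {n : ℕ} (σ : Eu n ≃ₗ[ℝ] Eu n) (L : Submodule ℤ (Eu n)) : Prop :=
  (∀ x y : Eu n, ⟪σ x, σ y⟫ = ⟪x, y⟫) ∧ σ '' (L : Set (Eu n)) = (L : Set (Eu n))

/-- The fixed space ker(σ - 1). -/
def fixSpace {n : ℕ} (σ : Eu n ≃ₗ[ℝ] Eu n) : Submodule ℝ (Eu n) :=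
  LinearMap.ker (σ.toLinearMap - LinearMap.id)

/-- The image space im(σ - 1). -/
def imSpace {n : ℕ} (σ : Eu n ≃ₗ[ℝ] Eu n) : Submodule ℝ (Eu n) :=
  LinearMap.range (σ.toLinearMap - LinearMap.id)

/-- The intersection of a lattice with a rational subspace, as an additive subgroup. -/
def latIn {n : ℕ} (L : Submodule ℤ (Eu n)) (W : Submodule ℝ (Eu n)) : AddSubgroup (Eu n) :=
  L.toAddSubgroup ⊓ W.toAddSubgroup

/-- The dual lattice of a set S taken inside the subspace W. -/
def dualIn {n : ℕ} (W : Submodule ℝ (Eu n)) (S : Set (Eu n)) : AddSubgroup (Eu n) where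
  carrier := {x | x ∈ W ∧ ∀ y ∈ S, ∃ k : ℤ, ⟪x, y⟫ = (k : ℝ)}
  zero_mem' := ⟨W.zero_mem, fun y _ => ⟨0, by simp⟩⟩
  add_mem' := by
    rintro a b ⟨haW, ha⟩ ⟨hbW, hb⟩
    refine ⟨W.add_mem haW hbW, fun y hy => ?_⟩
    obtain ⟨k, hk⟩ := ha y hy
    obtain ⟨l, hl⟩ := hb y hy
    exact ⟨k + l, by rw [inner_add_left, hk, hl]; push_cast; ring⟩
  neg_mem' := by
    rintro a ⟨haW, ha⟩
    refine ⟨W.neg_mem haW, fun y hy => ?_⟩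
    obtain ⟨k, hk⟩ := ha y hy
    exact ⟨-k, by rw [inner_neg_left, hk]; push_cast; ring⟩

/-- An extremal even unimodular lattice of dimension 48: even, unimodular, full rank,
with minimum norm 6. -/
def IsExtremal48 (L : Submodule ℤ (Eu 48)) : Prop :=
  Submodule.span ℝ (L : Set (Eu 48)) = ⊤ ∧
  IsEvenLat (L : Set (Eu 48)) ∧
  dualSet (L : Set (Eu 48)) = (L : Set (Eu 48)) ∧
  (∀ x ∈ L, x ≠ 0 → 6 ≤ ⟪x, x⟫) ∧
  (∃ x ∈ L, ⟪x, x⟫ = (6 : ℝ))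

/-- The fixed space of `-σ`, i.e. `ker(σ + 1)`. -/
def negFixSpace {n : ℕ} (σ : Eu n ≃ₗ[ℝ] Eu n) : Submodule ℝ (Eu n) :=
  LinearMap.ker (σ.toLinearMap + LinearMap.id)

/-- The discriminant group `(L ∩ W)^# / (L ∩ W)` of the sublattice cut out by `W`. -/
abbrev discQuot {n : ℕ} (L : Submodule ℤ (Eu n)) (W : Submodule ℝ (Eu n)) :=
  dualIn (Submodule.span ℝ ((latIn L W) : Set (Eu n))) ((latIn L W) : Set (Eu n)) ⧸
    (latIn L W).addSubgroupOf
      (dualIn (Submodule.span ℝ ((latIn L W) : Set (Eu n))) ((latIn L W) : Set (Eu n)))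

/-! ### Integral self-dual lattices -/

namespace SDLattice

variable {V : Type} [NormedAddCommGroup V] [InnerProductSpace ℝ V]

/-- A real number which is an integer. -/
def IsInt (a : ℝ) : Prop := ∃ k : ℤ, a = k

lemma IsInt.add {a b : ℝ} (ha : IsInt a) (hb : IsInt b) : IsInt (a + b) := by
  obtain ⟨k, rfl⟩ := ha; obtain ⟨l, rfl⟩ := hb; exact ⟨k + l, by push_cast; ring⟩

lemma IsInt.neg {a : ℝ} (ha : IsInt a) : IsInt (-a) := by
  obtain ⟨k, rfl⟩ := ha; exact ⟨-k, by push_cast; ring⟩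

lemma IsInt.sub {a b : ℝ} (ha : IsInt a) (hb : IsInt b) : IsInt (a - b) := by
  obtain ⟨k, rfl⟩ := ha; obtain ⟨l, rfl⟩ := hb; exact ⟨k - l, by push_cast; ring⟩

lemma IsInt.mul {a b : ℝ} (ha : IsInt a) (hb : IsInt b) : IsInt (a * b) := by
  obtain ⟨k, rfl⟩ := ha; obtain ⟨l, rfl⟩ := hb; exact ⟨k * l, by push_cast; ring⟩

lemma isInt_intCast (k : ℤ) : IsInt (k : ℝ) := ⟨k, rfl⟩

lemma isInt_zero : IsInt 0 := ⟨0, by simp⟩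

lemma isInt_one : IsInt 1 := ⟨1, by simp⟩

lemma isInt_two : IsInt 2 := ⟨2, by simp⟩

/-- A subgroup equal to its own dual. -/
def SelfDual (N : AddSubgroup V) : Prop := ∀ x, x ∈ N ↔ ∀ y ∈ N, IsInt ⟪x, y⟫

/-- All norms are even integers. -/
def Even (N : AddSubgroup V) : Prop := ∀ x ∈ N, ∃ k : ℤ, ⟪x, x⟫ = 2 * (k : ℝ)

variable {N : AddSubgroup V}

lemma SelfDual.isInt (hN : SelfDual N) {x y : V} (hx : x ∈ N) (hy : y ∈ N) : IsInt ⟪x, y⟫ :=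
  (hN x).1 hx y hy

lemma SelfDual.one_le (hN : SelfDual N) {x : V} (hx : x ∈ N) (h0 : x ≠ 0) : 1 ≤ ⟪x, x⟫ := by
  obtain ⟨k, hk⟩ := hN.isInt hx hx
  have h : 0 < ⟪x, x⟫ := real_inner_self_pos.2 h0
  rw [hk] at h ⊢
  exact_mod_cast (by exact_mod_cast h : 0 < k)

lemma SelfDual.eq_zero_of_orthogonal (hN : SelfDual N) {x : V} (h : ∀ y ∈ N, ⟪x, y⟫ = 0) :
    x = 0 := by
  have ht : ∀ t : ℝ, t • x ∈ N := fun t => (hN _).2 fun y hy => by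
    rw [real_inner_smul_left, h y hy, mul_zero]; exact isInt_zero
  have := h x (by simpa using ht 1)
  exact inner_self_eq_zero.1 this

lemma SelfDual.discrete (hN : SelfDual N) :
    DiscreteTopology (AddSubgroup.toIntSubmodule N) := by
  refine DiscreteTopology.of_forall_le_dist (r := 1) one_pos ?_
  intro x y hxy
  have h := hN.one_le (N.sub_mem x.2 y.2) (sub_ne_zero.2 fun h => hxy (Subtype.ext h))
  rw [real_inner_self_eq_norm_sq, ← dist_eq_norm] at h
  have h0 : (0:ℝ) ≤ dist (x:V) y := dist_nonneg
  change (1:ℝ) ≤ dist (x:V) y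
  nlinarith

variable [FiniteDimensional ℝ V]

lemma SelfDual.span_eq_top (hN : SelfDual N) : Submodule.span ℝ (N : Set V) = ⊤ := by
  rw [← Submodule.orthogonal_eq_bot_iff, Submodule.eq_bot_iff]
  intro x hx
  refine hN.eq_zero_of_orthogonal fun y hy => ?_
  rw [real_inner_comm]
  exact Submodule.inner_right_of_mem_orthogonal (Submodule.subset_span hy) hx

lemma SelfDual.isZLattice (hN : SelfDual N) :
    haveI := hN.discrete
    IsZLattice ℝ (AddSubgroup.toIntSubmodule N) :=
  have := hN.discrete
  ⟨hN.span_eq_top⟩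

/-- A self-dual lattice is the `ℤ`-span of an `ℝ`-basis of the ambient space. -/
lemma SelfDual.exists_basis (hN : SelfDual N) :
    ∃ b : Module.Basis (Fin (Module.finrank ℝ V)) ℝ V,
      AddSubgroup.toIntSubmodule N = Submodule.span ℤ (Set.range b) := by
  have := hN.discrete
  have := hN.isZLattice
  have := ZLattice.module_free ℝ (AddSubgroup.toIntSubmodule N)
  have := ZLattice.module_finite ℝ (AddSubgroup.toIntSubmodule N)
  have hr := ZLattice.rank ℝ (AddSubgroup.toIntSubmodule N)
  let b0 := Module.finBasisOfFinrankEq ℤ (AddSubgroup.toIntSubmodule N) hr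
  exact ⟨b0.ofZLatticeBasis ℝ _, (b0.ofZLatticeBasis_span ℝ _).symm⟩

lemma SelfDual.mem_iff_basis (hN : SelfDual N) {b : Module.Basis (Fin (Module.finrank ℝ V)) ℝ V}
    (hb : AddSubgroup.toIntSubmodule N = Submodule.span ℤ (Set.range b)) (x : V) :
    x ∈ N ↔ ∀ i, IsInt ⟪x, b i⟫ := by
  have hbm : ∀ i, b i ∈ N := fun i => by
    have : b i ∈ AddSubgroup.toIntSubmodule N := by
      rw [hb]; exact Submodule.subset_span ⟨i, rfl⟩
    exact this
  refine ⟨fun h i => hN.isInt h (hbm i), fun h => (hN x).2 fun y hy => ?_⟩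
  have hy' : y ∈ Submodule.span ℤ (Set.range b) := hb ▸ hy
  induction hy' using Submodule.span_induction with
  | mem z hz => obtain ⟨i, rfl⟩ := hz; exact h i
  | zero => rw [inner_zero_right]; exact isInt_zero
  | add u v hu hv h1 h2 =>
    rw [inner_add_right]
    exact (h1 (show u ∈ AddSubgroup.toIntSubmodule N from hb ▸ hu)).add
      (h2 (show v ∈ AddSubgroup.toIntSubmodule N from hb ▸ hv))
  | smul a u hu h1 =>
    rw [← Int.cast_smul_eq_zsmul ℝ, real_inner_smul_right]
    exact (isInt_intCast a).mul (h1 (show u ∈ AddSubgroup.toIntSubmodule N from hb ▸ hu))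

/-- A vector pairing in a prescribed way with a basis. -/
lemma exists_inner_basis {ι : Type} [Fintype ι] (b : Module.Basis ι ℝ V) (f : ι → ℝ) :
    ∃ c : V, ∀ i, ⟪b i, c⟫ = f i := by
  refine ⟨(InnerProductSpace.toDual ℝ V).symm (LinearMap.toContinuousLinearMap
    (b.constr ℝ f)), fun i => ?_⟩
  rw [real_inner_comm, InnerProductSpace.toDual_symm_apply]
  simp [b.constr_basis]

/-- Existence of characteristic vectors. -/
lemma SelfDual.exists_char (hN : SelfDual N) :
    ∃ c ∈ N, ∀ u ∈ N, ∃ k : ℤ, ⟪u, u⟫ - ⟪u, c⟫ = 2 * (k : ℝ) := by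
  obtain ⟨b, hb⟩ := hN.exists_basis
  obtain ⟨c, hc⟩ := exists_inner_basis b fun i => ⟪b i, b i⟫
  have hmem : ∀ u, u ∈ N ↔ u ∈ Submodule.span ℤ (Set.range b) := fun u => by
    rw [← hb]; exact Iff.rfl
  have hcN : c ∈ N := (hN.mem_iff_basis hb c).2 fun i => by
    rw [real_inner_comm, hc]
    have : b i ∈ N := (hmem _).2 (Submodule.subset_span ⟨i, rfl⟩)
    exact hN.isInt this this
  refine ⟨c, hcN, fun u hu => ?_⟩
  have hu' := (hmem u).1 hu
  clear hu
  induction hu' using Submodule.span_induction with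
  | mem z hz => obtain ⟨i, rfl⟩ := hz; exact ⟨0, by rw [hc]; simp⟩
  | zero => exact ⟨0, by simp⟩
  | add u v hu hv h1 h2 =>
    obtain ⟨k, hk⟩ := h1
    obtain ⟨l, hl⟩ := h2
    obtain ⟨m, hm⟩ := hN.isInt ((hmem u).2 hu) ((hmem v).2 hv)
    refine ⟨k + l + m, ?_⟩
    simp only [inner_add_left, inner_add_right, real_inner_comm u v] at *
    push_cast
    linarith
  | smul a u hu h1 =>
    obtain ⟨k, hk⟩ := h1
    obtain ⟨m, hm⟩ := hN.isInt ((hmem u).2 hu) ((hmem u).2 hu)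
    rw [← Int.cast_smul_eq_zsmul ℝ, real_inner_smul_right, real_inner_smul_left,
      real_inner_smul_left]
    obtain ⟨j, hj⟩ : ∃ j : ℤ, a * a - a = 2 * j := by
      obtain ⟨j, hj⟩ := Int.even_mul_pred_self a
      exact ⟨j, by linarith⟩
    have hj' : (a:ℝ) * a - a = 2 * j := by exact_mod_cast hj
    refine ⟨j * m + a * k, ?_⟩
    push_cast
    rw [hm] at hk ⊢
    linear_combination (m:ℝ) * hj' + a * hk

lemma pow_mul_exp_le (m : ℕ) (b : ℝ) {c : ℝ} (hc : 0 < c) :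
    ∃ K : ℝ, ∀ t : ℝ, 0 ≤ t → t ^ m * Real.exp (b * t - c * t ^ 2) ≤ K := by
  refine ⟨m.factorial * Real.exp ((b + 1) ^ 2 / (4 * c)), fun t ht => ?_⟩
  have h1 : b * t - c * t ^ 2 ≤ (b + 1) ^ 2 / (4 * c) - t := by
    rw [le_sub_iff_add_le, le_div_iff₀ (by positivity)]
    nlinarith [sq_nonneg (2 * c * t - (b + 1))]
  have h2 : t ^ m ≤ m.factorial * Real.exp t := by
    have := Real.pow_div_factorial_le_exp t ht m
    rwa [div_le_iff₀ (by positivity), mul_comm] at this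
  calc t ^ m * Real.exp (b * t - c * t ^ 2)
      ≤ (m.factorial * Real.exp t) * Real.exp ((b + 1) ^ 2 / (4 * c) - t) := by gcongr
    _ = m.factorial * Real.exp ((b + 1) ^ 2 / (4 * c)) := by
      rw [mul_assoc, ← Real.exp_add]; congr 2; ring

/-- Gaussian sums with polynomial and exponential weights converge. -/
lemma SelfDual.summable_gauss (hN : SelfDual N) (p : ℕ) (b : ℝ) {c : ℝ} (hc : 0 < c) :
    Summable fun x : N => ‖(x:V)‖ ^ p * Real.exp (b * ‖(x:V)‖ - c * ‖(x:V)‖ ^ 2) := by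
  have := hN.discrete
  have hs := ZLattice.summable_norm_pow_inv (AddSubgroup.toIntSubmodule N)
    (Module.finrank ℤ (AddSubgroup.toIntSubmodule N) + 1) (Nat.lt_succ_self _)
  set r := Module.finrank ℤ (AddSubgroup.toIntSubmodule N) + 1
  obtain ⟨K, hK⟩ := pow_mul_exp_le (p + r) b hc
  refine Summable.of_norm_bounded_eventually (g := fun x : N => K * ‖(x:V)‖⁻¹ ^ r)
    (Summable.mul_left K hs) ?_
  refine (Set.finite_singleton (0:N)).subset fun x hx => ?_
  by_contra h0
  refine hx ?_
  have hx0 : 0 < ‖(x:V)‖ := norm_pos_iff.2 fun h => h0 (Subtype.ext h)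
  have := hK _ hx0.le
  change ‖_‖ ≤ _
  rw [Real.norm_of_nonneg (by positivity), inv_pow, ← div_eq_mul_inv, le_div_iff₀ (by positivity)]
  calc _ = ‖(x:V)‖ ^ (p + r) * Real.exp (b * ‖(x:V)‖ - c * ‖(x:V)‖ ^ 2) := by ring
    _ ≤ K := this

lemma SelfDual.finite_ball (hN : SelfDual N) (R : ℝ) : {x : V | x ∈ N ∧ ⟪x, x⟫ ≤ R}.Finite := by
  have hs := (hN.summable_gauss 0 0 one_pos).tendsto_cofinite_zero
  have := (hs.eventually (gt_mem_nhds (Real.exp_pos (-R)))).filter_mono le_rfl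
  have hfin : {x : N | ¬ (‖(x:V)‖ ^ 0 * Real.exp (0 * ‖(x:V)‖ - 1 * ‖(x:V)‖ ^ 2)
    < Real.exp (-R))}.Finite := this
  refine (hfin.image Subtype.val).subset fun x hx => ⟨⟨x, hx.1⟩, ?_, rfl⟩
  have h2 := hx.2
  rw [real_inner_self_eq_norm_sq] at h2
  simp only [Set.mem_ofPred_eq, not_lt, pow_zero, one_mul, zero_mul, zero_sub, Real.exp_le_exp]
  linarith

/-- The vectors of `N` of norm `2 m`. -/
def shellSet (N : AddSubgroup V) (m : ℕ) : Set V := {x | x ∈ N ∧ ⟪x, x⟫ = 2 * (m : ℝ)}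

open Classical in
/-- The vectors of `N` of norm `2 m`, as a finite set (empty if there are infinitely many). -/
def shell (N : AddSubgroup V) (m : ℕ) : Finset V :=
  if h : (shellSet N m).Finite then h.toFinset else ∅

lemma SelfDual.mem_shell (hN : SelfDual N) {m : ℕ} {x : V} :
    x ∈ shell N m ↔ x ∈ N ∧ ⟪x, x⟫ = 2 * (m : ℝ) := by
  have : (shellSet N m).Finite :=
    (hN.finite_ball (2 * m)).subset fun x hx => ⟨hx.1, hx.2.le⟩
  rw [shell, dif_pos this]
  simp [shellSet]

end SDLattice

namespace SDLattice
open MeasureTheory Complex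
open scoped FourierTransform Real
variable {V : Type} [NormedAddCommGroup V] [InnerProductSpace ℝ V] [FiniteDimensional ℝ V]
  {N : AddSubgroup V}

/-- Coordinates of a self-dual lattice with respect to the dual of a basis. -/
lemma SelfDual.exists_dual_coords (hN : SelfDual N)
    {b : Module.Basis (Fin (Module.finrank ℝ V)) ℝ V}
    (hb : AddSubgroup.toIntSubmodule N = Submodule.span ℤ (Set.range b)) :
    ∃ e : N ≃ (Fin (Module.finrank ℝ V) → ℤ), ∀ x i, ((e x i : ℤ) : ℝ) = ⟪(x:V), b i⟫ := by
  choose f hf using fun (x : N) (i : Fin (Module.finrank ℝ V)) => (hN.mem_iff_basis hb x).1 x.2 i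
  refine ⟨Equiv.ofBijective f ⟨fun x y hxy => ?_, fun k => ?_⟩, fun x i => (hf x i).symm⟩
  · refine Subtype.ext (InnerProductSpace.ext_inner_right_basis b fun i => ?_)
    rw [hf x i, hf y i, hxy]
  · obtain ⟨c, hc⟩ := exists_inner_basis b fun i => (k i : ℝ)
    have hcN : c ∈ N := (hN.mem_iff_basis hb c).2 fun i => by
      rw [real_inner_comm, hc]; exact isInt_intCast _
    refine ⟨⟨c, hcN⟩, funext fun i => ?_⟩
    have := hf ⟨c, hcN⟩ i
    rw [real_inner_comm, hc] at this
    exact_mod_cast this.symm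

lemma exists_torus_lift {n : ℕ} (F : (Fin n → ℝ) → ℂ) (hF : Continuous F)
    (hper : ∀ (k : Fin n → ℤ) v, F (v + fun i => (k i : ℝ)) = F v) :
    ∃ f : C(UnitAddTorus (Fin n), ℂ), ∀ v : Fin n → ℝ, f (fun i => (v i : UnitAddCircle)) = F v := by
  have hq : IsOpenQuotientMap (Pi.map fun (_ : Fin n) (x : ℝ) => (x : UnitAddCircle)) :=
    IsOpenQuotientMap.piMap fun _ => QuotientAddGroup.isOpenQuotientMap_mk
  choose s hs using hq.surjective
  have hval : ∀ v : Fin n → ℝ, F (s (fun i => (v i : UnitAddCircle))) = F v := by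
    intro v
    have h1 := hs (fun i => (v i : UnitAddCircle))
    have h2 : ∀ i, ∃ k : ℤ, s (fun i => (v i : UnitAddCircle)) i = v i + k := fun i => by
      have := congrFun h1 i
      simp only [Pi.map_apply] at this
      obtain ⟨k, hk⟩ := AddSubgroup.mem_zmultiples_iff.1 (QuotientAddGroup.eq.1 this.symm)
      refine ⟨k, ?_⟩
      simp only [zsmul_eq_mul, mul_one] at hk
      linarith
    choose k hk using h2
    rw [show s (fun i => (v i : UnitAddCircle)) = v + fun i => (k i : ℝ) from funext hk, hper]
  refine ⟨⟨fun x => F (s x), ?_⟩, hval⟩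
  rw [← hq.isQuotientMap.continuous_iff.symm.eq] 
  convert hF using 1
  funext v
  exact hval v

/-- Poisson summation for a self-dual lattice. -/
theorem SelfDual.poisson [MeasurableSpace V] [BorelSpace V] (hN : SelfDual N) :
    ∃ C : ℝ, ∀ g : V → ℂ, Continuous g → Integrable g →
      (∀ R : ℝ, ∃ u : N → ℝ, Summable u ∧ ∀ v, ‖v‖ ≤ R → ∀ x : N, ‖g (x + v)‖ ≤ u x) →
      Summable (fun x : N => 𝓕 g (x:V)) →
      ∀ u : V, HasSum (fun x : N => C * 𝓕 g (x:V) * cexp (2 * π * I * ⟪(x:V), u⟫))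
        (∑' x : N, g (x + u)) := by
  obtain ⟨b, hb⟩ := hN.exists_basis
  obtain ⟨e, he⟩ := hN.exists_dual_coords hb
  let phi : (Fin (Module.finrank ℝ V) → ℝ) ≃L[ℝ] V := b.equivFun.symm.toContinuousLinearEquiv
  have hphi : ∀ v, phi v = ∑ i, v i • b i := fun v => b.equivFun_symm_apply v
  have hphimeas : MeasurableEmbedding phi := phi.toHomeomorph.measurableEmbedding
  have := phi.isAddHaarMeasure_map (volume : Measure (Fin (Module.finrank ℝ V) → ℝ))
  obtain ⟨c, hc⟩ : ∃ c : NNReal, Measure.map phi (volume : Measure (Fin (Module.finrank ℝ V) → ℝ)) = c • volume :=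
    ⟨_, Measure.isAddLeftInvariant_eq_smul _ _⟩
  have hbox : ∀ G : V → ℂ, ∫ v in {x : Fin (Module.finrank ℝ V) → ℝ | ∀ i, x i ∈ Set.Ioc ((fun _ => 0 : Fin (Module.finrank ℝ V) → ℝ) i)
      ((fun _ => 0 : Fin (Module.finrank ℝ V) → ℝ) i + 1)}, G (phi v) =
      (c:ℝ) • ∫ v in ZSpan.fundamentalDomain b, G v := by
    intro G
    have h1 : ∫ v in ZSpan.fundamentalDomain b, G v ∂(Measure.map phi volume) =
      (c:ℝ) • ∫ v in ZSpan.fundamentalDomain b, G v := by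
      rw [hc, Measure.restrict_smul, integral_smul_nnreal_measure]; rfl
    rw [← h1, hphimeas.setIntegral_map]
    refine setIntegral_congr_set ?_
    have h2 : phi ⁻¹' ZSpan.fundamentalDomain b =
        Set.univ.pi fun i : Fin (Module.finrank ℝ V) => Set.Ico (0:ℝ) 1 := by
      ext v
      simp only [Set.mem_preimage, ZSpan.mem_fundamentalDomain, Set.mem_univ_pi]
      have : ∀ i, b.repr (phi v) i = v i := fun i => by
        rw [hphi, b.repr_sum_self]
      simp only [this]
    have h3 : {x : Fin (Module.finrank ℝ V) → ℝ | ∀ i, x i ∈ Set.Ioc ((fun _ => 0 : Fin (Module.finrank ℝ V) → ℝ) i)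
      ((fun _ => 0 : Fin (Module.finrank ℝ V) → ℝ) i + 1)} = Set.univ.pi fun i : Fin (Module.finrank ℝ V) => Set.Ioc (0:ℝ) 1 := by
      ext v; simp
    rw [h2, h3]
    exact (Measure.univ_pi_Ioc_ae_eq_Icc (f := fun _ => (0:ℝ)) (g := fun _ => 1)).trans
      (Measure.univ_pi_Ico_ae_eq_Icc (f := fun _ => (0:ℝ)) (g := fun _ => 1)).symm
  have hD : IsAddFundamentalDomain N (ZSpan.fundamentalDomain b) (volume : Measure V) := by
    have h := ZSpan.isAddFundamentalDomain' b (volume : Measure V)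
    rwa [← hb] at h
  have : Countable N := e.injective.countable
  refine ⟨c, fun g hg hgi hbd hsum u => ?_⟩
  set F : V → ℂ := fun v => ∑' x : N, g (x + v) with hFdef
  have hFs : ∀ v, Summable fun x : N => g (x + v) := fun v => by
    obtain ⟨w, hw, h⟩ := hbd ‖v‖
    exact Summable.of_norm_bounded hw (h v le_rfl)
  have hFc : Continuous F := by
    rw [continuous_iff_continuousAt]
    intro v
    obtain ⟨w, hw, h⟩ := hbd (‖v‖ + 1)
    have : ContinuousOn F (Metric.ball 0 (‖v‖ + 1)) :=
      continuousOn_tsum (fun x => (hg.comp (by fun_prop)).continuousOn) hw fun x y hy => 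
        h y (by simpa using (mem_ball_zero_iff.1 hy).le) x
    exact this.continuousAt (Metric.isOpen_ball.mem_nhds (by simp))
  have hFper : ∀ (x : N) v, F (v + x) = F v := fun x v => by
    simp only [hFdef]
    rw [← (Equiv.addRight x).tsum_eq (fun y : N => g (y + v))]
    refine tsum_congr fun y => ?_
    congr 1
    simp only [Equiv.coe_addRight, AddSubgroup.coe_add]
    abel
  obtain ⟨f, hf⟩ := exists_torus_lift (fun v => F (phi v)) (hFc.comp phi.continuous) fun k v => by
    have hmem : phi (fun i => (k i : ℝ)) ∈ N := by
      have : phi (fun i => (k i : ℝ)) ∈ AddSubgroup.toIntSubmodule N := by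
        rw [hb, hphi]
        refine Submodule.sum_mem _ fun i _ => ?_
        rw [Int.cast_smul_eq_zsmul]
        exact Submodule.smul_mem _ _ (Submodule.subset_span ⟨i, rfl⟩)
      exact this
    rw [map_add]
    exact hFper ⟨_, hmem⟩ _
  have hmf : ∀ (x : N) (v : Fin (Module.finrank ℝ V) → ℝ), UnitAddTorus.mFourier (e x)
      (fun i => (v i : UnitAddCircle)) = cexp (2 * π * I * ⟪(x:V), phi v⟫) := fun x v => by
    simp only [UnitAddTorus.mFourier, ContinuousMap.coe_mk, fourier_coe_apply]
    rw [← Complex.exp_sum]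
    congr 1
    rw [hphi, inner_sum, ofReal_sum, Finset.mul_sum]
    refine Finset.sum_congr rfl fun i _ => ?_
    rw [real_inner_smul_right, ← he]
    push_cast; ring
  have hcoef : ∀ x : N, UnitAddTorus.mFourierCoeff f (e x) = c * 𝓕 g (x:V) := by
    intro x
    rw [UnitAddTorus.mFourierCoeff_eq_integral f (e x) (fun _ => 0)]
    have h1 : ∀ v : Fin (Module.finrank ℝ V) → ℝ, UnitAddTorus.mFourier (-(e x)) (fun i => (v i : UnitAddCircle)) •
        f (fun i => (v i : UnitAddCircle)) = 
        (fun w => cexp (-(2 * π * I * ⟪(x:V), w⟫)) * F w) (phi v) := fun v => by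
      rw [hf, UnitAddTorus.mFourier_neg, hmf, smul_eq_mul, ← Complex.exp_conj]
      simp only [map_mul, conj_ofReal, conj_I, Complex.conj_ofNat]
      congr 2; ring
    simp only [h1]
    rw [show (∫ v in {x : Fin (Module.finrank ℝ V) → ℝ | ∀ i, x i ∈ Set.Ioc (0:ℝ) (0 + 1)},
      (fun w => cexp (-(2 * π * I * ⟪(x:V), w⟫)) * F w) (phi v)) = _ from
      hbox (fun w => cexp (-(2 * π * I * ⟪(x:V), w⟫)) * F w), real_smul]
    congr 1
    set E : V → ℂ := fun w => cexp (-(2 * π * I * ⟪(x:V), w⟫)) with hE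
    have hEc : Continuous E := by rw [hE]; fun_prop
    have hEn : ∀ w, ‖E w‖ = 1 := fun w => by
      rw [hE]; simp only
      rw [show -(2 * π * I * ((⟪(x:V), w⟫ : ℝ):ℂ)) = ((-(2 * π * ⟪(x:V), w⟫) : ℝ) : ℂ) * I by
        push_cast; ring, Complex.norm_exp_ofReal_mul_I]
    have hEper : ∀ (y : N) w, E (y + w) = E w := fun y w => by
      obtain ⟨k, hk⟩ := hN.isInt x.2 y.2
      simp only [hE]
      rw [inner_add_right, hk]
      rw [show -(2 * π * I * (((k:ℝ) + ⟪(x:V), w⟫ : ℝ) : ℂ)) =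
        -(2 * π * I * (⟪(x:V), w⟫ : ℝ)) + ((-k : ℤ) : ℂ) * (2 * π * I) by push_cast; ring]
      exact Complex.exp_periodic.int_mul (-k) _
    have hint : Integrable (fun w => E w * g w) := by
      refine hgi.bdd_mul (c := 1) hEc.aestronglyMeasurable ?_
      exact Filter.Eventually.of_forall fun w => (hEn w).le
    have h2 : 𝓕 g (x:V) = ∫ w, E w * g w := by
      rw [Real.fourier_eq']
      refine integral_congr_ae (Filter.Eventually.of_forall fun w => ?_)
      simp only [hE, smul_eq_mul, real_inner_comm]
      congr 2
      push_cast; ring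
    rw [h2, hD.integral_eq_tsum'' _ hint]
    obtain ⟨R, hR⟩ := (ZSpan.fundamentalDomain_isBounded b).exists_norm_le
    obtain ⟨w, hw, hbw⟩ := hbd R
    have hvol : volume (ZSpan.fundamentalDomain b) < ⊤ :=
      (ZSpan.fundamentalDomain_isBounded b).measure_lt_top
    have hDm : MeasurableSet (ZSpan.fundamentalDomain b) := ZSpan.fundamentalDomain_measurableSet b
    have h3 := hasSum_integral_of_summable_integral_norm
      (μ := volume.restrict (ZSpan.fundamentalDomain b))
      (F := fun (y : N) v => E (y +ᵥ v) * g (y +ᵥ v)) ?_ ?_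
    · rw [h3.tsum_eq]
      refine integral_congr_ae (Filter.Eventually.of_forall fun v => ?_)
      simp only [AddSubgroup.vadd_def, vadd_eq_add, hEper, hFdef, tsum_mul_left]
      rfl
    · intro y
      refine Integrable.mono' (g := fun _ => w y) ?_ ?_ ?_
      · exact integrableOn_const hvol.ne
      · refine Continuous.aestronglyMeasurable ?_
        simp only [AddSubgroup.vadd_def, vadd_eq_add]
        fun_prop
      · refine (ae_restrict_iff' hDm).2 (Filter.Eventually.of_forall fun v hv => ?_)
        rw [norm_mul, hEn, one_mul]
        exact hbw v (hR v hv) y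
    · refine Summable.of_nonneg_of_le (fun y => integral_nonneg fun _ => norm_nonneg _) (fun y => ?_)
        (hw.mul_left (volume.real (ZSpan.fundamentalDomain b)))
      calc ∫ v in ZSpan.fundamentalDomain b, ‖E (y +ᵥ v) * g (y +ᵥ v)‖
          ≤ ∫ v in ZSpan.fundamentalDomain b, w y := by
            refine setIntegral_mono_on ?_ (integrableOn_const hvol.ne) hDm fun v hv => ?_
            · refine Integrable.mono' (g := fun _ => w y) (integrableOn_const hvol.ne) ?_ ?_
              · refine Continuous.aestronglyMeasurable ?_
                simp only [AddSubgroup.vadd_def, vadd_eq_add]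
                fun_prop
              · refine (ae_restrict_iff' hDm).2 (Filter.Eventually.of_forall fun v hv => ?_)
                rw [norm_norm, norm_mul, hEn, one_mul]
                exact hbw v (hR v hv) y
            · rw [norm_mul, hEn, one_mul]
              exact hbw v (hR v hv) y
        _ = _ := by rw [setIntegral_const, smul_eq_mul]
  have hsc : Summable (UnitAddTorus.mFourierCoeff f) := by
    rw [← e.summable_iff]
    exact (hsum.mul_left (c:ℂ)).congr fun x => (hcoef x).symm
  have hfin := UnitAddTorus.hasSum_mFourier_series_apply_of_summable hsc
    (fun i => ((phi.symm u i : ℝ) : UnitAddCircle))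
  rw [hf, phi.apply_symm_apply, ← e.hasSum_iff] at hfin
  convert hfin using 2 with x
  simp only [Function.comp, hcoef, hmf, phi.apply_symm_apply, smul_eq_mul]

end SDLattice

namespace SDLattice
open MeasureTheory Complex
open scoped FourierTransform Real
variable {V : Type} [NormedAddCommGroup V] [InnerProductSpace ℝ V] [FiniteDimensional ℝ V]
  {N : AddSubgroup V}

/-- The theta function with characteristics `∑ exp (π i τ ⟪x, x⟫ + 2 π i s ⟪x, y⟫)`. -/
def gauss (N : AddSubgroup V) (τ s : ℂ) (y : V) : ℂ :=
  ∑' x : N, cexp (π * I * τ * ⟪(x:V), x⟫ + 2 * π * I * s * ⟪(x:V), y⟫)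

/-- The theta function with weight `⟪x, y⟫ ^ d`. -/
def thetaPow (N : AddSubgroup V) (d : ℕ) (y : V) (τ : ℂ) : ℂ :=
  ∑' x : N, (⟪(x:V), y⟫ : ℂ) ^ d * cexp (π * I * τ * ⟪(x:V), x⟫)

lemma norm_cexp_gauss (τ : ℂ) (x : V) :
    ‖cexp (π * I * τ * ⟪x, x⟫)‖ = Real.exp (-(π * τ.im * ‖x‖ ^ 2)) := by
  rw [Complex.norm_exp, real_inner_self_eq_norm_sq]
  congr 1
  simp [← ofReal_pow]

lemma SelfDual.summable_thetaPow (hN : SelfDual N) (d : ℕ) (y : V) {τ : ℂ} (hτ : 0 < τ.im) :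
    Summable fun x : N => (⟪(x:V), y⟫ : ℂ) ^ d * cexp (π * I * τ * ⟪(x:V), x⟫) := by
  refine Summable.of_norm_bounded
    ((hN.summable_gauss d 0 (mul_pos Real.pi_pos hτ)).mul_left (‖y‖ ^ d)) fun x => ?_
  rw [norm_mul, norm_cexp_gauss, norm_pow, norm_real]
  rw [show ‖y‖ ^ d * (‖(x:V)‖ ^ d * Real.exp (0 * ‖(x:V)‖ - π * τ.im * ‖(x:V)‖ ^ 2)) =
    (‖(x:V)‖ * ‖y‖) ^ d * Real.exp (-(π * τ.im * ‖(x:V)‖ ^ 2)) by rw [mul_pow]; ring_nf]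
  gcongr
  exact norm_inner_le_norm _ _

lemma SelfDual.summable_gaussTerm (hN : SelfDual N) (s : ℂ) (y : V) {τ : ℂ} (hτ : 0 < τ.im) :
    Summable fun x : N => cexp (π * I * τ * ⟪(x:V), x⟫ + 2 * π * I * s * ⟪(x:V), y⟫) := by
  refine Summable.of_norm_bounded
    (hN.summable_gauss 0 (2 * π * ‖s‖ * ‖y‖) (mul_pos Real.pi_pos hτ)) fun x => ?_
  rw [Complex.exp_add, norm_mul, norm_cexp_gauss, pow_zero, one_mul, sub_eq_add_neg,
    Real.exp_add, mul_comm]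
  gcongr
  rw [Complex.norm_exp]
  gcongr
  refine (Complex.re_le_norm _).trans ?_
  simp only [norm_mul, norm_real, norm_I, mul_one, Complex.norm_ofNat, Real.norm_eq_abs,
    abs_of_pos Real.pi_pos]
  rw [mul_assoc _ ‖y‖, mul_comm ‖y‖]
  gcongr
  exact abs_real_inner_le_norm _ _

lemma integrable_gauss {b : ℂ} (hb : 0 < b.re) [MeasurableSpace V] [BorelSpace V] :
    Integrable fun v : V => cexp (-b * (‖v‖:ℂ) ^ 2) := by
  have := GaussianFourier.integrable_cexp_neg_mul_sq_norm_add hb 0 (0 : V)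
  simpa using this

/-- Theta inversion. -/
theorem SelfDual.gauss_inv (hN : SelfDual N) {b : ℂ} (hb : 0 < b.re) (u : V) :
    ∑' x : N, cexp (-b * (‖(x:V) + u‖:ℂ) ^ 2) = (π / b) ^ (Module.finrank ℝ V / 2 : ℂ) *
      ∑' x : N, cexp (-π ^ 2 * (‖(x:V)‖:ℂ) ^ 2 / b) * cexp (2 * π * I * ⟪(x:V), u⟫) := by
  letI : MeasurableSpace V := borel V
  have : BorelSpace V := ⟨rfl⟩
  obtain ⟨C, hC⟩ := hN.poisson
  have hbinv : ∀ {b : ℂ}, 0 < b.re → 0 < (1 / b).re := fun {b} hb => by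
    rw [one_div, Complex.inv_re]
    exact div_pos hb (Complex.normSq_pos.2 fun h => by simp [h] at hb)
  have hsumb : ∀ {b : ℂ}, 0 < b.re → ∀ u : V,
      Summable fun x : N => cexp (-π ^ 2 * (‖(x:V)‖:ℂ) ^ 2 / b) := fun {b} hb u => by
    refine Summable.of_norm_bounded
      (hN.summable_gauss 0 0 (mul_pos (pow_pos Real.pi_pos 2) (hbinv hb))) fun x => ?_
    rw [Complex.norm_exp, pow_zero, one_mul]
    refine le_of_eq ?_
    congr 1
    rw [show -(π:ℂ) ^ 2 * (‖(x:V)‖:ℂ) ^ 2 / b = ((-(π ^ 2 * ‖(x:V)‖ ^ 2) : ℝ) : ℂ) * (1 / b) by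
      push_cast; ring, Complex.re_ofReal_mul]
    ring
  have key : ∀ {b : ℂ}, 0 < b.re → ∀ u : V, HasSum (fun x : N =>
      C * ((π / b) ^ (Module.finrank ℝ V / 2 : ℂ) * cexp (-π ^ 2 * (‖(x:V)‖:ℂ) ^ 2 / b)) *
        cexp (2 * π * I * ⟪(x:V), u⟫)) (∑' x : N, cexp (-b * (‖(x:V) + u‖:ℂ) ^ 2)) := by
    intro b hb u
    have h := hC (fun v : V => cexp (-b * (‖v‖:ℂ) ^ 2)) (by fun_prop) (integrable_gauss hb) ?_ ?_ u
    · simpa only [fourier_gaussian_innerProductSpace hb] using h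
    · intro R
      refine ⟨_, hN.summable_gauss 0 (2 * b.re * R) hb, fun v hv x => ?_⟩
      rw [pow_zero, one_mul, Complex.norm_exp]
      gcongr
      rw [show (-b * (‖(x:V) + v‖:ℂ) ^ 2).re = -(b.re * ‖(x:V) + v‖ ^ 2) by
        rw [← ofReal_pow, Complex.re_mul_ofReal, neg_re]; ring]
      have h1 := norm_sub_norm_le (x:V) (-v)
      rw [sub_neg_eq_add, norm_neg] at h1
      have h2 : ‖(x:V)‖ ≤ ‖(x:V) + v‖ + R := by linarith
      have h3 : ‖(x:V)‖ ^ 2 - 2 * ‖(x:V)‖ * R ≤ ‖(x:V) + v‖ ^ 2 := by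
        have hR : 0 ≤ R := (norm_nonneg v).trans hv
        rcases le_total ‖(x:V)‖ R with h | h
        · nlinarith [norm_nonneg (x:V), sq_nonneg ‖(x:V) + v‖]
        · nlinarith [norm_nonneg (x:V), sq_nonneg ‖(x:V) + v‖]
      nlinarith
    · simp only [fourier_gaussian_innerProductSpace hb]
      exact (hsumb hb 0).mul_left _
  have hC1 : C = 1 := by
    have h := (key (b := π) (by simpa using Real.pi_pos) 0).tsum_eq
    have hpi : (π:ℂ) ≠ 0 := by exact_mod_cast Real.pi_ne_zero
    have h1 : ∀ x : N, cexp (-π ^ 2 * (‖(x:V)‖:ℂ) ^ 2 / π) = cexp (-π * (‖(x:V)‖:ℂ) ^ 2) :=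
      fun x => by congr 1; field_simp
    simp only [inner_zero_right, div_self hpi, one_cpow, one_mul, ofReal_zero, mul_zero,
      Complex.exp_zero, mul_one, add_zero, h1, tsum_mul_left] at h
    have h2 : (∑' x : N, cexp (-π * (‖(x:V)‖:ℂ) ^ 2)) ≠ 0 := by
      have h3 := hN.summable_gauss 0 0 Real.pi_pos
      have h4 : (∑' x : N, cexp (-π * (‖(x:V)‖:ℂ) ^ 2)) =
        ((∑' x : N, ‖(x:V)‖ ^ 0 * Real.exp (0 * ‖(x:V)‖ - π * ‖(x:V)‖ ^ 2) : ℝ) : ℂ) := by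
        rw [ofReal_tsum]
        refine tsum_congr fun x => ?_
        push_cast
        simp
      rw [h4]
      have := h3.tsum_pos (fun x => by positivity) 0 (by simp)
      exact_mod_cast this.ne'
    exact_mod_cast mul_right_cancel₀ h2 (h.trans (one_mul _).symm)
  have h := (key hb u).tsum_eq
  rw [← h, hC1, ← tsum_mul_left]
  exact tsum_congr fun x => by push_cast; ring

lemma SelfDual.gauss_neg_inv (hN : SelfDual N) {τ : ℂ} (hτ : 0 < τ.im) (s : ℝ) (y : V) :
    (I / τ) ^ (Module.finrank ℝ V / 2 : ℂ) * gauss N (-1 / τ) s y =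
      cexp (π * I * τ * s ^ 2 * ⟪y, y⟫) * gauss N τ (τ * s) y := by
  have h0 : τ ≠ 0 := fun h => by simp [h] at hτ
  have hpi : (π:ℂ) ≠ 0 := by exact_mod_cast Real.pi_ne_zero
  have h := hN.gauss_inv (b := -(π * I * τ)) (by simpa using mul_pos Real.pi_pos hτ) (s • y)
  have h1 : (π:ℂ) / -(π * I * τ) = I / τ := by
    field_simp
    rw [I_sq]
  rw [h1] at h
  rw [gauss, gauss]
  conv_rhs => rw [← tsum_mul_left]
  convert h.symm using 1
  · congr 1
    refine tsum_congr fun x => ?_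
    rw [← Complex.exp_add, real_inner_smul_right, real_inner_self_eq_norm_sq]
    congr 1
    field_simp
    push_cast
    ring_nf
    simp only [I_sq]
    ring
  · refine tsum_congr fun x => ?_
    rw [← Complex.exp_add]
    congr 1
    rw [← ofReal_pow ‖_‖, norm_add_sq_real, norm_smul, real_inner_smul_right,
      real_inner_self_eq_norm_sq, real_inner_self_eq_norm_sq, mul_pow, Real.norm_eq_abs, sq_abs]
    push_cast
    ring

lemma Even.gauss_add_one (hE : Even N) (τ s : ℂ) (y : V) : gauss N (τ + 1) s y = gauss N τ s y := by
  refine tsum_congr fun x => ?_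
  obtain ⟨k, hk⟩ := hE x x.2
  rw [hk]
  push_cast
  rw [show (π:ℂ) * I * (τ + 1) * (2 * k) + 2 * π * I * s * (⟪(x:V), y⟫:ℝ) =
    (π * I * τ * (2 * k) + 2 * π * I * s * (⟪(x:V), y⟫:ℝ)) + k * (2 * π * I) by ring]
  exact Complex.exp_periodic.int_mul k _

/-- An even self-dual lattice has rank divisible by `8`. -/
theorem SelfDual.eight_dvd (hN : SelfDual N) (hE : Even N) : 8 ∣ Module.finrank ℝ V := by
  set n := Module.finrank ℝ V with hn
  have e1 := hN.gauss_neg_inv (τ := 1 + I) (by simp) 0 (0:V)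
  have e2 := hN.gauss_neg_inv (τ := -1 + I) (by simp) 0 (0:V)
  simp only [inner_zero_right, ofReal_zero, mul_zero, Complex.exp_zero, one_mul] at e1 e2
  have hI : (1 + I) ≠ 0 := fun h => by simpa using congrArg Complex.im h
  have hI' : (-1 + I) ≠ 0 := fun h => by simpa using congrArg Complex.im h
  have t1 : -1 / (-1 + I) = -1 / (1 + I) + 1 := by
    field_simp
    ring_nf
    simp
    ring
  have t2 : (1 + I) = (-1 + I) + 1 + 1 := by ring
  have hg : gauss N (1 + I) 0 0 = gauss N (-1 + I) 0 0 := by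
    rw [t2, hE.gauss_add_one, hE.gauss_add_one]
  rw [t1, hE.gauss_add_one, ← hg, ← e1] at e2
  have hne : gauss N (-1 / (1 + I)) 0 (0:V) ≠ 0 := by
    intro h
    rw [h, mul_zero] at e1
    have h4 : gauss N (1 + I) 0 (0:V) = gauss N I 0 0 := by
      rw [add_comm, hE.gauss_add_one]
    rw [h4] at e1
    have h3 := hN.summable_gauss 0 0 Real.pi_pos
    have h5 : gauss N I 0 (0:V) =
      ((∑' x : N, ‖(x:V)‖ ^ 0 * Real.exp (0 * ‖(x:V)‖ - π * ‖(x:V)‖ ^ 2) : ℝ) : ℂ) := by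
      rw [ofReal_tsum]
      refine tsum_congr fun x => ?_
      push_cast
      simp only [mul_assoc, I_mul_I, real_inner_self_eq_norm_sq]
      simp
    have := h3.tsum_pos (fun x => by positivity) 0 (by simp)
    rw [h5] at e1
    exact this.ne' (by exact_mod_cast e1.symm)
  have hz := mul_right_cancel₀ hne e2
  have z1 : I / (1 + I) = I * (I / (-1 + I)) := by
    field_simp
    ring_nf
    simp
    ring
  have hw : I / (-1 + I) ≠ 0 := div_ne_zero I_ne_zero hI'
  rw [z1, ← hn] at hz
  set w := I / (-1 + I)
  have hsq : ∀ z : ℂ, (z ^ (n / 2 : ℂ)) ^ 2 = z ^ n := fun z => by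
    rw [← cpow_nat_mul, ← cpow_natCast]
    congr 1
    push_cast
    ring
  have hIn : I ^ n = 1 := by
    have h := congrArg (· ^ 2) hz
    simp only [hsq, mul_pow] at h
    have := mul_right_cancel₀ (pow_ne_zero n hw) (h.symm.trans (one_mul _).symm)
    exact this
  have h4 : 4 ∣ n := by
    have hmod : I ^ (n % 4) = 1 := by rw [← I_pow_eq_pow_mod]; exact hIn
    have hlt : n % 4 < 4 := Nat.mod_lt _ (by norm_num)
    interval_cases hm : n % 4
    · exact Nat.dvd_of_mod_eq_zero hm
    · simpa using congrArg Complex.im hmod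
    · rw [I_sq] at hmod
      exact absurd (congrArg Complex.re hmod) (by norm_num)
    · have := congrArg Complex.im hmod; simp [pow_succ] at this
  obtain ⟨m, hm⟩ := h4
  have hcast : (n / 2 : ℂ) = ((2 * m : ℕ) : ℂ) := by rw [hm]; push_cast; ring
  rw [hcast, cpow_natCast, cpow_natCast, mul_pow] at hz
  have h5 := mul_right_cancel₀ (pow_ne_zero (2 * m) hw) (hz.symm.trans (one_mul _).symm)
  rw [pow_mul, I_sq] at h5
  have h6 : _root_.Even m := by
    by_contra hodd
    rw [Nat.not_even_iff_odd] at hodd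
    rw [hodd.neg_one_pow] at h5
    norm_num at h5
  obtain ⟨r, hr⟩ := h6
  exact ⟨r, by rw [hm, hr]; ring⟩

lemma SelfDual.gauss_expand (hN : SelfDual N) {τ : ℂ} (hτ : 0 < τ.im) (y : V) (d : ℕ) :
    ∃ K : ℝ, ∀ s : ℂ, ‖s‖ ≤ 1 → ‖gauss N τ s y - ∑ j ∈ Finset.range (d + 1),
      (2 * π * I * s) ^ j / j.factorial * thetaPow N j y τ‖ ≤ K * ‖s‖ ^ (d + 1) := by
  have hs := hN.summable_gauss (d + 1) (2 * π * ‖y‖) (mul_pos Real.pi_pos hτ)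
  refine ⟨(2 * π * ‖y‖) ^ (d + 1) * ∑' x : N, ‖(x:V)‖ ^ (d + 1) *
    Real.exp (2 * π * ‖y‖ * ‖(x:V)‖ - π * τ.im * ‖(x:V)‖ ^ 2), fun s hs1 => ?_⟩
  have h1 : ∑ j ∈ Finset.range (d + 1),
      (2 * π * I * s) ^ j / j.factorial * thetaPow N j y τ = ∑' x : N, ∑ j ∈ Finset.range (d + 1),
      (2 * π * I * s) ^ j / j.factorial *
        ((⟪(x:V), y⟫ : ℂ) ^ j * cexp (π * I * τ * ⟪(x:V), x⟫)) := by
    rw [Summable.tsum_finsetSum fun j _ => (hN.summable_thetaPow j y hτ).mul_left _]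
    simp only [tsum_mul_left]
    rfl
  rw [h1, gauss, ← (hN.summable_gaussTerm s y hτ).tsum_sub
    (summable_sum fun j _ => (hN.summable_thetaPow j y hτ).mul_left _),
    mul_right_comm _ _ (‖s‖ ^ (d + 1)),
    ← tsum_mul_left (a := (2 * π * ‖y‖) ^ (d + 1) * ‖s‖ ^ (d + 1))]
  refine tsum_of_norm_bounded (hs.mul_left _).hasSum fun x => ?_
  have h2 : cexp (π * I * τ * ⟪(x:V), x⟫ + 2 * π * I * s * ⟪(x:V), y⟫) -
      ∑ j ∈ Finset.range (d + 1), (2 * π * I * s) ^ j / j.factorial *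
        ((⟪(x:V), y⟫ : ℂ) ^ j * cexp (π * I * τ * ⟪(x:V), x⟫)) =
      (cexp (2 * π * I * s * ⟪(x:V), y⟫) - ∑ j ∈ Finset.range (d + 1),
        (2 * π * I * s * ⟪(x:V), y⟫) ^ j / j.factorial) * cexp (π * I * τ * ⟪(x:V), x⟫) := by
    rw [Complex.exp_add, sub_mul, Finset.sum_mul, mul_comm]
    congr 1
    exact Finset.sum_congr rfl fun j _ => by rw [mul_pow]; ring
  have h4 : ‖2 * π * I * s * (⟪(x:V), y⟫ : ℝ)‖ ≤ 2 * π * ‖y‖ * ‖(x:V)‖ * ‖s‖ := by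
    simp only [norm_mul, norm_real, norm_I, mul_one, Complex.norm_ofNat, Real.norm_eq_abs,
      abs_of_pos Real.pi_pos]
    have := abs_real_inner_le_norm (x:V) y
    calc 2 * π * ‖s‖ * |⟪(x:V), y⟫| ≤ 2 * π * ‖s‖ * (‖(x:V)‖ * ‖y‖) := by gcongr
      _ = _ := by ring
  have h5 : ‖2 * π * I * s * (⟪(x:V), y⟫ : ℝ)‖ ≤ 2 * π * ‖y‖ * ‖(x:V)‖ :=
    h4.trans (mul_le_of_le_one_right (by positivity) hs1)
  rw [h2, norm_mul, norm_cexp_gauss]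
  calc _ ≤ (‖2 * π * I * s * (⟪(x:V), y⟫ : ℝ)‖ ^ (d + 1) *
        Real.exp ‖2 * π * I * s * (⟪(x:V), y⟫ : ℝ)‖) * Real.exp (-(π * τ.im * ‖(x:V)‖ ^ 2)) := by
        gcongr
        exact Complex.norm_exp_sub_sum_le_norm_mul_exp _ _
    _ ≤ ((2 * π * ‖y‖ * ‖(x:V)‖ * ‖s‖) ^ (d + 1) * Real.exp (2 * π * ‖y‖ * ‖(x:V)‖)) *
        Real.exp (-(π * τ.im * ‖(x:V)‖ ^ 2)) := by gcongr
    _ = _ := by rw [sub_eq_add_neg, Real.exp_add]; ring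

variable {J : Type} [Fintype J]

lemma SelfDual.gauss_tendsto (hN : SelfDual N) {τ : ℂ} (hτ : 0 < τ.im) (c : J → ℂ) (y : J → V)
    (d : ℕ) (hlow : ∀ d' < d, ∑ j, c j * thetaPow N d' (y j) τ = 0) :
    Filter.Tendsto (fun s : ℂ => (∑ j, c j * gauss N τ s (y j)) / s ^ d) (nhdsWithin 0 {0}ᶜ)
      (nhds ((2 * π * I) ^ d / d.factorial * ∑ j, c j * thetaPow N d (y j) τ)) := by
  choose K hK using fun j => hN.gauss_expand hτ (y j) d
  set A := (2 * π * I) ^ d / d.factorial * ∑ j, c j * thetaPow N d (y j) τ with hA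
  have hbound : ∀ s : ℂ, s ≠ 0 → ‖s‖ ≤ 1 →
      ‖(∑ j, c j * gauss N τ s (y j)) / s ^ d - A‖ ≤ (∑ j, ‖c j‖ * K j) * ‖s‖ := by
    intro s hs0 hs1
    have h1 : ∑ j, c j * (∑ i ∈ Finset.range (d + 1),
      (2 * π * I * s) ^ i / i.factorial * thetaPow N i (y j) τ) = A * s ^ d := by
      simp_rw [Finset.mul_sum]
      rw [Finset.sum_comm, Finset.sum_range_succ, Finset.sum_eq_zero, zero_add, hA, Finset.mul_sum,
        Finset.sum_mul]
      · exact Finset.sum_congr rfl fun j _ => by rw [mul_pow _ s]; ring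
      · intro i hi
        have := hlow i (Finset.mem_range.1 hi)
        calc _ = (2 * π * I * s) ^ i / i.factorial * ∑ j, c j * thetaPow N i (y j) τ := by
              rw [Finset.mul_sum]; exact Finset.sum_congr rfl fun j _ => by ring
          _ = 0 := by rw [this, mul_zero]
    have h2 : (∑ j, c j * gauss N τ s (y j)) / s ^ d - A = (∑ j, c j * (gauss N τ s (y j) -
        ∑ i ∈ Finset.range (d + 1),
          (2 * π * I * s) ^ i / i.factorial * thetaPow N i (y j) τ)) / s ^ d := by
      simp_rw [mul_sub]
      rw [Finset.sum_sub_distrib, h1]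
      field_simp
    rw [h2, norm_div, norm_pow, div_le_iff₀ (by positivity), Finset.sum_mul, Finset.sum_mul]
    refine (norm_sum_le _ _).trans (Finset.sum_le_sum fun j _ => ?_)
    rw [norm_mul]
    calc _ ≤ ‖c j‖ * (K j * ‖s‖ ^ (d + 1)) := by gcongr; exact hK j s hs1
      _ = _ := by ring
  rw [tendsto_iff_norm_sub_tendsto_zero]
  refine squeeze_zero' (Filter.Eventually.of_forall fun _ => norm_nonneg _)
    (g := fun s => (∑ j, ‖c j‖ * K j) * ‖s‖) ?_ ?_
  · filter_upwards [self_mem_nhdsWithin, mem_nhdsWithin_of_mem_nhds (Metric.closedBall_mem_nhds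
      (0:ℂ) one_pos)] with s h1 h2
    exact hbound s h1 (by simpa using h2)
  · have : Continuous fun s : ℂ => (∑ j, ‖c j‖ * K j) * ‖s‖ := by fun_prop
    have h := this.tendsto 0
    rw [norm_zero, mul_zero] at h
    exact h.mono_left nhdsWithin_le_nhds

/-- Transformation of weighted theta functions under `τ ↦ -1 / τ`. -/
theorem SelfDual.thetaPow_neg_inv (hN : SelfDual N) {k : ℕ} (hk : Module.finrank ℝ V = 8 * k)
    {τ : ℂ} (hτ : 0 < τ.im) (c : J → ℂ) (y : J → V) (q : ℝ) (hq : ∀ j, ⟪y j, y j⟫ = q) (d : ℕ)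
    (hlow : ∀ τ : ℂ, 0 < τ.im → ∀ d' < d, ∑ j, c j * thetaPow N d' (y j) τ = 0) :
    ∑ j, c j * thetaPow N d (y j) (-1 / τ) =
      τ ^ (4 * k + d) * ∑ j, c j * thetaPow N d (y j) τ := by
  have h0 : τ ≠ 0 := fun h => by simp [h] at hτ
  have hτ' : 0 < (-1 / τ).im := by
    rw [neg_div, neg_im, one_div, Complex.inv_im, neg_div, neg_neg]
    exact div_pos hτ (Complex.normSq_pos.2 h0)
  have hinv : ∀ (s : ℝ) j, gauss N (-1 / τ) s (y j) =
      τ ^ (4 * k) * cexp (π * I * τ * s ^ 2 * q) * gauss N τ (τ * s) (y j) := by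
    intro s j
    have h := hN.gauss_neg_inv hτ s (y j)
    rw [hk, hq j, show (((8 * k : ℕ) : ℂ) / 2) = ((4 * k : ℕ) : ℂ) by push_cast; ring,
      cpow_natCast, div_pow, pow_mul I, I_pow_four, one_pow] at h
    rw [mul_assoc, ← h]
    field_simp
  have t1 := hN.gauss_tendsto hτ' c y d (hlow _ hτ')
  have t2 := hN.gauss_tendsto hτ c y d (hlow _ hτ)
  have hr : Filter.Tendsto (fun s : ℝ => (s:ℂ)) (nhdsWithin 0 {0}ᶜ) (nhdsWithin 0 {0}ᶜ) := by
    refine tendsto_nhdsWithin_iff.2 ⟨?_, ?_⟩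
    · exact (Complex.continuous_ofReal.tendsto' 0 0 (by simp)).mono_left nhdsWithin_le_nhds
    · filter_upwards [self_mem_nhdsWithin] with s hs
      simpa using hs
  have hr' : Filter.Tendsto (fun s : ℝ => τ * s) (nhdsWithin 0 {0}ᶜ) (nhdsWithin 0 {0}ᶜ) := by
    refine tendsto_nhdsWithin_iff.2 ⟨?_, ?_⟩
    · have : Continuous fun s : ℝ => τ * s := by fun_prop
      exact (this.tendsto' 0 0 (by simp)).mono_left nhdsWithin_le_nhds
    · filter_upwards [self_mem_nhdsWithin] with s hs
      simpa [h0] using hs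
  have t3 := t1.comp hr
  have hexp : Filter.Tendsto (fun s : ℝ => τ ^ (4 * k) * cexp (π * I * τ * s ^ 2 * q) * τ ^ d)
      (nhdsWithin 0 {0}ᶜ) (nhds (τ ^ (4 * k) * τ ^ d)) := by
    have : Continuous fun s : ℝ => τ ^ (4 * k) * cexp (π * I * τ * s ^ 2 * q) * τ ^ d := by fun_prop
    exact (this.tendsto' 0 _ (by simp)).mono_left nhdsWithin_le_nhds
  have t4 := hexp.mul (t2.comp hr')
  have heq : (fun s : ℝ => τ ^ (4 * k) * cexp (π * I * τ * s ^ 2 * q) * τ ^ d *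
      ((fun s : ℂ => (∑ j, c j * gauss N τ s (y j)) / s ^ d) ∘ fun s : ℝ => τ * s) s) =ᶠ[
      nhdsWithin 0 {0}ᶜ]
      ((fun s : ℂ => (∑ j, c j * gauss N (-1 / τ) s (y j)) / s ^ d) ∘ fun s : ℝ => (s:ℂ)) := by
    filter_upwards [self_mem_nhdsWithin] with s hs
    have hs' : (s:ℂ) ≠ 0 := by simpa using hs
    simp only [Function.comp, hinv]
    rw [mul_pow, Finset.sum_div, Finset.sum_div, Finset.mul_sum]
    refine Finset.sum_congr rfl fun j _ => ?_
    field_simp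
  have hlim := tendsto_nhds_unique t3 (t4.congr' heq)
  have hcst : (2 * π * I : ℂ) ^ d / d.factorial ≠ 0 := by
    have hpi : (π:ℂ) ≠ 0 := by exact_mod_cast Real.pi_ne_zero
    have : (d.factorial : ℂ) ≠ 0 := by exact_mod_cast d.factorial_ne_zero
    simp [hpi, this]
  refine mul_left_cancel₀ hcst (hlim.trans ?_)
  rw [pow_add]; ring

lemma Even.thetaPow_add_one (hE : Even N) (d : ℕ) (y : V) (τ : ℂ) :
    thetaPow N d y (τ + 1) = thetaPow N d y τ := by
  refine tsum_congr fun x => ?_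
  obtain ⟨k, hk⟩ := hE x x.2
  rw [hk]
  push_cast
  rw [show (π:ℂ) * I * (τ + 1) * (2 * k) = π * I * τ * (2 * k) + k * (2 * π * I) by ring]
  congr 1
  exact Complex.exp_periodic.int_mul k _

end SDLattice

namespace SDLattice
open Complex UpperHalfPlane ModularForm MatrixGroups Matrix.SpecialLinearGroup
open Function (Periodic)
open Function.Periodic (qParam)
open scoped Real
variable {V : Type} [NormedAddCommGroup V] [InnerProductSpace ℝ V] [FiniteDimensional ℝ V]
  {N : AddSubgroup V}

lemma SelfDual.hasSum_thetaPow (hN : SelfDual N) (hE : Even N) (d : ℕ) (y : V) (τ : ℍ) :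
    HasSum (fun m : ℕ => ((∑ x ∈ shell N m, ⟪x, y⟫ ^ d : ℝ) : ℂ) * qParam 1 τ ^ m)
      (thetaPow N d y τ) := by
  have hφ : ∀ x : N, ⟪(x:V), x⟫ = 2 * ((⌊⟪(x:V), x⟫ / 2⌋₊ : ℕ) : ℝ) := by
    intro x
    obtain ⟨k, hk⟩ := hE x x.2
    have h0 : (0:ℝ) ≤ k := by
      have := real_inner_self_nonneg (x := (x:V))
      rw [hk] at this
      linarith
    lift k to ℕ using (by exact_mod_cast h0)
    rw [hk]
    simp
  set φ : N → ℕ := fun x => ⌊⟪(x:V), x⟫ / 2⌋₊ with hφd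
  have h := (hN.summable_thetaPow d y τ.im_pos).hasSum.tsum_fiberwise φ
  refine h.congr_fun fun m => ?_
  let e : φ ⁻¹' {m} ≃ shell N m :=
    { toFun := fun x => ⟨x.1, hN.mem_shell.2 ⟨x.1.2, by
        rw [hφ x.1, show ⌊⟪(x.1:V), x.1⟫ / 2⌋₊ = m from x.2]⟩⟩
      invFun := fun x => ⟨⟨x.1, (hN.mem_shell.1 x.2).1⟩, by
        change ⌊⟪(x:V), x⟫ / 2⌋₊ = m
        rw [(hN.mem_shell.1 x.2).2]
        simp⟩
      left_inv := fun x => rfl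
      right_inv := fun x => rfl }
  rw [← e.symm.tsum_eq, tsum_fintype, Finset.univ_eq_attach, ofReal_sum, Finset.sum_mul,
    ← Finset.sum_attach]
  refine Finset.sum_congr rfl fun x _ => ?_
  have hx := (hN.mem_shell.1 x.2).2
  change _ = (⟪(x:V), y⟫ : ℂ) ^ d * cexp (π * Complex.I * τ * ⟪(x:V), x⟫)
  rw [hx, qParam, ← Complex.exp_nat_mul]
  push_cast
  congr 2
  ring

variable {J : Type} [Fintype J]

theorem SelfDual.exists_modularForm (hN : SelfDual N) (hE : Even N) {k : ℕ}
    (hk : Module.finrank ℝ V = 8 * k) (c : J → ℝ) (y : J → V) (q : ℝ) (hq : ∀ j, ⟪y j, y j⟫ = q)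
    (d : ℕ) (hlow : ∀ d' < d, ∀ m, ∑ x ∈ shell N m, ∑ j, c j * ⟪x, y j⟫ ^ d' = 0) :
    ∃ f : ModularForm 𝒮ℒ ((4 * k + d : ℕ) : ℤ), ∀ m : ℕ, (qExpansion 1 f).coeff m =
      ((∑ x ∈ shell N m, ∑ j, c j * ⟪x, y j⟫ ^ d : ℝ) : ℂ) := by
  have hsum : ∀ (d : ℕ) (τ : ℍ), HasSum (fun m : ℕ =>
      ((∑ x ∈ shell N m, ∑ j, c j * ⟪x, y j⟫ ^ d : ℝ) : ℂ) • qParam 1 τ ^ m)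
      (∑ j, (c j : ℂ) * thetaPow N d (y j) τ) := by
    intro d τ
    have h := hasSum_sum (s := Finset.univ) fun j _ =>
      (hN.hasSum_thetaPow hE d (y j) τ).mul_left (c j : ℂ)
    refine h.congr_fun fun m => ?_
    rw [Finset.sum_comm, smul_eq_mul]
    push_cast
    rw [Finset.sum_mul]
    refine Finset.sum_congr rfl fun j _ => ?_
    rw [← Finset.mul_sum, mul_assoc]
  have hlow' : ∀ τ : ℂ, 0 < τ.im → ∀ d' < d, ∑ j, (c j : ℂ) * thetaPow N d' (y j) τ = 0 := by
    intro τ hτ d' hd'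
    have h := hsum d' ⟨τ, hτ⟩
    simp only [hlow d' hd', ofReal_zero, zero_smul] at h
    exact h.unique hasSum_zero
  set F : ℍ → ℂ := fun τ => ∑ j, (c j : ℂ) * thetaPow N d (y j) τ with hF
  have hS : (F ∣[((4 * k + d : ℕ) : ℤ)] ModularGroup.S) = F := by
    ext z
    have hz := hN.thetaPow_neg_inv hk z.im_pos (fun j => (c j : ℂ)) y q hq d hlow'
    have hz0 : (z:ℂ) ≠ 0 := z.ne_zero
    rw [SL_slash_apply, UpperHalfPlane.modular_S_smul]
    have hd : denom ModularGroup.S z = z := by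
      rw [ModularGroup.denom_apply]; simp [ModularGroup.S]
    rw [hd]
    simp only [hF]
    rw [show (-(z:ℂ))⁻¹ = -1 / (z:ℂ) by simp [neg_div, inv_neg], hz, zpow_neg, zpow_natCast]
    field_simp
  have hT : (F ∣[((4 * k + d : ℕ) : ℤ)] ModularGroup.T) = F := by
    ext z
    rw [SL_slash_apply, UpperHalfPlane.modular_T_smul]
    have hd : denom ModularGroup.T z = 1 := by
      rw [ModularGroup.denom_apply]; simp [ModularGroup.T]
    rw [hd]
    simp only [hF, one_zpow, mul_one]
    refine Finset.sum_congr rfl fun j _ => ?_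
    rw [← hE.thetaPow_add_one d (y j) z]
    congr 2
    simp [add_comm]
  have hgen := SlashInvariantForm.slash_action_generators_SL2Z hS hT
  have hbdd : IsBoundedAtImInfty F := isBoundedAtImInfty_of_hasSum_qExpansion one_pos (hsum d)
  have hdiff : ∀ y : V, DifferentiableOn ℂ (fun τ => thetaPow N d y τ) upperHalfPlaneSet := by
    intro y τ hτ
    refine DifferentiableAt.differentiableWithinAt ?_
    have h1 : 0 < τ.im / 2 := half_pos hτ
    have hopen : IsOpen {w : ℂ | τ.im / 2 < w.im} := isOpen_lt continuous_const continuous_im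
    refine (differentiableOn_tsum_of_summable_norm
      ((hN.summable_gauss d 0 (mul_pos Real.pi_pos h1)).mul_left (‖y‖ ^ d))
      (F := fun (x : N) w => (⟪(x:V), y⟫ : ℂ) ^ d * cexp (π * Complex.I * w * ⟪(x:V), x⟫))
      (U := {w : ℂ | τ.im / 2 < w.im}) (fun x => ?_) hopen fun x w hw => ?_).differentiableAt
      (hopen.mem_nhds (show τ.im / 2 < τ.im from half_lt_self hτ))
    · fun_prop
    · rw [norm_mul, norm_cexp_gauss, norm_pow, norm_real]
      rw [show ‖y‖ ^ d * (‖(x:V)‖ ^ d * Real.exp (0 * ‖(x:V)‖ - π * (τ.im / 2) * ‖(x:V)‖ ^ 2)) =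
        (‖(x:V)‖ * ‖y‖) ^ d * Real.exp (-(π * (τ.im / 2) * ‖(x:V)‖ ^ 2)) by rw [mul_pow]; ring_nf]
      have hw' : τ.im / 2 ≤ w.im := le_of_lt hw
      gcongr
      exact norm_inner_le_norm _ _
  let f : ModularForm 𝒮ℒ ((4 * k + d : ℕ) : ℤ) :=
    { toFun := F
      slash_action_eq' := ?_
      holo' := ?_
      bdd_at_cusps' := ?_ }
  · exact ⟨f, fun m => (ModularFormClass.qExpansion_coeff_unique (f := f) one_pos
      one_mem_strictPeriods_SL (hsum d) m).symm⟩
  · rintro A ⟨A, rfl⟩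
    exact hgen A
  · rw [UpperHalfPlane.mdifferentiable_iff]
    have : DifferentiableOn ℂ (fun τ => ∑ j, (c j : ℂ) * thetaPow N d (y j) τ)
      upperHalfPlaneSet := DifferentiableOn.fun_sum fun j _ => (hdiff (y j)).const_mul _
    refine this.congr fun z hz => ?_
    simp [hF, ofComplex_apply_of_im_pos hz]
  · intro c hc
    rw [OnePoint.isBoundedAt_iff_forall_SL2Z hc]
    intro γ _
    exact (hgen γ).symm ▸ hbdd

end SDLattice

namespace SDLattice
open UpperHalfPlane ModularForm MatrixGroups Matrix.SpecialLinearGroup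
variable {V : Type} [NormedAddCommGroup V] [InnerProductSpace ℝ V] [FiniteDimensional ℝ V]
  {N : AddSubgroup V}

lemma coeff_eq_zero_of_sturm {k : ℕ} (f : ModularForm 𝒮ℒ (k : ℤ))
    (h : ∀ m ≤ k / 12, (qExpansion 1 f).coeff m = 0) (m : ℕ) : (qExpansion 1 f).coeff m = 0 := by
  have h1 : f = 0 := by
    refine sturm_bound_levelOne_nat (lt_of_lt_of_le ?_
      (PowerSeries.nat_le_order _ (k / 12 + 1) fun i hi => h i (by omega)))
    exact_mod_cast Nat.lt_succ_self _
  rw [h1]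
  simp [qExpansion_zero]

lemma coeff_eq_zero_of_weight_fourteen (f : ModularForm 𝒮ℒ ((14 : ℕ) : ℤ))
    (h : (qExpansion 1 f).coeff 0 = 0) (m : ℕ) : (qExpansion 1 f).coeff m = 0 := by
  have h2 : CuspForm.discriminantEquiv (toCuspForm f h) = 0 :=
    rank_zero_iff_forall_zero.mp levelOne_weight_two_rank_zero _
  have h1 : f = 0 := by
    simpa [CuspForm.discriminantEquiv.map_eq_zero_iff, DFunLike.ext_iff] using h2
  rw [h1]
  simp [qExpansion_zero]

lemma SelfDual.shell_zero (hN : SelfDual N) : shell N 0 = {0} := by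
  ext x
  rw [hN.mem_shell, Finset.mem_singleton]
  constructor
  · rintro ⟨-, h⟩
    simpa using h
  · rintro rfl
    exact ⟨N.zero_mem, by simp⟩

lemma SelfDual.shell_odd (hN : SelfDual N) (m : ℕ) (y : V) {d : ℕ} (hd : Odd d) :
    ∑ x ∈ shell N m, ⟪x, y⟫ ^ d = 0 := by
  have h : ∑ x ∈ shell N m, ⟪x, y⟫ ^ d = ∑ x ∈ shell N m, -⟪x, y⟫ ^ d := by
    refine Finset.sum_nbij' (fun x => -x) (fun x => -x) ?_ ?_ (fun x _ => neg_neg x)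
      (fun x _ => neg_neg x) fun x _ => ?_
    · intro x hx
      rw [hN.mem_shell] at hx ⊢
      exact ⟨N.neg_mem hx.1, by rw [inner_neg_neg]; exact hx.2⟩
    · intro x hx
      rw [hN.mem_shell] at hx ⊢
      exact ⟨N.neg_mem hx.1, by rw [inner_neg_neg]; exact hx.2⟩
    · rw [inner_neg_left, hd.neg_pow, neg_neg]
  rw [Finset.sum_neg_distrib] at h
  linarith

lemma SelfDual.shell_zero_pow (hN : SelfDual N) {y y' : V} (d : ℕ) :
    ∑ x ∈ shell N 0, ⟪x, y⟫ ^ d = ∑ x ∈ shell N 0, ⟪x, y'⟫ ^ d := by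
  simp [hN.shell_zero]

/-- The difference of two weighted theta functions is a modular form if the lower ones agree. -/
lemma SelfDual.exists_modularForm_pair (hN : SelfDual N) (hE : Even N) {k : ℕ}
    (hk : Module.finrank ℝ V = 8 * k) {y y' : V} (hy : ⟪y, y⟫ = ⟪y', y'⟫) (d : ℕ)
    (hlow : ∀ d' < d, ∀ m, ∑ x ∈ shell N m, ⟪x, y⟫ ^ d' = ∑ x ∈ shell N m, ⟪x, y'⟫ ^ d') :
    ∃ f : ModularForm 𝒮ℒ ((4 * k + d : ℕ) : ℤ), ∀ m : ℕ, (qExpansion 1 f).coeff m =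
      ((∑ x ∈ shell N m, ⟪x, y⟫ ^ d - ∑ x ∈ shell N m, ⟪x, y'⟫ ^ d : ℝ) : ℂ) := by
  have key : ∀ d m, ∑ x ∈ shell N m, ∑ j : Fin 2, (![1, -1] j : ℝ) * ⟪x, ![y, y'] j⟫ ^ d =
      ∑ x ∈ shell N m, ⟪x, y⟫ ^ d - ∑ x ∈ shell N m, ⟪x, y'⟫ ^ d := by
    intro d m
    rw [← Finset.sum_sub_distrib]
    refine Finset.sum_congr rfl fun x _ => ?_
    rw [Fin.sum_univ_two]
    simp only [Matrix.cons_val_zero, Matrix.cons_val_one]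
    ring
  obtain ⟨f, hf⟩ := hN.exists_modularForm hE hk ![1, -1] ![y, y'] ⟪y', y'⟫
    (fun j => by fin_cases j; exacts [hy, rfl]) d
    (fun d' hd' m => by rw [key, hlow d' hd' m, sub_self])
  exact ⟨f, fun m => by rw [hf, key]⟩

/-- Equality of low-degree power sums over small shells propagates to all shells. -/
theorem SelfDual.shell_pow_eq (hN : SelfDual N) (hE : Even N) {k : ℕ}
    (hk : Module.finrank ℝ V = 8 * k) {y y' : V} (hy : ⟪y, y⟫ = ⟪y', y'⟫) (D : ℕ)
    (hD : (4 * k + D) / 12 ≤ 1)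
    (h1 : ∀ d ≤ D, ∑ x ∈ shell N 1, ⟪x, y⟫ ^ d = ∑ x ∈ shell N 1, ⟪x, y'⟫ ^ d) (d : ℕ)
    (hd : d ≤ D) (m : ℕ) :
    ∑ x ∈ shell N m, ⟪x, y⟫ ^ d = ∑ x ∈ shell N m, ⟪x, y'⟫ ^ d := by
  induction d using Nat.strong_induction_on generalizing m with | _ d ih =>
  obtain ⟨f, hf⟩ := hN.exists_modularForm_pair hE hk hy d
    (fun d' hd' m => ih d' hd' (by omega) m)
  have h := coeff_eq_zero_of_sturm f (fun m hm => ?_) m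
  · rw [hf] at h
    exact sub_eq_zero.1 (by exact_mod_cast h)
  · have hm1 : m ≤ 1 := hm.trans ((Nat.div_le_div_right (by omega)).trans hD)
    rw [hf]
    interval_cases m
    · rw [hN.shell_zero_pow (y' := y') d, sub_self, Complex.ofReal_zero]
    · rw [h1 d hd, sub_self, Complex.ofReal_zero]

/-- Shells of an even self-dual lattice of rank `24` are `2`-designs. -/
theorem SelfDual.shell_sq_eq (hN : SelfDual N) (hE : Even N)
    (hk : Module.finrank ℝ V = 24) {y y' : V} (hy : ⟪y, y⟫ = ⟪y', y'⟫) (m : ℕ) :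
    ∑ x ∈ shell N m, ⟪x, y⟫ ^ 2 = ∑ x ∈ shell N m, ⟪x, y'⟫ ^ 2 := by
  obtain ⟨f, hf⟩ := hN.exists_modularForm_pair hE (k := 3) hk hy 2 (fun d' hd' m => by
    interval_cases d'
    · simp
    · rw [hN.shell_odd m y odd_one, hN.shell_odd m y' odd_one])
  have h := coeff_eq_zero_of_weight_fourteen f (by
    rw [hf, hN.shell_zero_pow (y' := y') 2, sub_self, Complex.ofReal_zero]) m
  rw [hf] at h
  exact sub_eq_zero.1 (by exact_mod_cast h)

/-- In a rootless even self-dual lattice of rank `24` all shells are `11`-designs. -/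
theorem SelfDual.shell_pow_eq_of_rootless (hN : SelfDual N) (hE : Even N)
    (hk : Module.finrank ℝ V = 24) (h1 : shell N 1 = ∅) {y y' : V} (hy : ⟪y, y⟫ = ⟪y', y'⟫)
    (d : ℕ) (hd : d ≤ 11) (m : ℕ) :
    ∑ x ∈ shell N m, ⟪x, y⟫ ^ d = ∑ x ∈ shell N m, ⟪x, y'⟫ ^ d :=
  hN.shell_pow_eq hE (k := 3) hk hy 11 (by norm_num) (fun d _ => by simp [h1]) d hd m

lemma E₄_coeff_two : (qExpansion 1 E₄).coeff 2 = 2160 := by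
  norm_num [EisensteinSeries.E_qExpansion_coeff _ ⟨2, rfl⟩,
    show bernoulli 4 = -1 / 30 by decide +kernel,
    show ArithmeticFunction.sigma 3 2 = 9 by decide +kernel]

lemma E₆_coeff_two : (qExpansion 1 E₆).coeff 2 = -16632 := by
  norm_num [EisensteinSeries.E_qExpansion_coeff _ ⟨3, rfl⟩,
    show bernoulli 6 = 1 / 42 by decide +kernel,
    show ArithmeticFunction.sigma 5 2 = 33 by decide +kernel]

lemma E₄_coeff_zero : (qExpansion 1 E₄).coeff 0 = 1 :=
  EisensteinSeries.E_qExpansion_coeff_zero _ ⟨2, rfl⟩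

lemma E₆_coeff_zero : (qExpansion 1 E₆).coeff 0 = 1 :=
  EisensteinSeries.E_qExpansion_coeff_zero _ ⟨3, rfl⟩

lemma coeff_mul_zero' (p q : PowerSeries ℂ) : (p * q).coeff 0 = p.coeff 0 * q.coeff 0 := by
  simp [PowerSeries.coeff_mul]

lemma coeff_mul_one' (p q : PowerSeries ℂ) :
    (p * q).coeff 1 = p.coeff 0 * q.coeff 1 + p.coeff 1 * q.coeff 0 := by
  simp [PowerSeries.coeff_mul, Finset.Nat.antidiagonal_succ]

lemma coeff_mul_two' (p q : PowerSeries ℂ) : (p * q).coeff 2 =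
    p.coeff 0 * q.coeff 2 + p.coeff 1 * q.coeff 1 + p.coeff 2 * q.coeff 0 := by
  simp [PowerSeries.coeff_mul, Finset.Nat.antidiagonal_succ]
  ring

lemma qExp_add {k : ℤ} (f g : ModularForm 𝒮ℒ k) :
    qExpansion 1 ⇑(f + g) = qExpansion 1 f + qExpansion 1 g := by
  rw [FunLike.coe_add]
  exact ModularForm.qExpansion_add one_pos one_mem_strictPeriods_SL f g

lemma qExp_sub {k : ℤ} (f g : ModularForm 𝒮ℒ k) :
    qExpansion 1 ⇑(f - g) = qExpansion 1 f - qExpansion 1 g := by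
  rw [FunLike.coe_sub]
  exact ModularForm.qExpansion_sub one_pos one_mem_strictPeriods_SL f g

lemma qExp_smul {k : ℤ} (a : ℂ) (f : ModularForm 𝒮ℒ k) :
    qExpansion 1 ⇑(a • f) = a • qExpansion 1 f := by
  rw [FunLike.coe_smul]
  exact ModularForm.qExpansion_smul one_pos one_mem_strictPeriods_SL a f

lemma qExp_pow {k : ℤ} (f : ModularForm 𝒮ℒ k) (n : ℕ) :
    qExpansion 1 ⇑(f.pow n) = qExpansion 1 f ^ n :=
  ModularForm.qExpansion_pow one_pos one_mem_strictPeriods_SL f n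

lemma qExp_mul {k l : ℤ} (f : ModularForm 𝒮ℒ k) (g : ModularForm 𝒮ℒ l) :
    qExpansion 1 ⇑(f.mul g) = qExpansion 1 f * qExpansion 1 g :=
  ModularForm.qExpansion_mul one_pos one_mem_strictPeriods_SL f g

/-- The second coefficient of a form of weight `12` with first coefficients `1, 0`. -/
lemma coeff_two_of_weight_twelve (f : ModularForm 𝒮ℒ ((12 : ℕ) : ℤ))
    (h0 : (qExpansion 1 f).coeff 0 = 1) (h1 : (qExpansion 1 f).coeff 1 = 0) :
    (qExpansion 1 f).coeff 2 = 196560 := by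
  let g : ModularForm 𝒮ℒ ((12 : ℕ) : ℤ) := (7 / 12 : ℂ) • ModularForm.mcast (by decide) (E₄.pow 3)
    + (5 / 12 : ℂ) • ModularForm.mcast (by decide) (E₆.pow 2)
  have hg : qExpansion 1 g = (7 / 12 : ℂ) • qExpansion 1 E₄ ^ 3 +
      (5 / 12 : ℂ) • qExpansion 1 E₆ ^ 2 := by
    rw [qExp_add, qExp_smul, qExp_smul, ModularForm.qExpansion_mcast,
      ModularForm.qExpansion_mcast, qExp_pow, qExp_pow]
  have hfg : qExpansion 1 ⇑(f - g) = qExpansion 1 f - qExpansion 1 g := qExp_sub f g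
  have h := coeff_eq_zero_of_sturm (f - g) (fun m hm => ?_) 2
  · rw [hfg, hg] at h
    simp only [map_sub, map_add, PowerSeries.coeff_smul, pow_succ, pow_zero, one_mul,
      coeff_mul_zero', coeff_mul_one', coeff_mul_two', E₄_coeff_zero, E₆_coeff_zero,
      E₄_qExpansion_coeff_one, E₆_qExpansion_coeff_one, E₄_coeff_two, E₆_coeff_two] at h
    rw [sub_eq_zero] at h
    rw [h]
    norm_num
  · have hm1 : m ≤ 1 := hm
    rw [hfg, hg]
    interval_cases m
    · simp only [map_sub, map_add, PowerSeries.coeff_smul, pow_succ, pow_zero, one_mul,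
        coeff_mul_zero', E₄_coeff_zero, E₆_coeff_zero, h0]
      norm_num
    · simp only [map_sub, map_add, PowerSeries.coeff_smul, pow_succ, pow_zero, one_mul,
        coeff_mul_zero', coeff_mul_one', E₄_coeff_zero, E₆_coeff_zero, h1,
        E₄_qExpansion_coeff_one, E₆_qExpansion_coeff_one]
      norm_num

/-- The second coefficient of a cusp form of weight `20`. -/
lemma coeff_two_of_weight_twenty (f : ModularForm 𝒮ℒ ((20 : ℕ) : ℤ))
    (h0 : (qExpansion 1 f).coeff 0 = 0) :
    (qExpansion 1 f).coeff 2 = 456 * (qExpansion 1 f).coeff 1 := by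
  set a := (qExpansion 1 f).coeff 1 with ha
  let g : ModularForm 𝒮ℒ ((20 : ℕ) : ℤ) := (a / 1728) • (ModularForm.mcast (by decide) (E₄.pow 5)
    - ModularForm.mcast (by decide) ((E₄.pow 2).mul (E₆.pow 2)))
  have hg : qExpansion 1 g = (a / 1728) • (qExpansion 1 E₄ ^ 5 -
      qExpansion 1 E₄ ^ 2 * qExpansion 1 E₆ ^ 2) := by
    rw [qExp_smul, qExp_sub, ModularForm.qExpansion_mcast,
      ModularForm.qExpansion_mcast, qExp_mul, qExp_pow, qExp_pow, qExp_pow]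
  have hfg : qExpansion 1 ⇑(f - g) = qExpansion 1 f - qExpansion 1 g := qExp_sub f g
  have h := coeff_eq_zero_of_sturm (f - g) (fun m hm => ?_) 2
  · rw [hfg, hg] at h
    simp only [map_sub, PowerSeries.coeff_smul, pow_succ, pow_zero, one_mul,
      coeff_mul_zero', coeff_mul_one', coeff_mul_two', E₄_coeff_zero, E₆_coeff_zero,
      E₄_qExpansion_coeff_one, E₆_qExpansion_coeff_one, E₄_coeff_two, E₆_coeff_two] at h
    rw [sub_eq_zero] at h
    rw [h, smul_eq_mul]
    ring
  · have hm1 : m ≤ 1 := hm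
    rw [hfg, hg]
    interval_cases m
    · simp only [map_sub, PowerSeries.coeff_smul, pow_succ, pow_zero, one_mul,
        coeff_mul_zero', E₄_coeff_zero, E₆_coeff_zero, h0]
      norm_num
    · simp only [map_sub, PowerSeries.coeff_smul, pow_succ, pow_zero, one_mul,
        coeff_mul_zero', coeff_mul_one', E₄_coeff_zero, E₆_coeff_zero, ← ha,
        E₄_qExpansion_coeff_one, E₆_qExpansion_coeff_one, smul_eq_mul]
      ring

/-- A rootless even self-dual lattice of rank `24` has `196560` vectors of norm `4`. -/
theorem SelfDual.card_shell_two (hN : SelfDual N) (hE : Even N)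
    (hk : Module.finrank ℝ V = 24) (h1 : shell N 1 = ∅) : (shell N 2).card = 196560 := by
  obtain ⟨f, hf⟩ := hN.exists_modularForm hE (k := 3) hk (fun _ : Unit => 1) (fun _ => 0) 0
    (by simp) 0 (by simp)
  have h := coeff_two_of_weight_twelve f (by rw [hf]; simp [hN.shell_zero]) (by rw [hf]; simp [h1])
  rw [hf] at h
  simp only [pow_zero, mul_one, Finset.univ_unique, Finset.sum_const, Finset.card_singleton,
    one_smul, nsmul_eq_mul, Complex.ofReal_natCast] at h
  exact_mod_cast h

end SDLattice

/-! ### Neighbours, sums with cubic lattices and moments -/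

namespace SDLattice

variable {V : Type} [NormedAddCommGroup V] [InnerProductSpace ℝ V]

lemma isInt_or_half {a : ℝ} (h : IsInt (2 * a)) : IsInt a ∨ IsInt (a - 1 / 2) := by
  obtain ⟨k, hk⟩ := h
  rcases Int.even_or_odd' k with ⟨l, rfl | rfl⟩
  · left; exact ⟨l, by push_cast at hk; linarith⟩
  · right; exact ⟨l, by push_cast at hk; linarith⟩

/-- The neighbour of a unimodular lattice with respect to the half vector `z`. -/
theorem SelfDual.exists_neighbor {U : AddSubgroup V} (hU : SelfDual U) {z : V} (h2 : z + z ∈ U)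
    (hz : ∃ k : ℤ, ⟪z, z⟫ = 2 * (k : ℝ))
    (hev : ∀ u ∈ U, IsInt ⟪u, z⟫ → ∃ k : ℤ, ⟪u, u⟫ = 2 * (k : ℝ)) :
    ∃ E : AddSubgroup V, SelfDual E ∧ Even E ∧
      ∀ x, x ∈ E ↔ IsInt ⟪x, z⟫ ∧ (x ∈ U ∨ x - z ∈ U) := by
  have hzz : IsInt ⟪z, z⟫ := by
    obtain ⟨k, hk⟩ := hz; rw [hk]; exact isInt_two.mul (isInt_intCast k)
  let E : AddSubgroup V :=
    { carrier := {x | IsInt ⟪x, z⟫ ∧ (x ∈ U ∨ x - z ∈ U)}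
      zero_mem' := ⟨by rw [inner_zero_left]; exact isInt_zero, Or.inl U.zero_mem⟩
      add_mem' := by
        rintro a b ⟨ha, ha'⟩ ⟨hb, hb'⟩
        refine ⟨by rw [inner_add_left]; exact ha.add hb, ?_⟩
        rcases ha' with ha' | ha' <;> rcases hb' with hb' | hb'
        · exact Or.inl (U.add_mem ha' hb')
        · right; rw [add_sub_assoc]; exact U.add_mem ha' hb'
        · right; rw [add_sub_right_comm]; exact U.add_mem ha' hb'
        · left
          have := U.add_mem (U.add_mem ha' hb') h2
          rwa [show a - z + (b - z) + (z + z) = a + b by abel] at this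
      neg_mem' := by
        rintro a ⟨ha, ha'⟩
        refine ⟨by rw [inner_neg_left]; exact ha.neg, ?_⟩
        rcases ha' with ha' | ha'
        · exact Or.inl (U.neg_mem ha')
        · right
          have := U.sub_mem (U.neg_mem ha') h2
          rwa [show -(a - z) - (z + z) = -a - z by abel] at this }
  have hE : ∀ x, x ∈ E ↔ IsInt ⟪x, z⟫ ∧ (x ∈ U ∨ x - z ∈ U) := fun x => Iff.rfl
  refine ⟨E, fun x => ⟨fun hx y hy => ?_, fun h => ?_⟩, ?_, hE⟩
  · rw [hE] at hx hy
    obtain ⟨hx, hx'⟩ := hx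
    obtain ⟨hy, hy'⟩ := hy
    rw [real_inner_comm] at hy
    rcases hx' with hx' | hx' <;> rcases hy' with hy' | hy'
    · exact hU.isInt hx' hy'
    · have := (hU.isInt hx' hy').add hx
      rwa [inner_sub_right, sub_add_cancel] at this
    · have := (hU.isInt hx' hy').add hy
      rwa [inner_sub_left, sub_add_cancel] at this
    · have := (((hU.isInt hx' hy').add hx).add hy).sub hzz
      simp only [inner_sub_left, inner_sub_right] at this
      convert this using 1; ring
  · have hxz : IsInt ⟪x, z⟫ := h z ((hE z).2 ⟨hzz, Or.inr (by simp)⟩)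
    have hE0 : ∀ u ∈ U, IsInt ⟪u, z⟫ → IsInt ⟪x, u⟫ := fun u hu hi => h u ((hE u).2 ⟨hi, Or.inl hu⟩)
    refine (hE x).2 ⟨hxz, ?_⟩
    by_cases hall : ∀ o ∈ U, IsInt ⟪o, z⟫
    · exact Or.inl ((hU x).2 fun u hu => hE0 u hu (hall u hu))
    push Not at hall
    obtain ⟨o, ho, hoz⟩ := hall
    have half : ∀ u ∈ U, IsInt ⟪u, z⟫ ∨ IsInt (⟪u, z⟫ - 1 / 2) := fun u hu => isInt_or_half (by
      have := hU.isInt hu h2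
      rwa [inner_add_right, ← two_mul] at this)
    have ho' := (half o ho).resolve_left hoz
    have hcoset : ∀ u ∈ U, ¬ IsInt ⟪u, z⟫ → IsInt ⟪u - o, z⟫ := fun u hu hi => by
      have := ((half u hu).resolve_left hi).sub ho'
      rw [inner_sub_left]; convert this using 1; ring
    have hxo : IsInt ⟪x, o⟫ ∨ IsInt (⟪x, o⟫ - 1 / 2) := isInt_or_half (by
      have := hE0 (o + o) (U.add_mem ho ho) (by
        have := (ho'.add ho').add isInt_one
        rw [inner_add_left]; convert this using 1; ring)
      rwa [inner_add_right, ← two_mul] at this)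
    rcases hxo with hxo | hxo
    · left
      refine (hU x).2 fun u hu => ?_
      by_cases hi : IsInt ⟪u, z⟫
      · exact hE0 u hu hi
      · have := (hE0 (u - o) (U.sub_mem hu ho) (hcoset u hu hi)).add hxo
        rwa [inner_sub_right, sub_add_cancel] at this
    · right
      have hx0 : ∀ u ∈ U, IsInt ⟪u, z⟫ → IsInt ⟪x - z, u⟫ := fun u hu hi => by
        rw [inner_sub_left, real_inner_comm u z]; exact (hE0 u hu hi).sub hi
      have hxo' : IsInt ⟪x - z, o⟫ := by
        rw [inner_sub_left, real_inner_comm o z]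
        have := hxo.sub ho'; convert this using 1; ring
      refine (hU _).2 fun u hu => ?_
      by_cases hi : IsInt ⟪u, z⟫
      · exact hx0 u hu hi
      · have := (hx0 (u - o) (U.sub_mem hu ho) (hcoset u hu hi)).add hxo'
        rwa [inner_sub_right, sub_add_cancel] at this
  · intro x hx
    obtain ⟨hi, hx | hx⟩ := (hE x).1 hx
    · exact hev x hx hi
    · obtain ⟨k, hk⟩ := hev _ hx (by rw [inner_sub_left]; exact hi.sub hzz)
      obtain ⟨l, hl⟩ := hz
      obtain ⟨m, hm⟩ := hi
      refine ⟨k + m - l, ?_⟩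
      simp only [inner_sub_left, inner_sub_right] at hk
      rw [real_inner_comm x z] at hk
      push_cast; linarith

/-- The orthogonal sum of a lattice with the cubic lattice of rank `m`. -/
def addCubic (N : AddSubgroup V) (m : ℕ) : AddSubgroup (WithLp 2 (V × EuclideanSpace ℝ (Fin m))) where
  carrier := {x | x.fst ∈ N ∧ ∀ i, IsInt (x.snd i)}
  zero_mem' := ⟨N.zero_mem, fun i => isInt_zero⟩
  add_mem' := by
    rintro a b ⟨ha, ha'⟩ ⟨hb, hb'⟩
    exact ⟨N.add_mem ha hb, fun i => (ha' i).add (hb' i)⟩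
  neg_mem' := by
    rintro a ⟨ha, ha'⟩
    exact ⟨N.neg_mem ha, fun i => (ha' i).neg⟩

variable {N : AddSubgroup V} {m : ℕ}

/-- The pair `(v, t)`. -/
def pair (v : V) (t : Fin m → ℝ) : WithLp 2 (V × EuclideanSpace ℝ (Fin m)) :=
  WithLp.toLp 2 (v, WithLp.toLp 2 t)

@[simp] lemma pair_fst (v : V) (t : Fin m → ℝ) : (pair v t).fst = v := rfl
@[simp] lemma pair_snd (v : V) (t : Fin m → ℝ) (i : Fin m) : (pair v t).snd i = t i := rfl

lemma inner_eq_add_sum (x y : WithLp 2 (V × EuclideanSpace ℝ (Fin m))) :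
    ⟪x, y⟫ = ⟪x.fst, y.fst⟫ + ∑ i, x.snd i * y.snd i := by
  rw [WithLp.prod_inner_apply, PiLp.inner_apply]
  congr 1
  exact Finset.sum_congr rfl fun i _ => by simp [mul_comm]

lemma isInt_sum {ι : Type} (s : Finset ι) (f : ι → ℝ) (h : ∀ i ∈ s, IsInt (f i)) :
    IsInt (∑ i ∈ s, f i) := by
  classical
  induction s using Finset.induction_on with
  | empty => simpa using isInt_zero
  | insert a s ha ih =>
    rw [Finset.sum_insert ha]
    exact (h a (Finset.mem_insert_self a s)).add
      (ih fun i hi => h i (Finset.mem_insert_of_mem hi))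

lemma SelfDual.addCubic (hN : SelfDual N) (m : ℕ) : SelfDual (addCubic N m) := by
  intro x
  constructor
  · rintro ⟨h1, h2⟩ y ⟨h3, h4⟩
    rw [inner_eq_add_sum]
    exact (hN.isInt h1 h3).add (isInt_sum _ _ fun i _ => (h2 i).mul (h4 i))
  · intro h
    constructor
    · refine (hN _).2 fun y hy => ?_
      have := h (pair y 0) ⟨hy, fun i => isInt_zero⟩
      rw [inner_eq_add_sum] at this
      simpa using this
    · intro i
      have := h (pair 0 (Pi.single i 1)) ⟨N.zero_mem, fun j => by
        rw [pair_snd]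
        by_cases hij : j = i
        · subst hij; simpa using isInt_one
        · simpa [Pi.single_eq_of_ne hij] using isInt_zero⟩
      rw [inner_eq_add_sum] at this
      simpa [Pi.single_apply] using this

lemma even_sum_sq_sub {ι : Type} (s : Finset ι) (f : ι → ℝ) (h : ∀ i ∈ s, IsInt (f i)) :
    ∃ k : ℤ, ∑ i ∈ s, f i * f i - ∑ i ∈ s, f i = 2 * (k : ℝ) := by
  have hh : ∀ i, ∃ k : ℤ, i ∈ s → f i * f i - f i = 2 * (k : ℝ) := fun i => by
    by_cases hi : i ∈ s
    · obtain ⟨l, hl⟩ := h i hi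
      obtain ⟨k, hk⟩ := Int.even_mul_pred_self l
      refine ⟨k, fun _ => ?_⟩
      have : ((l * (l - 1) : ℤ) : ℝ) = ((k + k : ℤ) : ℝ) := by rw [hk]
      push_cast at this
      rw [hl]; linarith
    · exact ⟨0, fun h => absurd h hi⟩
  choose k hk using hh
  refine ⟨∑ i ∈ s, k i, ?_⟩
  rw [← Finset.sum_sub_distrib, Int.cast_sum, Finset.mul_sum]
  exact Finset.sum_congr rfl fun i hi => hk i hi

lemma finrank_prod_eq [FiniteDimensional ℝ V] (m : ℕ) :
    Module.finrank ℝ (WithLp 2 (V × EuclideanSpace ℝ (Fin m))) = Module.finrank ℝ V + m := by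
  rw [(WithLp.linearEquiv 2 ℝ (V × EuclideanSpace ℝ (Fin m))).finrank_eq, Module.finrank_prod,
    finrank_euclideanSpace_fin]

/-- The even neighbour of `N ⊕ ℤᵐ` attached to a characteristic vector `c` of `N`. -/
theorem SelfDual.exists_even_glue (hN : SelfDual N) {c : V} (hc : c ∈ N)
    (hch : ∀ u ∈ N, ∃ k : ℤ, ⟪u, u⟫ - ⟪u, c⟫ = 2 * (k : ℝ)) (m : ℕ)
    (hm : ∃ k : ℤ, ⟪c, c⟫ + m = 8 * (k : ℝ)) :
    ∃ E : AddSubgroup (WithLp 2 (V × EuclideanSpace ℝ (Fin m))), SelfDual E ∧ Even E ∧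
      ∀ x, x ∈ E ↔ (∃ k : ℤ, ⟪x.fst, c⟫ + ∑ i, x.snd i = 2 * (k : ℝ)) ∧
        (x ∈ SDLattice.addCubic N m ∨
          (x.fst - (1 / 2 : ℝ) • c ∈ N ∧ ∀ i, IsInt (x.snd i - 1 / 2))) := by
  set z := pair ((1 / 2 : ℝ) • c) (fun _ : Fin m => (1 / 2 : ℝ)) with hz
  have hxz : ∀ x : WithLp 2 (V × EuclideanSpace ℝ (Fin m)), IsInt ⟪x, z⟫ ↔
      ∃ k : ℤ, ⟪x.fst, c⟫ + ∑ i, x.snd i = 2 * (k : ℝ) := fun x => by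
    rw [inner_eq_add_sum, hz]
    simp only [pair_fst, pair_snd, real_inner_smul_right, ← Finset.sum_mul]
    refine exists_congr fun k => ?_
    constructor <;> intro h <;> linarith
  obtain ⟨E, h1, h2, h3⟩ := (hN.addCubic m).exists_neighbor (z := z) (by
    refine ⟨?_, fun i => ?_⟩
    · change (1 / 2 : ℝ) • c + (1 / 2 : ℝ) • c ∈ N
      rwa [← add_smul, add_halves, one_smul]
    · change IsInt ((1 / 2 : ℝ) + 1 / 2)
      rw [add_halves]; exact isInt_one) (by
    obtain ⟨k, hk⟩ := hm
    refine ⟨k, ?_⟩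
    rw [inner_eq_add_sum, hz]
    simp only [pair_fst, pair_snd, real_inner_smul_right, real_inner_smul_left, Finset.sum_const,
      Finset.card_univ, Fintype.card_fin, nsmul_eq_mul]
    linarith) (by
    rintro u ⟨hu, hu'⟩ hi
    obtain ⟨k, hk⟩ := (hxz u).1 hi
    obtain ⟨l, hl⟩ := hch _ hu
    obtain ⟨j, hj⟩ := even_sum_sq_sub Finset.univ (fun i => u.snd i) fun i _ => hu' i
    refine ⟨k + l + j, ?_⟩
    rw [inner_eq_add_sum]; push_cast; linarith)
  refine ⟨E, h1, h2, fun x => ?_⟩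
  rw [h3, hxz]
  rfl

/-- The norm of a characteristic vector is congruent to the dimension modulo 8. -/
theorem SelfDual.char_norm [FiniteDimensional ℝ V] (hN : SelfDual N) {c : V} (hc : c ∈ N)
    (hch : ∀ u ∈ N, ∃ k : ℤ, ⟪u, u⟫ - ⟪u, c⟫ = 2 * (k : ℝ)) :
    ∃ k : ℤ, ⟪c, c⟫ = Module.finrank ℝ V + 8 * (k : ℝ) := by
  obtain ⟨q, hq⟩ := hN.isInt hc hc
  obtain ⟨E, h1, h2, -⟩ := hN.exists_even_glue hc hch (((-q) % 8).toNat)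
    ⟨-((-q) / 8), by
      rw [hq]
      have : (((((-q) % 8).toNat : ℕ) : ℤ) : ℝ) = (((-q) % 8 : ℤ) : ℝ) := by
        rw [Int.toNat_of_nonneg (Int.emod_nonneg _ (by norm_num))]
      rw [← Int.cast_natCast, this]
      have h := Int.emod_add_mul_ediv (-q) 8
      have : (((-q) % 8 + 8 * ((-q) / 8) : ℤ) : ℝ) = ((-q : ℤ) : ℝ) := by rw [h]
      push_cast at this ⊢
      linarith⟩
  have h8 := h1.eight_dvd h2
  rw [finrank_prod_eq] at h8
  obtain ⟨j, hj⟩ := h8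
  refine ⟨(q - Module.finrank ℝ V) / 8, ?_⟩
  rw [hq]
  have : q = Module.finrank ℝ V + 8 * ((q - Module.finrank ℝ V) / 8) := by omega
  exact_mod_cast this

end SDLattice

namespace SDLattice

variable {V : Type} [NormedAddCommGroup V] [InnerProductSpace ℝ V] [FiniteDimensional ℝ V]
variable {N : AddSubgroup V}

/-- Applying the Laplacian to an identity between spherical moments lowers the degree by two. -/
lemma moment_step {ι : Type} (s : Finset ι) (w : ι → ℝ) (v : ι → V) (A : ℝ) (e : ℕ)
    (h : ∀ y, ∑ i ∈ s, w i * ⟪v i, y⟫ ^ (2 * e + 2) = A * ⟪y, y⟫ ^ (e + 1)) (y : V) :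
    (2 * e + 1) * ∑ i ∈ s, w i * ⟪v i, v i⟫ * ⟪v i, y⟫ ^ (2 * e) =
      A * (Module.finrank ℝ V + 2 * e) * ⟪y, y⟫ ^ e := by
  have key : ∀ z : V, (2 * e + 2) * (2 * e + 1) *
      ∑ i ∈ s, w i * ⟪v i, z⟫ ^ 2 * ⟪v i, y⟫ ^ (2 * e) =
      A * (e + 1) * (4 * e * ⟪y, y⟫ ^ (e - 1) * ⟪y, z⟫ ^ 2 + 2 * ⟪y, y⟫ ^ e * ⟪z, z⟫) := fun z => by
    have h0 : ∀ t : ℝ, ∑ i ∈ s, w i * (⟪v i, y⟫ + t * ⟪v i, z⟫) ^ (2 * e + 2) =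
        A * (⟪y, y⟫ + t * (2 * ⟪y, z⟫) + t * t * ⟪z, z⟫) ^ (e + 1) := fun t => by
      have := h (y + t • z)
      simp only [inner_add_right, inner_add_left, real_inner_smul_right, real_inner_smul_left] at this
      rw [this, real_inner_comm y z]; ring
    have hd : ∀ a b t : ℝ, HasDerivAt (fun t : ℝ => a + t * b) b t := fun a b t => by
      simpa using ((hasDerivAt_id t).mul_const b).const_add a
    have hq : ∀ t : ℝ, HasDerivAt (fun t : ℝ => ⟪y, y⟫ + t * (2 * ⟪y, z⟫) + t * t * ⟪z, z⟫)
        (2 * ⟪y, z⟫ + 2 * t * ⟪z, z⟫) t := fun t => by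
      have := (hd ⟪y, y⟫ (2 * ⟪y, z⟫) t).add
        (((hasDerivAt_id t).mul (hasDerivAt_id t)).mul_const ⟪z, z⟫)
      exact this.congr_deriv (by simp only [id]; ring)
    have h1 : ∀ t : ℝ, ∑ i ∈ s, w i * ((2 * e + 2) * (⟪v i, y⟫ + t * ⟪v i, z⟫) ^ (2 * e + 1) *
        ⟪v i, z⟫) = A * ((e + 1) * (⟪y, y⟫ + t * (2 * ⟪y, z⟫) + t * t * ⟪z, z⟫) ^ e *
          (2 * ⟪y, z⟫ + 2 * t * ⟪z, z⟫)) := fun t => by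
      have hF : HasDerivAt (fun t : ℝ => ∑ i ∈ s, w i * (⟪v i, y⟫ + t * ⟪v i, z⟫) ^ (2 * e + 2))
          (∑ i ∈ s, w i * ((2 * e + 2) * (⟪v i, y⟫ + t * ⟪v i, z⟫) ^ (2 * e + 1) *
            ⟪v i, z⟫)) t := by
        refine HasDerivAt.fun_sum fun i _ => ?_
        have := ((hd ⟪v i, y⟫ ⟪v i, z⟫ t).fun_pow (2 * e + 2)).const_mul (w i)
        exact this.congr_deriv (by push_cast; rfl)
      have hG := ((hq t).pow (e + 1)).const_mul A
      have hG' := hG.unique (hF.congr_of_eventuallyEq (Filter.Eventually.of_forall fun t =>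
        (h0 t).symm))
      rw [← hG']
      push_cast; rfl
    have hF : HasDerivAt (fun t : ℝ => ∑ i ∈ s, w i * ((2 * e + 2) *
        (⟪v i, y⟫ + t * ⟪v i, z⟫) ^ (2 * e + 1) * ⟪v i, z⟫))
        (∑ i ∈ s, w i * ((2 * e + 2) * (((2 * e + 1 : ℕ) : ℝ) *
          (⟪v i, y⟫ + 0 * ⟪v i, z⟫) ^ (2 * e) * ⟪v i, z⟫) * ⟪v i, z⟫)) 0 := by
      refine HasDerivAt.fun_sum fun i _ => ?_
      have := ((((hd ⟪v i, y⟫ ⟪v i, z⟫ 0).fun_pow (2 * e + 1)).const_mul (2 * (e : ℝ) + 2)).mul_const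
        ⟪v i, z⟫).const_mul (w i)
      exact this
    have hG := ((((hq 0).pow e).const_mul ((e : ℝ) + 1)).mul
      (((hasDerivAt_id (0 : ℝ)).const_mul 2 |>.mul_const ⟪z, z⟫).const_add
        (2 * ⟪y, z⟫))).const_mul A
    have hG' := hG.unique (hF.congr_of_eventuallyEq (Filter.Eventually.of_forall fun t => by
      simpa using (h1 t).symm))
    simp only [zero_mul, mul_zero, add_zero, id] at hG'
    rw [Finset.mul_sum]
    calc _ = ∑ i ∈ s, w i * ((2 * e + 2) * (((2 * e + 1 : ℕ) : ℝ) *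
          ⟪v i, y⟫ ^ (2 * e) * ⟪v i, z⟫) * ⟪v i, z⟫) :=
        Finset.sum_congr rfl fun i _ => by push_cast; ring
      _ = _ := by rw [← hG']; simp; ring
  let b := stdOrthonormalBasis ℝ V
  have hb : ∀ x : V, ∑ j, ⟪x, b j⟫ ^ 2 = ⟪x, x⟫ := fun x => by
    rw [← b.sum_inner_mul_inner x x]
    exact Finset.sum_congr rfl fun j _ => by rw [real_inner_comm x (b j), sq]
  have hs := Finset.sum_congr (rfl : Finset.univ = Finset.univ) fun j (_ : j ∈ Finset.univ) =>
    key (b j)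
  rw [← Finset.mul_sum, ← Finset.mul_sum, Finset.sum_comm, Finset.sum_add_distrib,
    ← Finset.mul_sum, hb, ← Finset.mul_sum] at hs
  have h1 : ∀ j, ⟪b j, b j⟫ = (1 : ℝ) := fun j => by
    rw [real_inner_self_eq_norm_sq, b.orthonormal.1 j]; norm_num
  simp only [h1, Finset.sum_const, Finset.card_univ, Fintype.card_fin, nsmul_eq_mul] at hs
  have h2 : ∑ i ∈ s, ∑ j, w i * ⟪v i, b j⟫ ^ 2 * ⟪v i, y⟫ ^ (2 * e) =
      ∑ i ∈ s, w i * ⟪v i, v i⟫ * ⟪v i, y⟫ ^ (2 * e) :=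
    Finset.sum_congr rfl fun i _ => by rw [← Finset.sum_mul, ← Finset.mul_sum, hb]
  rw [h2] at hs
  have h3 : (e : ℝ) * ⟪y, y⟫ ^ (e - 1) * ⟪y, y⟫ = e * ⟪y, y⟫ ^ e := by
    rcases e with _ | e
    · simp
    · rw [Nat.add_sub_cancel, pow_succ]; ring
  have h4 : (2 * (e : ℝ) + 2) ≠ 0 := by positivity
  apply mul_left_cancel₀ h4
  rw [← mul_assoc, hs]
  linear_combination (4 * A * (e + 1)) * h3

/-- Equality of the `d`-th power sums on spheres determines them up to a constant. -/
lemma exists_moment_const [Nontrivial V] {ι : Type} (s : Finset ι) (w : ι → ℝ) (v : ι → V) (e : ℕ)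
    (h : ∀ y y', ⟪y, y⟫ = ⟪y', y'⟫ →
      ∑ i ∈ s, w i * ⟪v i, y⟫ ^ (2 * e) = ∑ i ∈ s, w i * ⟪v i, y'⟫ ^ (2 * e)) :
    ∃ A : ℝ, ∀ y, ∑ i ∈ s, w i * ⟪v i, y⟫ ^ (2 * e) = A * ⟪y, y⟫ ^ e := by
  obtain ⟨u, hu⟩ := exists_norm_eq V (zero_le_one (α := ℝ))
  refine ⟨∑ i ∈ s, w i * ⟪v i, u⟫ ^ (2 * e), fun y => ?_⟩
  rw [h y (‖y‖ • u) (by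
    rw [real_inner_self_eq_norm_sq, real_inner_self_eq_norm_sq, norm_smul, hu, norm_norm, mul_one]),
    real_inner_self_eq_norm_sq, ← pow_mul, Finset.sum_mul]
  exact Finset.sum_congr rfl fun i _ => by rw [real_inner_smul_right, mul_pow]; ring

end SDLattice

namespace SDLattice

variable {V : Type} [NormedAddCommGroup V] [InnerProductSpace ℝ V] [FiniteDimensional ℝ V]
variable {N : AddSubgroup V}

lemma SelfDual.mem_shell_one (hN : SelfDual N) {x : V} : x ∈ shell N 1 ↔ x ∈ N ∧ ⟪x, x⟫ = 2 := by
  rw [hN.mem_shell]; norm_num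

lemma SelfDual.mem_shell_two (hN : SelfDual N) {x : V} : x ∈ shell N 2 ↔ x ∈ N ∧ ⟪x, x⟫ = 4 := by
  rw [hN.mem_shell]; norm_num

lemma moment_ratio [Nontrivial V] {ι : Type} (s : Finset ι) (v : ι → V) (q A B : ℝ) (e : ℕ)
    (hv : ∀ i ∈ s, ⟪v i, v i⟫ = q)
    (hA : ∀ y, ∑ i ∈ s, ⟪v i, y⟫ ^ (2 * e) = A * ⟪y, y⟫ ^ e)
    (hB : ∀ y, ∑ i ∈ s, ⟪v i, y⟫ ^ (2 * e + 2) = B * ⟪y, y⟫ ^ (e + 1)) :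
    (2 * e + 1) * (q * A) = B * (Module.finrank ℝ V + 2 * e) := by
  obtain ⟨u, hu⟩ := exists_norm_eq V (zero_le_one (α := ℝ))
  have huu : ⟪u, u⟫ = (1 : ℝ) := by rw [real_inner_self_eq_norm_sq, hu]; norm_num
  have := moment_step s (fun _ => 1) v B e (by simpa using hB) u
  rw [huu, one_pow, mul_one] at this
  rw [← this]
  congr 1
  have h2 := hA u
  rw [huu, one_pow, mul_one] at h2
  rw [← h2, Finset.mul_sum]
  exact Finset.sum_congr rfl fun i hi => by rw [hv i hi, one_mul]

lemma SelfDual.moments (hN : SelfDual N) (hE : Even N) (hk : Module.finrank ℝ V = 24)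
    (h1 : shell N 1 = ∅) (t : V) :
    ∑ x ∈ shell N 2, ⟪x, t⟫ ^ 2 = 196560 * (1 / 6) * ⟪t, t⟫ ∧
    ∑ x ∈ shell N 2, ⟪x, t⟫ ^ 4 = 196560 * (1 / 13) * ⟪t, t⟫ ^ 2 ∧
    ∑ x ∈ shell N 2, ⟪x, t⟫ ^ 6 = 196560 * (5 / 91) * ⟪t, t⟫ ^ 3 ∧
    ∑ x ∈ shell N 2, ⟪x, t⟫ ^ 8 = 196560 * (2 / 39) * ⟪t, t⟫ ^ 4 ∧
    ∑ x ∈ shell N 2, ⟪x, t⟫ ^ 10 = 196560 * (3 / 52) * ⟪t, t⟫ ^ 5 := by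
  have : Nontrivial V := Module.nontrivial_of_finrank_pos (R := ℝ) (by omega)
  have hA : ∀ e : ℕ, 2 * e ≤ 11 → ∃ A : ℝ, ∀ y, ∑ x ∈ shell N 2, ⟪x, y⟫ ^ (2 * e) =
      A * ⟪y, y⟫ ^ e := fun e he => by
    have := exists_moment_const (shell N 2) (fun _ => (1 : ℝ)) (fun x => x) e (fun y y' hy => by
      simpa using hN.shell_pow_eq_of_rootless hE hk h1 hy _ he 2)
    simpa using this
  have hv : ∀ x ∈ shell N 2, ⟪x, x⟫ = (4 : ℝ) := fun x hx => (hN.mem_shell_two.1 hx).2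
  have hc := hN.card_shell_two hE hk h1
  obtain ⟨A1, h1⟩ := hA 1 (by norm_num)
  obtain ⟨A2, h2⟩ := hA 2 (by norm_num)
  obtain ⟨A3, h3⟩ := hA 3 (by norm_num)
  obtain ⟨A4, h4⟩ := hA 4 (by norm_num)
  obtain ⟨A5, h5⟩ := hA 5 (by norm_num)
  have r1 := moment_ratio (shell N 2) (fun x => x) 4 196560 A1 0 hv
    (fun y => by simp [hc]) (by simpa using h1)
  have r2 := moment_ratio (shell N 2) (fun x => x) 4 A1 A2 1 hv h1 h2
  have r3 := moment_ratio (shell N 2) (fun x => x) 4 A2 A3 2 hv h2 h3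
  have r4 := moment_ratio (shell N 2) (fun x => x) 4 A3 A4 3 hv h3 h4
  have r5 := moment_ratio (shell N 2) (fun x => x) 4 A4 A5 4 hv h4 h5
  rw [hk] at r1 r2 r3 r4 r5
  push_cast at r1 r2 r3 r4 r5
  have e1 : A1 = 196560 * (1 / 6) := by linarith
  have e2 : A2 = 196560 * (1 / 13) := by linarith
  have e3 : A3 = 196560 * (5 / 91) := by linarith
  have e4 : A4 = 196560 * (2 / 39) := by linarith
  have e5 : A5 = 196560 * (3 / 52) := by linarith
  subst e1 e2 e3 e4 e5
  exact ⟨by simpa using h1 t, h2 t, h3 t, h4 t, h5 t⟩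

/-- Half-integral cosets of a rootless even unimodular lattice of rank 24 contain a vector of
norm at most 2. -/
theorem SelfDual.exists_short (hN : SelfDual N) (hE : Even N) (hk : Module.finrank ℝ V = 24)
    (h1 : shell N 1 = ∅) {a : V} (ha : a + a ∈ N) :
    ∃ y, y - a ∈ N ∧ (⟪y, y⟫ = 0 ∨ ⟪y, y⟫ = 1 ∨ ⟪y, y⟫ = 3 / 2 ∨ ⟪y, y⟫ = 2) := by
  have hnat : ∀ y, y - a ∈ N → y + y ∈ N ∧ ∃ k : ℕ, 2 * ⟪y, y⟫ = k := fun y hy => by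
    have h2 : y + y ∈ N := by
      have := N.add_mem (N.add_mem hy hy) ha
      rwa [show y - a + (y - a) + (a + a) = y + y by abel] at this
    refine ⟨h2, ?_⟩
    obtain ⟨k, hk⟩ := hE _ h2
    simp only [inner_add_left, inner_add_right] at hk
    have : (0 : ℝ) ≤ k := by linarith [real_inner_self_nonneg (x := y)]
    refine ⟨k.toNat, ?_⟩
    have h3 : ((k.toNat : ℤ) : ℝ) = k := by rw [Int.toNat_of_nonneg (by exact_mod_cast this)]
    rw [← Int.cast_natCast, h3]; linarith
  have hex : ∃ k : ℕ, ∃ y, y - a ∈ N ∧ 2 * ⟪y, y⟫ = k := by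
    obtain ⟨-, k, hk⟩ := hnat a (by simp)
    exact ⟨k, a, by simp, hk⟩
  classical
  obtain ⟨y, hy, hyk⟩ := Nat.find_spec hex
  have hmin : ∀ e ∈ N, ⟪y, y⟫ ≤ ⟪y + e, y + e⟫ := fun e he => by
    have h2 : y + e - a ∈ N := by
      rw [add_sub_right_comm]; exact N.add_mem hy he
    obtain ⟨-, k, hk⟩ := hnat _ h2
    have := Nat.find_min' hex ⟨y + e, h2, hk⟩
    have : ((Nat.find hex : ℕ) : ℝ) ≤ k := by exact_mod_cast this
    linarith
  refine ⟨y, hy, ?_⟩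
  obtain ⟨m2, m4, m6, m8, m10⟩ := hN.moments hE hk h1 (y + y)
  have hw : ∀ x ∈ shell N 2, ⟪x, y + y⟫ ^ 10 - 30 * ⟪x, y + y⟫ ^ 8 + 273 * ⟪x, y + y⟫ ^ 6 -
      820 * ⟪x, y + y⟫ ^ 4 + 576 * ⟪x, y + y⟫ ^ 2 = 0 := fun x hx => by
    obtain ⟨hx, hx4⟩ := hN.mem_shell_two.1 hx
    obtain ⟨k, hk⟩ := hN.isInt hx (hnat y hy).1
    have b1 := hmin x hx
    have b2 := hmin (-x) (N.neg_mem hx)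
    rw [inner_add_right] at hk
    simp only [inner_add_left, inner_add_right, inner_neg_left, inner_neg_right,
      real_inner_comm x y, hx4] at b1 b2
    have k1 : (k : ℝ) ≤ 4 := by linarith
    have k2 : (-4 : ℝ) ≤ k := by linarith
    have k3 : k ≤ 4 := by exact_mod_cast k1
    have k4 : -4 ≤ k := by exact_mod_cast k2
    rw [inner_add_right, hk]
    interval_cases k <;> norm_num
  have hs := Finset.sum_eq_zero hw
  simp only [Finset.sum_add_distrib, Finset.sum_sub_distrib, ← Finset.mul_sum] at hs
  rw [m2, m4, m6, m8, m10] at hs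
  have ht : ⟪y + y, y + y⟫ = 4 * ⟪y, y⟫ := by simp only [inner_add_left, inner_add_right]; ring
  rw [ht] at hs
  set q := ⟪y, y⟫ with hq
  have hp : q * ((q - 1) * ((q - 3 / 2) * ((q - 2) * (q - 13 / 6)))) = 0 := by
    linear_combination hs / (196560 * (3 / 52) * 1024)
  rcases mul_eq_zero.1 hp with h | h
  · exact Or.inl h
  rcases mul_eq_zero.1 h with h | h
  · right; left; linarith
  rcases mul_eq_zero.1 h with h | h
  · right; right; left; linarith
  rcases mul_eq_zero.1 h with h | h
  · right; right; right; linarith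
  exfalso
  obtain ⟨-, k, hk⟩ := hnat y hy
  have : (13 : ℝ) = 3 * k := by linarith
  have : 13 = 3 * k := by exact_mod_cast this
  omega

/-- If the roots of an even unimodular lattice of rank 24 are orthogonal up to sign, there are
exactly 48 of them. -/
theorem SelfDual.frame (hN : SelfDual N) (hE : Even N) (hk : Module.finrank ℝ V = 24) {r : V}
    (hr : r ∈ shell N 1) (h : ∀ x ∈ shell N 1, x - r ∉ shell N 1 ∧ x + r ∉ shell N 1) :
    (∀ v, ∑ x ∈ shell N 1, ⟪x, v⟫ ^ 2 = 4 * ⟪v, v⟫) ∧ (shell N 1).card = 48 := by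
  classical
  have : Nontrivial V := Module.nontrivial_of_finrank_pos (R := ℝ) (by omega)
  obtain ⟨A, hA⟩ := exists_moment_const (shell N 1) (fun _ => (1 : ℝ)) (fun x => x) 1
    (fun y y' hy => by simpa using hN.shell_sq_eq hE hk hy 1)
  simp only [one_mul, pow_one] at hA
  have hR := moment_ratio (shell N 1) (fun x => x) 2 (shell N 1).card A 0
    (fun x hx => (hN.mem_shell_one.1 hx).2) (fun y => by simp) (by simpa using hA)
  rw [hk] at hR
  obtain ⟨hrN, hr2⟩ := hN.mem_shell_one.1 hr
  have hs : ∑ x ∈ shell N 1, ⟪x, r⟫ ^ 2 = ∑ x ∈ ({r, -r} : Finset V), ⟪x, r⟫ ^ 2 := by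
    symm
    apply Finset.sum_subset
    · intro x hx
      rcases Finset.mem_insert.1 hx with rfl | hx
      · exact hr
      · rw [Finset.mem_singleton] at hx; subst hx
        exact hN.mem_shell_one.2 ⟨N.neg_mem hrN, by rw [inner_neg_neg, hr2]⟩
    · intro x hx hx'
      obtain ⟨hxN, hx2⟩ := hN.mem_shell_one.1 hx
      obtain ⟨h1, h2⟩ := h x hx
      rw [hN.mem_shell_one] at h1 h2
      have hp : ⟪x + r, x + r⟫ = 4 + 2 * ⟪x, r⟫ := by
        simp only [inner_add_left, inner_add_right, real_inner_comm x r, hx2, hr2]; ring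
      have hm : ⟪x - r, x - r⟫ = 4 - 2 * ⟪x, r⟫ := by
        simp only [inner_sub_left, inner_sub_right, real_inner_comm x r, hx2, hr2]; ring
      have hp0 : x + r ≠ 0 := fun h => hx' (by
        rw [eq_neg_of_add_eq_zero_left h]; simp)
      have hm0 : x - r ≠ 0 := fun h => hx' (by rw [sub_eq_zero.1 h]; simp)
      have hp1 := real_inner_self_pos.2 hp0
      have hm1 := real_inner_self_pos.2 hm0
      obtain ⟨k, hk⟩ := hN.isInt hxN hrN
      rw [hp, hk] at hp1
      rw [hm, hk] at hm1
      have k1 : (k : ℝ) < 2 := by linarith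
      have k2 : (-2 : ℝ) < k := by linarith
      have k3 : k < 2 := by exact_mod_cast k1
      have k4 : -2 < k := by exact_mod_cast k2
      rw [hk]
      interval_cases k
      · exact absurd ⟨N.add_mem hxN hrN, by rw [hp, hk]; norm_num⟩ h2
      · norm_num
      · exact absurd ⟨N.sub_mem hxN hrN, by rw [hm, hk]; norm_num⟩ h1
  have hne : r ≠ -r := fun h => by
    have h' : ⟪r, r⟫ = ⟪-r, r⟫ := congrArg (fun x => ⟪x, r⟫) h
    rw [inner_neg_left] at h'; linarith
  rw [Finset.sum_pair hne, inner_neg_left, hr2, hA r, hr2] at hs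
  have hA4 : A = 4 := by linarith
  refine ⟨fun v => by rw [← hA4]; exact hA v, ?_⟩
  have : ((shell N 1).card : ℝ) = 48 := by push_cast at hR; rw [hA4] at hR; linarith
  exact_mod_cast this

end SDLattice

namespace SDLattice

variable {V : Type} [NormedAddCommGroup V] [InnerProductSpace ℝ V]
variable {N : AddSubgroup V}

/-- The vectors of even norm in a unimodular lattice. -/
def SelfDual.evenPart (hN : SelfDual N) : AddSubgroup V where
  carrier := {u | u ∈ N ∧ IsInt (⟪u, u⟫ / 2)}
  zero_mem' := ⟨N.zero_mem, by rw [inner_zero_left, zero_div]; exact isInt_zero⟩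
  add_mem' := by
    rintro a b ⟨ha, ha'⟩ ⟨hb, hb'⟩
    refine ⟨N.add_mem ha hb, ?_⟩
    have := (ha'.add hb').add (hN.isInt ha hb)
    simp only [inner_add_left, inner_add_right, real_inner_comm a b]
    convert this using 1; ring
  neg_mem' := by
    rintro a ⟨ha, ha'⟩
    exact ⟨N.neg_mem ha, by rwa [inner_neg_neg]⟩

lemma SelfDual.isInt_of_notMem_evenPart (hN : SelfDual N) {u : V} (hu : u ∈ N)
    (hu' : u ∉ hN.evenPart) : IsInt (⟪u, u⟫ / 2 - 1 / 2) :=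
  (isInt_or_half (by rw [mul_div_cancel₀ _ (two_ne_zero' ℝ)]; exact hN.isInt hu hu)).resolve_left
    fun h => hu' ⟨hu, h⟩

lemma SelfDual.double_mem_evenPart (hN : SelfDual N) {u : V} (hu : u + u ∈ N)
    (h : IsInt ⟪u, u⟫) : u + u ∈ hN.evenPart := by
  refine ⟨hu, ?_⟩
  have := h.add h
  simp only [inner_add_left, inner_add_right]
  convert this using 1; ring

/-- The even unimodular lattice generated by the even part of a unimodular lattice and half a
characteristic vector. -/
theorem SelfDual.exists_glue (hN : SelfDual N) [FiniteDimensional ℝ V]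
    (hk : Module.finrank ℝ V = 24) {z : V} (hz : z + z ∈ N)
    (hch : ∀ u ∈ N, ∃ k : ℤ, ⟪u, u⟫ - ⟪u, z + z⟫ = 2 * (k : ℝ)) :
    ∃ E : AddSubgroup V, SelfDual E ∧ Even E ∧ (∃ k : ℤ, ⟪z, z⟫ = 2 * (k : ℝ)) ∧
      ∀ x, x ∈ E ↔ x ∈ hN.evenPart ∨ x - z ∈ hN.evenPart := by
  have hzz : ∃ k : ℤ, ⟪z, z⟫ = 2 * (k : ℝ) := by
    obtain ⟨k, h⟩ := hN.char_norm hz hch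
    rw [hk] at h
    simp only [inner_add_left, inner_add_right] at h
    refine ⟨3 + k, ?_⟩
    push_cast at h ⊢; linarith
  have hiff : ∀ u ∈ N, IsInt ⟪u, z⟫ ↔ IsInt (⟪u, u⟫ / 2) := fun u hu => by
    obtain ⟨k, hk⟩ := hch u hu
    rw [inner_add_right] at hk
    have h : ⟪u, u⟫ / 2 = ⟪u, z⟫ + k := by linarith
    rw [h]
    refine ⟨fun h => h.add (isInt_intCast k), fun h => ?_⟩
    have := h.sub (isInt_intCast k)
    rwa [add_sub_cancel_right] at this
  obtain ⟨E, h1, h2, h3⟩ := hN.exists_neighbor hz hzz fun u hu hi => by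
    obtain ⟨k, hk⟩ := (hiff u hu).1 hi
    exact ⟨k, by linarith⟩
  refine ⟨E, h1, h2, hzz, fun x => ?_⟩
  have hi : IsInt ⟪z, z⟫ := by
    obtain ⟨k, hk⟩ := hzz; rw [hk]; exact isInt_two.mul (isInt_intCast k)
  have hxz : IsInt ⟪x, z⟫ ↔ IsInt ⟪x - z, z⟫ := by
    rw [inner_sub_left]
    exact ⟨fun h => h.sub hi, fun h => by simpa using h.add hi⟩
  rw [h3]
  constructor
  · rintro ⟨h, hx | hx⟩
    · exact Or.inl ⟨hx, (hiff x hx).1 h⟩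
    · exact Or.inr ⟨hx, (hiff _ hx).1 (hxz.1 h)⟩
  · rintro (⟨hx, h⟩ | ⟨hx, h⟩)
    · exact ⟨(hiff x hx).2 h, Or.inl hx⟩
    · exact ⟨hxz.2 ((hiff _ hx).2 h), Or.inr hx⟩

lemma SelfDual.frame_of_coset [FiniteDimensional ℝ V] {G G0 : AddSubgroup V} (hG : SelfDual G)
    (hE : Even G) (hk : Module.finrank ℝ V = 24) {z : V} (hz : z + z ∈ G0)
    (h0 : ∀ x ∈ G0, ⟪x, x⟫ ≠ (2 : ℝ)) (hmem : ∀ x ∈ G, x ∈ G0 ∨ x - z ∈ G0) {r : V}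
    (hr : r ∈ shell G 1) :
    (∀ v, ∑ x ∈ shell G 1, ⟪x, v⟫ ^ 2 = 4 * ⟪v, v⟫) ∧ (shell G 1).card = 48 ∧
      ∀ s ∈ shell G 1, s - z ∈ G0 := by
  have hroot : ∀ s ∈ shell G 1, s - z ∈ G0 := fun s hs => by
    obtain ⟨h1, h2⟩ := hG.mem_shell_one.1 hs
    exact (hmem s h1).resolve_left fun h => h0 s h h2
  have := hG.frame hE hk hr fun s hs => by
    have h1 := G0.sub_mem (hroot s hs) (hroot r hr)
    have h2 := G0.add_mem (G0.add_mem (hroot s hs) (hroot r hr)) hz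
    rw [show s - z - (r - z) = s - r by abel] at h1
    rw [show s - z + (r - z) + (z + z) = s + r by abel] at h2
    exact ⟨fun h => h0 _ h1 (hG.mem_shell_one.1 h).2, fun h => h0 _ h2 (hG.mem_shell_one.1 h).2⟩
  exact ⟨this.1, this.2, hroot⟩

variable [FiniteDimensional ℝ V]

lemma SelfDual.not_both_rooted (hN : SelfDual N) (hk : Module.finrank ℝ V = 24)
    (h3 : ∀ u ∈ N, u ≠ 0 → 3 ≤ ⟪u, u⟫) {z o : V} (ho : o ∈ N) (ho' : o ∉ hN.evenPart)
    (hz : z + z ∈ hN.evenPart) {E : AddSubgroup V} (hE : SelfDual E) (hEe : Even E)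
    (hEm : ∀ x ∈ E, x ∈ hN.evenPart ∨ x - z ∈ hN.evenPart) {r s : V} (hr : r - (z + o) ∈ hN.evenPart)
    (hr2 : ⟪r, r⟫ = (2 : ℝ)) (hs : s ∈ shell E 1) : False := by
  have h0 : ∀ x ∈ hN.evenPart, ⟪x, x⟫ ≠ (2 : ℝ) := fun x hx h => by
    have hx0 : x ≠ 0 := by rintro rfl; simp at h
    have := h3 x hx.1 hx0
    linarith
  obtain ⟨f1, f2, f3⟩ := hE.frame_of_coset hEe hk hz h0 hEm hs
  have hq : ∀ x ∈ shell E 1, ⟪x, r⟫ ^ 2 = 1 / 4 := fun x hx => by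
    have hx2 := (hE.mem_shell_one.1 hx).2
    have hxz := f3 x hx
    have hodd : ∀ y, y - o ∈ hN.evenPart → y ∈ N ∧ IsInt (⟪y, y⟫ / 2 - 1 / 2) ∧ 3 ≤ ⟪y, y⟫ := by
      intro y hy
      have hyN : y ∈ N := by have := N.add_mem hy.1 ho; rwa [sub_add_cancel] at this
      have hy' : y ∉ hN.evenPart := fun h => ho' (by
        have := hN.evenPart.sub_mem h hy; rwa [sub_sub_cancel] at this)
      exact ⟨hyN, hN.isInt_of_notMem_evenPart hyN hy', h3 y hyN fun h => hy' (by
        rw [h]; exact hN.evenPart.zero_mem)⟩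
    obtain ⟨-, ⟨k, hk⟩, a2⟩ := hodd (r - x) (by
      have := hN.evenPart.sub_mem hr hxz
      rwa [show r - (z + o) - (x - z) = r - x - o by abel] at this)
    obtain ⟨-, -, b2⟩ := hodd (r + x) (by
      have := hN.evenPart.add_mem (hN.evenPart.add_mem hr hxz) hz
      rwa [show r - (z + o) + (x - z) + (z + z) = r + x - o by abel] at this)
    simp only [inner_sub_left, inner_sub_right, inner_add_left, inner_add_right,
      real_inner_comm x r, hx2, hr2] at hk a2 b2
    have k1 : (k : ℝ) < 3 := by linarith
    have k2 : (0 : ℝ) < k := by linarith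
    have k3 : k < 3 := by exact_mod_cast k1
    have k4 : 0 < k := by exact_mod_cast k2
    interval_cases k
    · have : ⟪x, r⟫ = (1 / 2 : ℝ) := by push_cast at hk; linarith
      rw [this]; norm_num
    · have : ⟪x, r⟫ = (-1 / 2 : ℝ) := by push_cast at hk; linarith
      rw [this]; norm_num
  have := f1 r
  rw [Finset.sum_congr rfl hq, Finset.sum_const, f2, hr2] at this
  norm_num at this

lemma SelfDual.not_both_rootless (hN : SelfDual N) (hk : Module.finrank ℝ V = 24)
    (h3 : ∀ u ∈ N, u ≠ 0 → 3 ≤ ⟪u, u⟫) {z o : V} (ho : o ∈ N) (ho' : o ∉ hN.evenPart)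
    {E E' : AddSubgroup V} (hE : SelfDual E) (hEe : Even E) (hE' : SelfDual E') (hEe' : Even E')
    (hEm : ∀ x, x ∈ E ↔ x ∈ hN.evenPart ∨ x - z ∈ hN.evenPart)
    (hEm' : ∀ x, x ∈ E' ↔ x ∈ hN.evenPart ∨ x - (z + o) ∈ hN.evenPart)
    (hr : shell E 1 = ∅) (hr' : shell E' 1 = ∅) : False := by
  obtain ⟨y, hy, hy2⟩ := hE.exists_short hEe hk hr (a := o) ((hEm _).2 (Or.inl
    (hN.double_mem_evenPart (N.add_mem ho ho) (hN.isInt ho ho))))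
  have hyle : ⟪y, y⟫ ≤ 2 := by rcases hy2 with h | h | h | h <;> rw [h] <;> norm_num
  rcases (hEm _).1 hy with h | h
  · have hyN : y ∈ N := by have := N.add_mem h.1 ho; rwa [sub_add_cancel] at this
    have hy0 : y ≠ 0 := by
      rintro rfl
      exact ho' (by simpa using h)
    linarith [h3 y hyN hy0]
  · rw [sub_sub, add_comm o z] at h
    have hyE : y ∈ E' := (hEm' y).2 (Or.inr h)
    obtain ⟨k, hk⟩ := hEe' y hyE
    have h2 : ⟪y, y⟫ ≠ 2 := fun h => by
      have : y ∈ shell E' 1 := hE'.mem_shell_one.2 ⟨hyE, h⟩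
      rw [hr'] at this; simp at this
    have hy0 : y = 0 := by
      by_contra hne
      have := real_inner_self_pos.2 hne
      have k1 : (0 : ℝ) < k := by linarith
      have k2 : (k : ℝ) ≤ 1 := by linarith
      have k3 : 0 < k := by exact_mod_cast k1
      have k4 : k ≤ 1 := by exact_mod_cast k2
      have : k = 1 := by omega
      rw [this] at hk; exact h2 (by rw [hk]; norm_num)
    rw [hy0, zero_sub] at h
    have h' := hN.evenPart.neg_mem h
    rw [neg_neg] at h'
    have hzE : z ∈ E := (hEm z).2 (Or.inr (by simp))
    obtain ⟨l, hl⟩ := hEe z hzE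
    have hzN : z ∈ hN.evenPart := ⟨by
      have := N.sub_mem h'.1 ho; rwa [add_sub_cancel_right] at this, l, by rw [hl]; ring⟩
    exact ho' (by have := hN.evenPart.sub_mem h' hzN; rwa [add_sub_cancel_left] at this)

lemma sq_half {a : ℝ} (hi : IsInt (2 * a)) (h1 : 2 * a ≤ 1) (h2 : -1 ≤ 2 * a) :
    a ^ 2 = 0 ∧ a = 0 ∨ a ^ 2 = 1 / 4 ∧ IsInt (a - 1 / 2) := by
  obtain ⟨k, hk⟩ := hi
  rw [hk] at h1 h2
  have k1 : k ≤ 1 := by exact_mod_cast h1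
  have k2 : -1 ≤ k := by exact_mod_cast h2
  have : a = k / 2 := by linarith
  subst this
  interval_cases k
  · right; exact ⟨by norm_num, -1, by norm_num⟩
  · left; norm_num
  · right; exact ⟨by norm_num, 0, by norm_num⟩

lemma SelfDual.le_of_rootless_of_rooted (hN : SelfDual N) (hk : Module.finrank ℝ V = 24)
    (h3 : ∀ u ∈ N, u ≠ 0 → 3 ≤ ⟪u, u⟫) {M : AddSubgroup V} (hNM : N ≤ M)
    (hM : ∀ u ∈ M, IsInt ⟪u, u⟫ ∧ (u ≠ 0 → 3 ≤ ⟪u, u⟫)) (hM2 : ∀ u ∈ M, u + u ∈ N)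
    {z o : V} (ho : o ∈ N) (ho' : o ∉ hN.evenPart) (hz : z + z ∈ hN.evenPart)
    {E E' : AddSubgroup V} (hE : SelfDual E) (hEe : Even E) (hE' : SelfDual E') (hEe' : Even E')
    (hEm : ∀ x, x ∈ E ↔ x ∈ hN.evenPart ∨ x - z ∈ hN.evenPart)
    (hEm' : ∀ x, x ∈ E' ↔ x ∈ hN.evenPart ∨ x - (z + o) ∈ hN.evenPart)
    (hr : shell E 1 = ∅) {r : V} (hr' : r ∈ shell E' 1) : M ≤ N := by
  intro x hx
  by_contra hxN
  have h0 : ∀ x ∈ hN.evenPart, ⟪x, x⟫ ≠ (2 : ℝ) := fun x hx h => by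
    have hx0 : x ≠ 0 := by rintro rfl; simp at h
    have := h3 x hx.1 hx0
    linarith
  have hE0 : ∀ x ∈ E, ⟪x, x⟫ ≠ (2 : ℝ) := fun x hx h => by
    have : x ∈ shell E 1 := hE.mem_shell_one.2 ⟨hx, h⟩
    rw [hr] at this; simp at this
  have hoo : o + o ∈ hN.evenPart := hN.double_mem_evenPart (N.add_mem ho ho) (hN.isInt ho ho)
  have hle : ∀ {y : V}, (⟪y, y⟫ = 0 ∨ ⟪y, y⟫ = 1 ∨ ⟪y, y⟫ = 3 / 2 ∨ ⟪y, y⟫ = 2) → ⟪y, y⟫ < 3 :=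
    fun h => by rcases h with h | h | h | h <;> rw [h] <;> norm_num
  have hcoset : ∀ y, y - x ∈ N → 3 ≤ ⟪y, y⟫ ∧ IsInt ⟪y, y⟫ := fun y hy => by
    have hyM : y ∈ M := by have := M.add_mem (hNM hy) hx; rwa [sub_add_cancel] at this
    refine ⟨(hM y hyM).2 ?_, (hM y hyM).1⟩
    rintro rfl
    exact hxN (by simpa using hy)
  by_cases hxE : x ∈ E
  · have hxz : x - z ∈ hN.evenPart := ((hEm x).1 hxE).resolve_left fun h => hxN h.1
    obtain ⟨y, hy, hy2⟩ := hE.exists_short hEe hk hr (a := o) ((hEm _).2 (Or.inl hoo))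
    rcases (hEm _).1 hy with h | h
    · have hyN : y ∈ N := by have := N.add_mem h.1 ho; rwa [sub_add_cancel] at this
      have hy0 : y ≠ 0 := by
        rintro rfl
        exact ho' (by simpa using h)
      linarith [h3 y hyN hy0, hle hy2]
    · have := (hcoset y (by
        have := N.sub_mem (N.add_mem h.1 ho) hxz.1
        rwa [show y - o - z + o - (x - z) = y - x by abel] at this)).1
      linarith [hle hy2]
  have hxx : x + x ∈ hN.evenPart := hN.double_mem_evenPart (hM2 x hx) (hM x hx).1
  obtain ⟨y, hy, hy2⟩ := hE.exists_short hEe hk hr (a := x) ((hEm _).2 (Or.inl hxx))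
  have hyz : y - x - z ∈ hN.evenPart := ((hEm _).1 hy).resolve_left fun h => by
    linarith [(hcoset y h.1).1, hle hy2]
  have hz' : z + o + (z + o) ∈ hN.evenPart := by
    have := hN.evenPart.add_mem hz hoo
    rwa [show z + z + (o + o) = z + o + (z + o) by abel] at this
  obtain ⟨f1, f2, f3⟩ := hE'.frame_of_coset hEe' hk hz' h0 (fun x hx => (hEm' x).1 hx) hr'
  have hinner : ∀ v, v - x - z ∈ hN.evenPart → ∀ s ∈ shell E' 1,
      (3 ≤ ⟪v, v⟫ + 2 - 2 * ⟪s, v⟫ ∧ 3 ≤ ⟪v, v⟫ + 2 + 2 * ⟪s, v⟫) ∧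
        IsInt (⟪v, v⟫ + 2 + 2 * ⟪s, v⟫) := fun v hv s hs => by
    have hs2 := (hE'.mem_shell_one.1 hs).2
    have p1 := hcoset (v - s) (by
      have := N.sub_mem (N.sub_mem hv.1 (f3 s hs).1) ho
      rwa [show v - x - z - (s - (z + o)) - o = v - s - x by abel] at this)
    have p2 := hcoset (v + s) (by
      have := N.add_mem (N.add_mem (N.add_mem hv.1 (f3 s hs).1) ho) hz.1
      rwa [show v - x - z + (s - (z + o)) + o + (z + z) = v + s - x by abel] at this)
    have e1 : ⟪v - s, v - s⟫ = ⟪v, v⟫ + 2 - 2 * ⟪s, v⟫ := by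
      simp only [inner_sub_left, inner_sub_right, real_inner_comm s v, hs2]; ring
    have e2 : ⟪v + s, v + s⟫ = ⟪v, v⟫ + 2 + 2 * ⟪s, v⟫ := by
      simp only [inner_add_left, inner_add_right, real_inner_comm s v, hs2]; ring
    rw [e1] at p1
    rw [e2] at p2
    exact ⟨⟨p1.1, p2.1⟩, p2.2⟩
  have hyy : ⟪y, y⟫ = 2 := by
    have hsum : 4 * ⟪y, y⟫ ≤ 12 * (⟪y, y⟫ - 1) ^ 2 := by
      rw [← f1 y]
      calc ∑ s ∈ shell E' 1, ⟪s, y⟫ ^ 2 ≤ ∑ s ∈ shell E' 1, ((⟪y, y⟫ - 1) / 2) ^ 2 :=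
            Finset.sum_le_sum fun s hs => by
              obtain ⟨⟨a, b⟩, -⟩ := hinner y hyz s hs
              exact sq_le_sq' (by linarith) (by linarith)
        _ = _ := by rw [Finset.sum_const, f2]; simp; ring
    rcases hy2 with h | h | h | h
    · obtain ⟨⟨a, b⟩, -⟩ := hinner y hyz r hr'
      rw [h] at a b; linarith
    · rw [h] at hsum; norm_num at hsum
    · rw [h] at hsum; norm_num at hsum
    · exact h
  have hyyE : y + y ∈ E := by
    have := E.add_mem (E.add_mem hy hy) ((hEm _).2 (Or.inl hxx))
    rwa [show y - x + (y - x) + (x + x) = y + y by abel] at this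
  obtain ⟨F, hF, hFe, hFm⟩ := hE.exists_neighbor hyyE ⟨1, by rw [hyy]; norm_num⟩
    fun u hu _ => hEe u hu
  have hyF : y ∈ shell F 1 := hF.mem_shell_one.2 ⟨(hFm y).2 ⟨⟨2, by rw [hyy]; norm_num⟩,
    Or.inr (by simp)⟩, hyy⟩
  obtain ⟨g1, g2, g3⟩ := hF.frame_of_coset hFe hk hyyE hE0 (fun x hx => ((hFm x).1 hx).2) hyF
  have hmain : ∀ s ∈ shell F 1, ⟪s, r⟫ ^ 2 = ⟪y, r⟫ ^ 2 ∧
      (⟪y, r⟫ ^ 2 = 0 ∨ ⟪y, r⟫ ^ 2 = 1 / 4) := fun s hs => by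
    have hs2 := (hF.mem_shell_one.1 hs).2
    have hsy : s - y ∈ hN.evenPart := ((hEm _).1 (g3 s hs)).resolve_right fun h => by
      have := (hcoset s (by
        have := N.add_mem (N.add_mem h.1 hyz.1) hz.1
        rwa [show s - y - z + (y - x - z) + (z + z) = s - x by abel] at this)).1
      linarith
    have hsz : s - x - z ∈ hN.evenPart := by
      have := hN.evenPart.add_mem hsy hyz
      rwa [show s - y + (y - x - z) = s - x - z by abel] at this
    have hd : IsInt (⟪s, r⟫ - ⟪y, r⟫) := by
      rw [← inner_sub_left]
      exact hE'.isInt ((hEm' _).2 (Or.inl hsy)) (hE'.mem_shell_one.1 hr').1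
    have hval : ∀ v, v - x - z ∈ hN.evenPart → ⟪v, v⟫ = 2 →
        ⟪v, r⟫ ^ 2 = 0 ∧ ⟪v, r⟫ = 0 ∨ ⟪v, r⟫ ^ 2 = 1 / 4 ∧ IsInt (⟪v, r⟫ - 1 / 2) := by
      intro v hv hv2
      obtain ⟨⟨a, b⟩, c⟩ := hinner v hv r hr'
      rw [hv2, real_inner_comm] at a b c
      refine sq_half ?_ (by linarith) (by linarith)
      have := c.sub (isInt_two.add isInt_two)
      convert this using 1; ring
    have hno : ∀ a b : ℝ, a = 0 → IsInt (b - 1 / 2) → ¬ IsInt (a - b) := by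
      rintro a b rfl ⟨k, hk⟩ ⟨l, hl⟩
      have : (1 : ℝ) = ((-2 * l - 2 * k : ℤ) : ℝ) := by push_cast; linarith
      have : 1 = -2 * l - 2 * k := by exact_mod_cast this
      omega
    rcases hval y hyz hyy with ⟨a, a'⟩ | ⟨a, a'⟩ <;> rcases hval s hsz hs2 with ⟨b, b'⟩ | ⟨b, b'⟩
    · exact ⟨by rw [a, b], Or.inl a⟩
    · exact absurd (by simpa using hd.neg) (hno _ _ a' b')
    · exact absurd hd (hno _ _ b' a')
    · exact ⟨by rw [a, b], Or.inr a⟩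
  have hs := g1 r
  rw [Finset.sum_congr rfl fun s hs => (hmain s hs).1, Finset.sum_const, g2,
    (hE'.mem_shell_one.1 hr').2] at hs
  rcases (hmain y hyF).2 with h | h <;> rw [h] at hs <;> norm_num at hs

/-- A unimodular lattice of rank 24 and minimum at least 3 has no proper overlattice of exponent
two whose nonzero vectors have integral norms at least 3. -/
theorem SelfDual.overlattice_le (hN : SelfDual N) (hk : Module.finrank ℝ V = 24)
    {M : AddSubgroup V} (hNM : N ≤ M)
    (hM : ∀ u ∈ M, IsInt ⟪u, u⟫ ∧ (u ≠ 0 → 3 ≤ ⟪u, u⟫)) (hM2 : ∀ u ∈ M, u + u ∈ N) : M ≤ N := by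
  have h3 : ∀ u ∈ N, u ≠ 0 → 3 ≤ ⟪u, u⟫ := fun u hu => (hM u (hNM hu)).2
  by_cases hev : N ≤ hN.evenPart
  · intro x hx
    by_contra hxN
    have hNe : Even N := fun u hu => by
      obtain ⟨k, hk⟩ := (hev hu).2
      exact ⟨k, by linarith⟩
    have hr : shell N 1 = ∅ := Finset.eq_empty_of_forall_notMem fun u hu => by
      obtain ⟨h1, h2⟩ := hN.mem_shell_one.1 hu
      have hu0 : u ≠ 0 := by rintro rfl; simp at h2
      linarith [h3 u h1 hu0]
    obtain ⟨y, hy, hy2⟩ := hN.exists_short hNe hk hr (hM2 x hx)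
    have hyM : y ∈ M := by have := M.add_mem (hNM hy) hx; rwa [sub_add_cancel] at this
    have hy0 : y ≠ 0 := by
      rintro rfl
      exact hxN (by simpa using hy)
    have := (hM y hyM).2 hy0
    rcases hy2 with h | h | h | h <;> linarith
  obtain ⟨o, ho, ho'⟩ := SetLike.not_le_iff_exists.1 hev
  obtain ⟨c, hc, hch⟩ := hN.exists_char
  obtain ⟨z, rfl⟩ : ∃ z, z + z = c := ⟨(1 / 2 : ℝ) • c, by rw [← add_smul, add_halves, one_smul]⟩
  obtain ⟨E, hE, hEe, hzz, hEm⟩ := hN.exists_glue hk hc hch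
  have hc' : z + o + (z + o) ∈ N := by
    have := N.add_mem hc (N.add_mem ho ho)
    rwa [show z + z + (o + o) = z + o + (z + o) by abel] at this
  obtain ⟨E', hE', hEe', hzz', hEm'⟩ := hN.exists_glue hk hc' fun u hu => by
    obtain ⟨k, hk⟩ := hch u hu
    obtain ⟨l, hl⟩ := hN.isInt hu ho
    refine ⟨k - l, ?_⟩
    simp only [inner_add_right] at hk ⊢
    push_cast; linarith
  have hi : ∀ {a : V}, (∃ k : ℤ, ⟪a, a⟫ = 2 * (k : ℝ)) → IsInt ⟪a, a⟫ := fun h => by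
    obtain ⟨k, hk⟩ := h; rw [hk]; exact isInt_two.mul (isInt_intCast k)
  have hz := hN.double_mem_evenPart hc (hi hzz)
  have hz' := hN.double_mem_evenPart hc' (hi hzz')
  have hback : z + o + -o = z := by abel
  have ho2 : -o ∉ hN.evenPart := fun h => ho' (by simpa using hN.evenPart.neg_mem h)
  have h0 : ∀ x ∈ hN.evenPart, ⟪x, x⟫ ≠ (2 : ℝ) := fun x hx h => by
    have hx0 : x ≠ 0 := by rintro rfl; simp at h
    have := h3 x hx.1 hx0
    linarith
  rcases (shell E 1).eq_empty_or_nonempty with hr | ⟨s, hs⟩ <;>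
    rcases (shell E' 1).eq_empty_or_nonempty with hr' | ⟨r, hr'⟩
  · exact (hN.not_both_rootless hk h3 ho ho' hE hEe hE' hEe' hEm hEm' hr hr').elim
  · exact hN.le_of_rootless_of_rooted hk h3 hNM hM hM2 ho ho' hz hE hEe hE' hEe' hEm hEm' hr hr'
  · exact hN.le_of_rootless_of_rooted hk h3 hNM hM hM2 (N.neg_mem ho) ho2 hz' hE' hEe' hE hEe hEm'
      (by rw [hback]; exact hEm) hr' hs
  · obtain ⟨h1, h2⟩ := hE'.mem_shell_one.1 hr'
    exact (hN.not_both_rooted hk h3 ho ho' hz hE hEe (fun x hx => (hEm x).1 hx)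
      (((hEm' r).1 h1).resolve_left fun h => h0 r h h2) h2 hs).elim

end SDLattice

namespace SDLattice

variable {V : Type} [NormedAddCommGroup V] [InnerProductSpace ℝ V]
variable {N : AddSubgroup V} {m : ℕ}

lemma inner_pair (x : WithLp 2 (V × EuclideanSpace ℝ (Fin m))) (v : V) (t : Fin m → ℝ) :
    ⟪x, pair v t⟫ = ⟪x.fst, v⟫ + ∑ i, x.snd i * t i := by
  rw [inner_eq_add_sum]; simp

lemma quarter_le_sq {a : ℝ} (h : IsInt (a - 1 / 2)) : 1 / 4 ≤ a * a := by
  obtain ⟨k, hk⟩ := h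
  have ha : a = k + 1 / 2 := by linarith
  rw [ha]
  have : (0 : ℝ) ≤ k * (k + 1) := by
    have : 0 ≤ k * (k + 1) := by
      rcases le_or_gt 0 k with h | h
      · positivity
      · exact mul_nonneg_of_nonpos_of_nonpos h.le (by omega)
    exact_mod_cast this
  nlinarith

/-- There are no unimodular lattices of minimum at least 3 in dimensions between 1 and 22. -/
theorem SelfDual.false_of_finrank_le [FiniteDimensional ℝ V] (hN : SelfDual N)
    (h3 : ∀ u ∈ N, u ≠ 0 → 3 ≤ ⟪u, u⟫) {n : ℕ} (hk : Module.finrank ℝ V + (n + 2) = 24)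
    (h1 : 1 ≤ Module.finrank ℝ V) : False := by
  have : Nontrivial V := Module.nontrivial_of_finrank_pos (R := ℝ) (by omega)
  obtain ⟨c, hc, hch⟩ := hN.exists_char
  obtain ⟨j, hj⟩ := hN.char_norm hc hch
  have hk' : (Module.finrank ℝ V : ℝ) + (n + 2) = 24 := by exact_mod_cast hk
  obtain ⟨E, hE, hEe, hEm⟩ := hN.exists_even_glue hc hch (n + 2)
    ⟨3 + j, by rw [hj]; push_cast; linarith⟩
  have hdim := finrank_prod_eq (V := V) (n + 2)
  rw [hk] at hdim
  have : Nontrivial (WithLp 2 (V × EuclideanSpace ℝ (Fin (n + 2)))) :=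
    Module.nontrivial_of_finrank_pos (R := ℝ) (by omega)
  obtain ⟨A, hA⟩ := exists_moment_const (shell E 1) (fun _ => (1 : ℝ)) (fun x => x) 1
    (fun y y' hy => by simpa using hE.shell_sq_eq hEe hdim hy 1)
  have hA0 : ∑ x ∈ shell E 1, x.snd 0 * x.snd 0 = A := by
    have := hA (pair 0 (Pi.single 0 1))
    simp only [inner_pair, one_mul, pair_fst, pair_snd, inner_zero_right, zero_add, pow_one,
      Pi.single_apply, mul_ite, mul_one, mul_zero, Finset.sum_ite_eq', Finset.mem_univ, if_true,
      sq] at this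
    exact this
  have hAV := moment_step (shell E 1) (fun _ => (1 : ℝ)) (fun x => x.fst) A 0
    (fun y => by
      have := hA (pair y 0)
      simp only [inner_pair, pair_fst, Pi.zero_apply, mul_zero, Finset.sum_const_zero,
        add_zero] at this
      simpa using this) 0
  simp only [Nat.cast_zero, mul_zero, zero_add, one_mul, pow_zero, mul_one, add_zero] at hAV
  have hmem : pair 0 (fun i : Fin (n + 2) => if i = 0 ∨ i = 1 then (1 : ℝ) else 0) ∈ shell E 1 := by
    have hs : ∑ i : Fin (n + 2), (if i = 0 ∨ i = 1 then (1 : ℝ) else 0) = 2 := by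
      rw [Finset.sum_ite, Finset.sum_const_zero, Finset.sum_const, add_zero]
      have : (Finset.univ.filter fun i : Fin (n + 2) => i = 0 ∨ i = 1) = {0, 1} := by
        ext i; simp
      rw [this, Finset.card_pair (by simp)]; norm_num
    rw [hE.mem_shell_one, hEm]
    refine ⟨⟨⟨1, ?_⟩, Or.inl ⟨N.zero_mem, fun i => ?_⟩⟩, ?_⟩
    · simp only [pair_fst, pair_snd, inner_zero_left, hs]; norm_num
    · rw [pair_snd]; split_ifs
      exacts [isInt_one, isInt_zero]
    · rw [inner_pair, pair_fst, inner_zero_left, zero_add, ← hs]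
      exact Finset.sum_congr rfl fun i _ => by rw [pair_snd]; split_ifs <;> norm_num
  have hA1 : 1 ≤ A := by
    rw [← hA0]
    refine le_trans (le_of_eq ?_) (Finset.single_le_sum (fun x _ => mul_self_nonneg (x.snd 0)) hmem)
    simp
  have hle : ∀ x ∈ shell E 1, ⟪x.fst, x.fst⟫ ≤ max (8 - ((n : ℝ) + 2)) 0 * (x.snd 0 * x.snd 0) := by
    intro x hx
    obtain ⟨hx, hx2⟩ := hE.mem_shell_one.1 hx
    rw [inner_eq_add_sum] at hx2
    have hpos := mul_nonneg (le_max_right (8 - ((n : ℝ) + 2)) 0) (mul_self_nonneg (x.snd 0))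
    rcases ((hEm x).1 hx).2 with ⟨h, -⟩ | ⟨-, h⟩
    · by_cases h0 : x.fst = 0
      · rw [h0, inner_zero_left]; exact hpos
      · have := h3 _ h h0
        have := Finset.sum_nonneg fun i (_ : i ∈ Finset.univ) => mul_self_nonneg (x.snd i)
        linarith
    · have h4 : ((n : ℝ) + 2) * (1 / 4) ≤ ∑ i, x.snd i * x.snd i := by
        have := Finset.sum_le_sum fun i (_ : i ∈ Finset.univ) => quarter_le_sq (h i)
        simpa using this
      have h5 := quarter_le_sq (h 0)
      have h6 : 8 - ((n : ℝ) + 2) ≤ max (8 - ((n : ℝ) + 2)) 0 := le_max_left _ _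
      have h7 := le_max_right (8 - ((n : ℝ) + 2)) 0
      nlinarith
  have hsum := Finset.sum_le_sum hle
  rw [← Finset.mul_sum, hA0, hAV] at hsum
  have h1' : (1 : ℝ) ≤ Module.finrank ℝ V := by exact_mod_cast h1
  have hlt : max (8 - ((n : ℝ) + 2)) 0 < Module.finrank ℝ V := max_lt (by linarith) (by linarith)
  nlinarith

end SDLattice

namespace SDLattice

variable {V : Type} [NormedAddCommGroup V] [InnerProductSpace ℝ V]
variable {N : AddSubgroup V}

/-- The defining property of the even neighbour of `N ⊕ ℤᵐ` attached to `c`. -/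
def IsGlue (N : AddSubgroup V) {m : ℕ} (c : V)
    (E : AddSubgroup (WithLp 2 (V × EuclideanSpace ℝ (Fin m)))) : Prop :=
  ∀ x, x ∈ E ↔ (∃ k : ℤ, ⟪x.fst, c⟫ + ∑ i, x.snd i = 2 * (k : ℝ)) ∧
        (x ∈ SDLattice.addCubic N m ∨
          (x.fst - (1 / 2 : ℝ) • c ∈ N ∧ ∀ i, IsInt (x.snd i - 1 / 2)))

lemma sq_of_half {a : ℝ} (h : IsInt (a - 1 / 2)) : ∃ k : ℤ, a * a = 1 / 4 + 2 * (k : ℝ) := by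
  obtain ⟨l, hl⟩ := h
  obtain ⟨k, hk⟩ := Int.even_mul_succ_self l
  have : ((l * (l + 1) : ℤ) : ℝ) = ((k + k : ℤ) : ℝ) := by rw [hk]
  push_cast at this
  have ha : a = l + 1 / 2 := by linarith
  exact ⟨k, by rw [ha]; linarith⟩

lemma sum_sq_of_half {m : ℕ} {f : Fin m → ℝ} (h : ∀ i, IsInt (f i - 1 / 2)) :
    ∃ k : ℤ, ∑ i, f i * f i = m / 4 + 2 * (k : ℝ) := by
  choose k hk using fun i => sq_of_half (h i)
  refine ⟨∑ i, k i, ?_⟩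
  rw [Finset.sum_congr rfl fun i _ => hk i, Finset.sum_add_distrib, ← Finset.mul_sum,
    Int.cast_sum]
  simp; ring

variable {c : V} {E : AddSubgroup (WithLp 2 (V × EuclideanSpace ℝ (Fin 7)))}

lemma nine_quarters_le (hEe : Even E) (hc : c ∈ N)
    (h3 : ∀ u ∈ N, u ≠ 0 → 3 ≤ ⟪u, u⟫) {x : WithLp 2 (V × EuclideanSpace ℝ (Fin 7))}
    (hx : x ∈ E) (hx' : x.fst - (1 / 2 : ℝ) • c ∈ N) (hi : ∀ i, IsInt (x.snd i - 1 / 2)) :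
    9 / 4 ≤ ⟪x.fst, x.fst⟫ := by
  obtain ⟨k, hk⟩ := sum_sq_of_half hi
  obtain ⟨a, ha⟩ := hEe x hx
  rw [inner_eq_add_sum, hk] at ha
  push_cast at ha
  have h0 := real_inner_self_nonneg (x := x.fst)
  have h1 : (-1 : ℝ) < ((a - k - 1 : ℤ) : ℝ) := by push_cast; linarith
  have h2 : -1 < a - k - 1 := by exact_mod_cast h1
  rcases eq_or_ne (a - k - 1) 0 with h | h
  · exfalso
    have h' : ((a - k - 1 : ℤ) : ℝ) = 0 := by rw [h]; simp
    push_cast at h'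
    have hq : ⟪x.fst, x.fst⟫ = 1 / 4 := by linarith
    have hmem : x.fst + x.fst ∈ N := by
      have := N.add_mem (N.add_mem hx' hx') hc
      rwa [show x.fst - (1 / 2 : ℝ) • c + (x.fst - (1 / 2 : ℝ) • c) + c =
        x.fst + x.fst + (c - ((1 / 2 : ℝ) • c + (1 / 2 : ℝ) • c)) by abel, ← add_smul, add_halves,
        one_smul, sub_self, add_zero] at this
    have hn : ⟪x.fst + x.fst, x.fst + x.fst⟫ = (1 : ℝ) := by
      simp only [inner_add_left, inner_add_right, hq]; norm_num
    have := h3 _ hmem (fun h => by rw [h, inner_zero_left] at hn; norm_num at hn)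
    linarith
  · have h4 : 1 ≤ a - k - 1 := by omega
    have h5 : (1 : ℝ) ≤ ((a - k - 1 : ℤ) : ℝ) := by exact_mod_cast h4
    push_cast at h5
    linarith

lemma seven_quarters_le {f : Fin 7 → ℝ} (h : ∀ i, IsInt (f i - 1 / 2)) :
    7 / 4 ≤ ∑ i, f i * f i := by
  have := Finset.sum_le_sum fun i (_ : i ∈ Finset.univ) => quarter_le_sq (h i)
  norm_num at this ⊢
  linarith

lemma IsGlue.root (hEm : IsGlue N c E) [FiniteDimensional ℝ V] (hE : SelfDual E) (hEe : Even E)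
    (hc : c ∈ N) (h3 : ∀ u ∈ N, u ≠ 0 → 3 ≤ ⟪u, u⟫)
    {x : WithLp 2 (V × EuclideanSpace ℝ (Fin 7))} (hx : x ∈ shell E 1) :
    x.fst = 0 ∧ (∀ i, IsInt (x.snd i)) ∧ ∑ i, x.snd i * x.snd i = 2 := by
  obtain ⟨hx, hx2⟩ := hE.mem_shell_one.1 hx
  rw [inner_eq_add_sum] at hx2
  rcases ((hEm x).1 hx).2 with ⟨h, hi⟩ | ⟨h, hi⟩
  · have h0 : x.fst = 0 := by
      by_contra h0
      have := h3 _ h h0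
      have := Finset.sum_nonneg fun i (_ : i ∈ Finset.univ) => mul_self_nonneg (x.snd i)
      linarith
    rw [h0, inner_zero_left, zero_add] at hx2
    exact ⟨h0, hi, hx2⟩
  · linarith [nine_quarters_le hEe hc h3 hx h hi, seven_quarters_le hi]

lemma IsGlue.shell_two (hEm : IsGlue N c E) [FiniteDimensional ℝ V] (hN : SelfDual N)
    (hE : SelfDual E) (hEe : Even E)
    (hc : c ∈ N) (h3 : ∀ u ∈ N, u ≠ 0 → 3 ≤ ⟪u, u⟫)
    {x : WithLp 2 (V × EuclideanSpace ℝ (Fin 7))} (hx : x ∈ shell E 2) :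
    (x.fst = 0 ∧ (∀ i, IsInt (x.snd i)) ∧ ∑ i, x.snd i * x.snd i = 4) ∨
    (x.fst ∈ N ∧ ⟪x.fst, x.fst⟫ = 3 ∧ (∀ i, IsInt (x.snd i)) ∧ ∑ i, x.snd i * x.snd i = 1) ∨
    (∀ i, x.snd i = 0) ∨
    (x.fst - (1 / 2 : ℝ) • c ∈ N ∧ ⟪x.fst, x.fst⟫ = 9 / 4 ∧ ∀ i, x.snd i * x.snd i = 1 / 4) := by
  obtain ⟨hx, hx2⟩ := hE.mem_shell_two.1 hx
  rw [inner_eq_add_sum] at hx2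
  have hpos := Finset.sum_nonneg fun i (_ : i ∈ Finset.univ) => mul_self_nonneg (x.snd i)
  rcases ((hEm x).1 hx).2 with ⟨h, hi⟩ | ⟨h, hi⟩
  · by_cases h0 : x.fst = 0
    · rw [h0, inner_zero_left, zero_add] at hx2
      exact Or.inl ⟨h0, hi, hx2⟩
    · right
      have h3' := h3 _ h h0
      obtain ⟨k, hk⟩ := hN.isInt h h
      have k1 : (3 : ℝ) ≤ k := by linarith
      have k2 : (k : ℝ) ≤ 4 := by linarith
      have k3 : 3 ≤ k := by exact_mod_cast k1
      have k4 : k ≤ 4 := by exact_mod_cast k2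
      interval_cases k
      · left
        refine ⟨h, by rw [hk]; norm_num, hi, ?_⟩
        push_cast at hk; linarith
      · right; left
        have h0 : ∑ i, x.snd i * x.snd i = 0 := by push_cast at hk; linarith
        intro i
        exact mul_self_eq_zero.1 ((Finset.sum_eq_zero_iff_of_nonneg
          fun i _ => mul_self_nonneg (x.snd i)).1 h0 i (Finset.mem_univ i))
  · right; right; right
    have h9 := nine_quarters_le hEe hc h3 hx h hi
    have h7 := seven_quarters_le hi
    refine ⟨h, by linarith, fun i => ?_⟩
    have hs : ∑ i, (x.snd i * x.snd i - 1 / 4) = 0 := by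
      rw [Finset.sum_sub_distrib]; norm_num; linarith
    have := (Finset.sum_eq_zero_iff_of_nonneg fun i _ => sub_nonneg.2 (quarter_le_sq (hi i))).1 hs i
      (Finset.mem_univ i)
    linarith

/-- The harmonic quartic `x₀⁴ - 6 x₀²x₁² + x₁⁴`. -/
def quartic (x : WithLp 2 (V × EuclideanSpace ℝ (Fin 7))) : ℝ :=
  x.snd 0 ^ 4 - 6 * x.snd 0 ^ 2 * x.snd 1 ^ 2 + x.snd 1 ^ 4

lemma sum_quartic_eq [FiniteDimensional ℝ V] (hE : SelfDual E) (hEe : Even E)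
    (hk : Module.finrank ℝ V = 25) :
    ∑ x ∈ shell E 2, quartic x = 456 * ∑ x ∈ shell E 1, quartic x := by
  have hdim := finrank_prod_eq (V := V) 7
  rw [hk] at hdim
  set h : ℝ := √2 / 2 with hh
  have h2 : h ^ 2 = 1 / 2 := by rw [hh, div_pow, Real.sq_sqrt (by norm_num)]; norm_num
  have h4 : h ^ 4 = 1 / 4 := by rw [show h ^ 4 = (h ^ 2) ^ 2 by ring, h2]; norm_num
  have key : ∀ (a b : ℝ) (x : WithLp 2 (V × EuclideanSpace ℝ (Fin 7))),
      ⟪x, pair (0 : V) ![a, b, 0, 0, 0, 0, 0]⟫ = x.snd 0 * a + x.snd 1 * b := fun a b x => by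
    rw [inner_pair, inner_zero_right, zero_add, Fin.sum_univ_seven]; simp
  obtain ⟨f, hf⟩ := hE.exists_modularForm hEe (k := 4) hdim ![(1 : ℝ), 1, -1, -1]
    ![pair (0 : V) ![1, 0, 0, 0, 0, 0, 0], pair (0 : V) ![0, 1, 0, 0, 0, 0, 0],
      pair (0 : V) ![h, h, 0, 0, 0, 0, 0], pair (0 : V) ![h, -h, 0, 0, 0, 0, 0]] 1 (fun j => by
        fin_cases j
        · change ⟪pair (0 : V) ![1, 0, 0, 0, 0, 0, 0], pair (0 : V) ![1, 0, 0, 0, 0, 0, 0]⟫ = 1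
          rw [key]; simp
        · change ⟪pair (0 : V) ![0, 1, 0, 0, 0, 0, 0], pair (0 : V) ![0, 1, 0, 0, 0, 0, 0]⟫ = 1
          rw [key]; simp
        · change ⟪pair (0 : V) ![h, h, 0, 0, 0, 0, 0], pair (0 : V) ![h, h, 0, 0, 0, 0, 0]⟫ = 1
          rw [key]; simp; linarith
        · change ⟪pair (0 : V) ![h, -h, 0, 0, 0, 0, 0], pair (0 : V) ![h, -h, 0, 0, 0, 0, 0]⟫ = 1
          rw [key]; simp; linarith) 4 (fun d hd m => by
        rw [Finset.sum_comm]
        interval_cases d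
        · simp [Fin.sum_univ_four]
        · exact Finset.sum_eq_zero fun j _ => by
            rw [← Finset.mul_sum, hE.shell_odd m _ (by decide), mul_zero]
        · rw [Finset.sum_comm]
          refine Finset.sum_eq_zero fun x _ => ?_
          rw [Fin.sum_univ_four]
          simp only [Matrix.cons_val, key]
          linear_combination (-2 * (x.snd 0 ^ 2 + x.snd 1 ^ 2)) * h2
        · exact Finset.sum_eq_zero fun j _ => by
            rw [← Finset.mul_sum, hE.shell_odd m _ (by decide), mul_zero])
  have hval : ∀ x : WithLp 2 (V × EuclideanSpace ℝ (Fin 7)),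
      ∑ j, ![(1 : ℝ), 1, -1, -1] j * ⟪x, ![pair (0 : V) ![1, 0, 0, 0, 0, 0, 0],
        pair (0 : V) ![0, 1, 0, 0, 0, 0, 0], pair (0 : V) ![h, h, 0, 0, 0, 0, 0],
        pair (0 : V) ![h, -h, 0, 0, 0, 0, 0]] j⟫ ^ 4 = 1 / 2 * quartic x := fun x => by
    rw [Fin.sum_univ_four]
    simp only [Matrix.cons_val, key, quartic]
    linear_combination (-2 * (x.snd 0 ^ 4 + 6 * x.snd 0 ^ 2 * x.snd 1 ^ 2 + x.snd 1 ^ 4)) * h4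
  simp only [hval, ← Finset.mul_sum] at hf
  have h0 := coeff_two_of_weight_twenty f (by rw [hf, hE.shell_zero]; simp [quartic])
  rw [hf, hf] at h0
  have h1 : (1 / 2 * ∑ x ∈ shell E 2, quartic x : ℝ) =
    456 * (1 / 2 * ∑ x ∈ shell E 1, quartic x) := by exact_mod_cast h0
  linarith

end SDLattice

namespace SDLattice

variable {V : Type} [NormedAddCommGroup V] [InnerProductSpace ℝ V]
variable {N : AddSubgroup V} {c : V}
  {E : AddSubgroup (WithLp 2 (V × EuclideanSpace ℝ (Fin 7)))}

lemma IsInt.exists_fin_three {a : ℝ} (h : IsInt a) (ha : a * a < 4) :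
    ∃ j : Fin 3, a = (((j : ℤ) - 1 : ℤ) : ℝ) := by
  obtain ⟨k, rfl⟩ := h
  have h1 : k * k < 4 := by exact_mod_cast ha
  have h2 : -2 < k := by nlinarith
  have h3 : k < 2 := by nlinarith
  refine ⟨⟨(k + 1).toNat, by omega⟩, ?_⟩
  congr 1
  simp only
  omega

set_option maxRecDepth 100000 in
lemma sum_quartic_fin_three : ∑ g : Fin 7 → Fin 3,
    (if ∑ i, ((g i : ℤ) - 1) ^ 2 = 2 then ((g 0 : ℤ) - 1) ^ 4 -
      6 * ((g 0 : ℤ) - 1) ^ 2 * ((g 1 : ℤ) - 1) ^ 2 + ((g 1 : ℤ) - 1) ^ 4 else 0) = 24 := by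
  decide +kernel

lemma ext_pair {m : ℕ} {x y : WithLp 2 (V × EuclideanSpace ℝ (Fin m))} (h : x.fst = y.fst)
    (h' : ∀ i, x.snd i = y.snd i) : x = y := by
  have h2 : x.snd = y.snd := by ext i; exact h' i
  exact (WithLp.ofLp_injective 2) (Prod.ext h h2)

lemma IsGlue.sum_root_quartic (hEm : IsGlue N c E) [FiniteDimensional ℝ V] (hE : SelfDual E)
    (hEe : Even E) (hc : c ∈ N) (h3 : ∀ u ∈ N, u ≠ 0 → 3 ≤ ⟪u, u⟫) :
    ∑ x ∈ shell E 1, quartic x = 24 := by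
  have h24 := congrArg (fun n : ℤ => (n : ℝ)) sum_quartic_fin_three
  rw [← Finset.sum_filter] at h24
  rw [show (24 : ℝ) = ((24 : ℤ) : ℝ) by norm_num, ← h24, Int.cast_sum]
  symm
  refine Finset.sum_nbij (fun g => pair (0 : V) fun i => (((g i : ℤ) - 1 : ℤ) : ℝ)) ?_ ?_ ?_ ?_
  · intro g hg
    have hg := (Finset.mem_filter.1 hg).2
    have hg' : ∑ i, (((g i : ℤ) - 1 : ℤ) : ℝ) * (((g i : ℤ) - 1 : ℤ) : ℝ) = 2 := by
      have := congrArg (fun n : ℤ => (n : ℝ)) hg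
      push_cast at this ⊢
      rw [← this]
      exact Finset.sum_congr rfl fun i _ => (sq _).symm
    rw [hE.mem_shell_one, hEm]
    refine ⟨⟨?_, Or.inl ⟨?_, ?_⟩⟩, ?_⟩
    · obtain ⟨k, hk⟩ := even_sum_sq_sub Finset.univ
        (fun i => (((g i : ℤ) - 1 : ℤ) : ℝ)) (fun i _ => isInt_intCast _)
      simp only [pair_fst, pair_snd, inner_zero_left]
      refine ⟨1 - k, ?_⟩
      push_cast at hk hg' ⊢
      linarith
    · simp only [pair_fst]; exact N.zero_mem
    · intro i; simp only [pair_snd]; exact isInt_intCast _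
    · rw [inner_eq_add_sum]
      simp only [pair_fst, pair_snd, inner_zero_left, zero_add]; exact hg'
  · intro g _ g' _ h
    ext i
    have := congrArg (fun x => x.snd i) h
    simp only [pair_snd, Int.cast_inj, sub_left_inj, Nat.cast_inj] at this
    exact this
  · intro x hx
    obtain ⟨h0, hi, h2⟩ := hEm.root hE hEe hc h3 hx
    have : ∀ i, ∃ j : Fin 3, x.snd i = (((j : ℤ) - 1 : ℤ) : ℝ) := fun i =>
      (hi i).exists_fin_three (by
        have := Finset.single_le_sum (f := fun i => x.snd i * x.snd i)
          (fun i _ => mul_self_nonneg (x.snd i)) (Finset.mem_univ i)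
        linarith)
    choose g hg using this
    refine ⟨g, ?_, ?_⟩
    · simp only [Finset.coe_filter, Finset.mem_univ, true_and, Set.mem_ofPred_eq]
      have : ((∑ i, ((g i : ℤ) - 1) ^ 2 : ℤ) : ℝ) = (2 : ℤ) := by
        rw [Int.cast_sum, Int.cast_ofNat, ← h2]
        exact Finset.sum_congr rfl fun i _ => by rw [hg i]; push_cast; ring
      exact_mod_cast this
    · exact ext_pair (by rw [pair_fst, h0]) fun i => by rw [pair_snd, hg]
  · intro g _
    simp only [quartic, pair_snd]
    push_cast
    ring

lemma IsGlue.exists_norm_three (hEm : IsGlue N c E) [FiniteDimensional ℝ V] (hN : SelfDual N)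
    (hE : SelfDual E) (hEe : Even E) (hk : Module.finrank ℝ V = 25)
    (hc : c ∈ N) (h3 : ∀ u ∈ N, u ≠ 0 → 3 ≤ ⟪u, u⟫) : ∃ u ∈ N, ⟪u, u⟫ = (3 : ℝ) := by
  classical
  by_contra! hne
  have h1 := sum_quartic_eq hE hEe hk
  rw [hEm.sum_root_quartic hE hEe hc h3] at h1
  set D1 := (shell E 2).filter fun x => x.fst = 0 ∧ ∀ i, IsInt (x.snd i) ∧ x.snd i * x.snd i < 4
    with hD1
  set D2 := (Finset.univ : Finset (Fin 7 × Bool)).image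
    (fun p => pair (0 : V) (Pi.single p.1 (if p.2 then (2 : ℝ) else -2))) with hD2
  have hle : ∑ x ∈ shell E 2, quartic x ≤
      ∑ x ∈ shell E 2, ((if x ∈ D1 then (1 : ℝ) else 0) + if x ∈ D2 then 16 else 0) := by
    refine Finset.sum_le_sum fun x hx => ?_
    have hpos : (0 : ℝ) ≤ if x ∈ D1 then (1 : ℝ) else 0 := by split_ifs <;> norm_num
    have hpos' : (0 : ℝ) ≤ if x ∈ D2 then (16 : ℝ) else 0 := by split_ifs <;> norm_num
    rcases hEm.shell_two hN hE hEe hc h3 hx with ⟨h0, hi, h4⟩ | ⟨h, h', -⟩ | h | ⟨-, -, h⟩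
    · have hall : ∀ i, x.snd i * x.snd i ≤ 4 := fun i => by
        have := Finset.single_le_sum (f := fun i => x.snd i * x.snd i)
          (fun i _ => mul_self_nonneg (x.snd i)) (Finset.mem_univ i)
        linarith
      by_cases hx1 : ∀ i, x.snd i * x.snd i < 4
      · have : x ∈ D1 := Finset.mem_filter.2 ⟨hx, h0, fun i => ⟨hi i, hx1 i⟩⟩
        rw [if_pos this]
        have : quartic x ≤ 1 := by
          obtain ⟨j, hj⟩ := (hi 0).exists_fin_three (hx1 0)
          obtain ⟨j', hj'⟩ := (hi 1).exists_fin_three (hx1 1)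
          rw [quartic, hj, hj']
          fin_cases j <;> fin_cases j' <;> norm_num
        linarith
      · push Not at hx1
        obtain ⟨i, hi4⟩ := hx1
        have hi4 : x.snd i * x.snd i = 4 := le_antisymm (hall i) hi4
        have hz : ∀ j, j ≠ i → x.snd j = 0 := fun j hj => by
          rw [← Finset.add_sum_erase _ _ (Finset.mem_univ i), hi4] at h4
          have h5 : ∑ i ∈ Finset.univ.erase i, x.snd i * x.snd i = 0 := by linarith
          exact mul_self_eq_zero.1 ((Finset.sum_eq_zero_iff_of_nonneg
            fun i _ => mul_self_nonneg (x.snd i)).1 h5 j (by simp [hj]))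
        have hi2 : x.snd i = 2 ∨ x.snd i = -2 := by
          apply mul_self_eq_mul_self_iff.1; rw [hi4]; norm_num
        have : x ∈ D2 := by
          refine Finset.mem_image.2 ⟨(i, decide (x.snd i = 2)), Finset.mem_univ _, ?_⟩
          refine ext_pair (by rw [pair_fst, h0]) fun j => ?_
          rw [pair_snd]
          rcases eq_or_ne j i with rfl | hj
          · rcases hi2 with h | h
            · simp [h]
            · simp only [Pi.single_eq_same, h]; norm_num
          · simp [hj, hz j hj]
        rw [if_pos this]
        have : quartic x ≤ 16 := by
          rw [quartic]
          nlinarith [mul_nonneg (mul_self_nonneg (x.snd 0)) (mul_self_nonneg (x.snd 1)), h4,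
            Fin.sum_univ_seven fun i => x.snd i * x.snd i, hall 0, hall 1,
            mul_self_nonneg (x.snd 0), mul_self_nonneg (x.snd 1)]
        linarith
    · exact absurd h' (hne _ h)
    · have : quartic x = 0 := by rw [quartic, h, h]; norm_num
      linarith
    · have : quartic x ≤ 0 := by
        rw [quartic, show x.snd 0 ^ 4 - 6 * x.snd 0 ^ 2 * x.snd 1 ^ 2 + x.snd 1 ^ 4 =
          (x.snd 0 * x.snd 0) ^ 2 - 6 * (x.snd 0 * x.snd 0) * (x.snd 1 * x.snd 1) +
            (x.snd 1 * x.snd 1) ^ 2 by ring, h, h]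
        norm_num
      linarith
  rw [Finset.sum_add_distrib, ← Finset.sum_filter, ← Finset.sum_filter, Finset.sum_const,
    Finset.sum_const, nsmul_eq_mul, nsmul_eq_mul] at hle
  have c1 : ((shell E 2).filter fun x => x ∈ D1).card ≤ 3 ^ 7 := by
    have hex : ∀ x : WithLp 2 (V × EuclideanSpace ℝ (Fin 7)), ∃ g : Fin 7 → Fin 3, x ∈ D1 →
        ∀ i, x.snd i = (((g i : ℤ) - 1 : ℤ) : ℝ) := fun x => by
      by_cases hx : x ∈ D1
      · choose g hg using fun i => ((Finset.mem_filter.1 hx).2.2 i).1.exists_fin_three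
          ((Finset.mem_filter.1 hx).2.2 i).2
        exact ⟨g, fun _ => hg⟩
      · exact ⟨0, fun h => absurd h hx⟩
    choose g hg using hex
    have := Finset.card_le_card_of_injOn (s := (shell E 2).filter fun x => x ∈ D1)
      (t := (Finset.univ : Finset (Fin 7 → Fin 3))) g (fun _ _ => Finset.mem_univ _)
      (fun x hx y hy h => by
        have hx := (Finset.mem_filter.1 hx).2
        have hy := (Finset.mem_filter.1 hy).2
        refine ext_pair ?_ fun i => ?_
        · rw [(Finset.mem_filter.1 hx).2.1, (Finset.mem_filter.1 hy).2.1]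
        · rw [hg x hx, hg y hy, h])
    simpa using this
  have c2 : ((shell E 2).filter fun x => x ∈ D2).card ≤ 14 := by
    refine (Finset.card_le_card (t := D2) fun x hx => (Finset.mem_filter.1 hx).2).trans ?_
    refine Finset.card_image_le.trans ?_
    simp
  have c1' : (((shell E 2).filter fun x => x ∈ D1).card : ℝ) ≤ 3 ^ 7 := by exact_mod_cast c1
  have c2' : (((shell E 2).filter fun x => x ∈ D2).card : ℝ) ≤ 14 := by exact_mod_cast c2
  rw [h1, mul_one] at hle
  linarith [show (3 : ℝ) ^ 7 = 2187 by norm_num]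

end SDLattice

namespace SDLattice

variable {V : Type} [NormedAddCommGroup V] [InnerProductSpace ℝ V] [FiniteDimensional ℝ V]
variable {N : AddSubgroup V} {c : V}
  {E : AddSubgroup (WithLp 2 (V × EuclideanSpace ℝ (Fin 7)))}

lemma IsGlue.sum_mixed_pow_eq (hEm : IsGlue N c E) (hE : SelfDual E) (hEe : Even E)
    (hk : Module.finrank ℝ V = 25) (hc : c ∈ N) (h3 : ∀ u ∈ N, u ≠ 0 → 3 ≤ ⟪u, u⟫)
    {u u' : V} (hu : ⟪u, u⟫ = ⟪u', u'⟫) (α : ℝ) {d : ℕ} (hd : d ≤ 7) :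
    ∑ x ∈ shell E 2, (⟪x.fst, u⟫ + x.snd 0 * α) ^ d =
      ∑ x ∈ shell E 2, (⟪x.fst, u'⟫ + x.snd 0 * α) ^ d := by
  have hdim := finrank_prod_eq (V := V) 7
  rw [hk] at hdim
  have key : ∀ (v : V) (x : WithLp 2 (V × EuclideanSpace ℝ (Fin 7))),
      ⟪x, pair v (Pi.single 0 α)⟫ = ⟪x.fst, v⟫ + x.snd 0 * α := fun v x => by
    rw [inner_pair]; simp [Pi.single_apply]
  have := hE.shell_pow_eq hEe (k := 4) hdim (y := pair u (Pi.single 0 α))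
    (y' := pair u' (Pi.single 0 α)) (by rw [key, key]; simp only [pair_fst, pair_snd, hu]) 7 (by norm_num) (fun d _ =>
      Finset.sum_congr rfl fun x hx => by
        rw [key, key, (hEm.root hE hEe hc h3 hx).1, inner_zero_left, inner_zero_left]) d hd 2
  simpa only [key] using this

lemma IsGlue.sum_mixed_eq (hEm : IsGlue N c E) (hE : SelfDual E) (hEe : Even E)
    (hk : Module.finrank ℝ V = 25) (hc : c ∈ N) (h3 : ∀ u ∈ N, u ≠ 0 → 3 ≤ ⟪u, u⟫)
    {u u' : V} (hu : ⟪u, u⟫ = ⟪u', u'⟫) :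
    ∑ x ∈ shell E 2, x.snd 0 ^ 2 * (1 - x.snd 0 ^ 2) * ⟪x.fst, u⟫ ^ 2 =
      ∑ x ∈ shell E 2, x.snd 0 ^ 2 * (1 - x.snd 0 ^ 2) * ⟪x.fst, u'⟫ ^ 2 ∧
    ∑ x ∈ shell E 2, x.snd 0 ^ 2 * ⟪x.fst, u⟫ ^ 4 =
      ∑ x ∈ shell E 2, x.snd 0 ^ 2 * ⟪x.fst, u'⟫ ^ 4 := by
  have e := fun (α : ℝ) (d : ℕ) (hd : d ≤ 7) => hEm.sum_mixed_pow_eq hE hEe hk hc h3 hu α hd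
  constructor
  · have key : ∀ v : V, ∑ x ∈ shell E 2, x.snd 0 ^ 2 * (1 - x.snd 0 ^ 2) * ⟪x.fst, v⟫ ^ 2 =
        1 / 12 * (∑ x ∈ shell E 2, (⟪x.fst, v⟫ + x.snd 0 * 1) ^ 4
          + ∑ x ∈ shell E 2, (⟪x.fst, v⟫ + x.snd 0 * -1) ^ 4
          - 2 * ∑ x ∈ shell E 2, (⟪x.fst, v⟫ + x.snd 0 * 0) ^ 4
          - 2 * ∑ x ∈ shell E 2, x.snd 0 ^ 4)
        - 1 / 360 * (∑ x ∈ shell E 2, (⟪x.fst, v⟫ + x.snd 0 * 2) ^ 6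
          + ∑ x ∈ shell E 2, (⟪x.fst, v⟫ + x.snd 0 * -2) ^ 6
          - 4 * ∑ x ∈ shell E 2, (⟪x.fst, v⟫ + x.snd 0 * 1) ^ 6
          - 4 * ∑ x ∈ shell E 2, (⟪x.fst, v⟫ + x.snd 0 * -1) ^ 6
          + 6 * ∑ x ∈ shell E 2, (⟪x.fst, v⟫ + x.snd 0 * 0) ^ 6
          - 120 * ∑ x ∈ shell E 2, x.snd 0 ^ 6) := fun v => by
      simp only [Finset.mul_sum, ← Finset.sum_add_distrib, ← Finset.sum_sub_distrib]
      exact Finset.sum_congr rfl fun x _ => by ring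
    rw [key, key, e 1 4 (by norm_num), e (-1) 4 (by norm_num), e 0 4 (by norm_num),
      e 2 6 (by norm_num), e (-2) 6 (by norm_num), e 1 6 (by norm_num), e (-1) 6 (by norm_num),
      e 0 6 (by norm_num)]
  · have key : ∀ v : V, ∑ x ∈ shell E 2, x.snd 0 ^ 2 * ⟪x.fst, v⟫ ^ 4 =
        - 1 / 360 * (∑ x ∈ shell E 2, (⟪x.fst, v⟫ + x.snd 0 * 2) ^ 6
          + ∑ x ∈ shell E 2, (⟪x.fst, v⟫ + x.snd 0 * -2) ^ 6
          - 16 * ∑ x ∈ shell E 2, (⟪x.fst, v⟫ + x.snd 0 * 1) ^ 6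
          - 16 * ∑ x ∈ shell E 2, (⟪x.fst, v⟫ + x.snd 0 * -1) ^ 6
          + 30 * ∑ x ∈ shell E 2, (⟪x.fst, v⟫ + x.snd 0 * 0) ^ 6
          - 96 * ∑ x ∈ shell E 2, x.snd 0 ^ 6) := fun v => by
      simp only [Finset.mul_sum, ← Finset.sum_add_distrib, ← Finset.sum_sub_distrib]
      exact Finset.sum_congr rfl fun x _ => by ring
    rw [key, key,
      e 2 6 (by norm_num), e (-2) 6 (by norm_num), e 1 6 (by norm_num), e (-1) 6 (by norm_num),
      e 0 6 (by norm_num)]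

/-- Norm 4 vectors of `E` whose first component is a norm 3 vector of `N` and whose second
component is `±e₀`. -/
def axisShell (E : AddSubgroup (WithLp 2 (V × EuclideanSpace ℝ (Fin 7)))) :
    Finset (WithLp 2 (V × EuclideanSpace ℝ (Fin 7))) :=
  open scoped Classical in (shell E 2).filter fun x => x.fst ≠ 0 ∧ x.snd 0 * x.snd 0 = 1

/-- Norm 4 vectors of `E` with half-integral second component. -/
def halfShell (E : AddSubgroup (WithLp 2 (V × EuclideanSpace ℝ (Fin 7)))) :
    Finset (WithLp 2 (V × EuclideanSpace ℝ (Fin 7))) :=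
  open scoped Classical in (shell E 2).filter fun x => x.snd 0 * x.snd 0 = 1 / 4

lemma IsInt.sq_ne_quarter {a : ℝ} (h : IsInt a) : a * a ≠ 1 / 4 := by
  obtain ⟨k, rfl⟩ := h
  intro h
  have h4 : 4 * (k * k) = 1 := by
    have : (4 : ℝ) * (k * k) = 1 := by linarith
    exact_mod_cast this
  omega

lemma IsGlue.of_mem_axisShell (hEm : IsGlue N c E) (hN : SelfDual N)
    (hE : SelfDual E) (hEe : Even E)
    (hc : c ∈ N) (h3 : ∀ u ∈ N, u ≠ 0 → 3 ≤ ⟪u, u⟫)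
    {x : WithLp 2 (V × EuclideanSpace ℝ (Fin 7))} (hx : x ∈ axisShell E) :
    x.fst ∈ N ∧ ⟪x.fst, x.fst⟫ = (3 : ℝ) ∧ x.snd 0 * x.snd 0 = 1 ∧ ∀ i ≠ 0, x.snd i = 0 := by
  classical
  obtain ⟨hx, h0, h1⟩ := Finset.mem_filter.1 hx
  rcases hEm.shell_two hN hE hEe hc h3 hx with ⟨h, -⟩ | ⟨h, h', -, h4⟩ | h | ⟨-, -, h⟩
  · exact absurd h h0
  · refine ⟨h, h', h1, fun i hi => ?_⟩
    rw [← Finset.add_sum_erase _ _ (Finset.mem_univ 0), h1] at h4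
    have h5 : ∑ i ∈ Finset.univ.erase 0, x.snd i * x.snd i = 0 := by linarith
    exact mul_self_eq_zero.1 ((Finset.sum_eq_zero_iff_of_nonneg
      fun i _ => mul_self_nonneg (x.snd i)).1 h5 i (by simp [hi]))
  · rw [h] at h1; norm_num at h1
  · rw [h] at h1; norm_num at h1

lemma IsGlue.of_mem_halfShell (hEm : IsGlue N c E) (hN : SelfDual N)
    (hE : SelfDual E) (hEe : Even E)
    (hc : c ∈ N) (h3 : ∀ u ∈ N, u ≠ 0 → 3 ≤ ⟪u, u⟫)
    {x : WithLp 2 (V × EuclideanSpace ℝ (Fin 7))} (hx : x ∈ halfShell E) :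
    x.fst - (1 / 2 : ℝ) • c ∈ N ∧ ⟪x.fst, x.fst⟫ = (9 / 4 : ℝ) := by
  classical
  obtain ⟨hx, h1⟩ := Finset.mem_filter.1 hx
  rcases hEm.shell_two hN hE hEe hc h3 hx with ⟨-, h, -⟩ | ⟨-, -, h, -⟩ | h | ⟨h, h2, -⟩
  · exact absurd h1 (h 0).sq_ne_quarter
  · exact absurd h1 (h 0).sq_ne_quarter
  · rw [h] at h1; norm_num at h1
  · exact ⟨h, h2⟩

/-- Sums over the norm 4 vectors of `E` weighted by a function of the first coordinate of the
second component split into the contributions of the two relevant types. -/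
lemma IsGlue.sum_split (hEm : IsGlue N c E) (hN : SelfDual N)
    (hE : SelfDual E) (hEe : Even E)
    (hc : c ∈ N) (h3 : ∀ u ∈ N, u ≠ 0 → 3 ≤ ⟪u, u⟫) (g : ℝ → ℝ) (hg : g 0 = 0)
    (f : V → ℝ) (hf : f 0 = 0) :
    ∑ x ∈ shell E 2, g (x.snd 0 ^ 2) * f x.fst =
      g 1 * ∑ x ∈ axisShell E, f x.fst + g (1 / 4) * ∑ x ∈ halfShell E, f x.fst := by
  classical
  rw [axisShell, halfShell, Finset.sum_filter, Finset.sum_filter, Finset.mul_sum, Finset.mul_sum,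
    ← Finset.sum_add_distrib]
  refine Finset.sum_congr rfl fun x hx => ?_
  rcases hEm.shell_two hN hE hEe hc h3 hx with ⟨h, -⟩ | ⟨h, h', hi, h4⟩ | h | ⟨-, h', h⟩
  · simp [h, hf]
  · have h0 : x.fst ≠ 0 := fun h0 => by rw [h0, inner_zero_left] at h'; norm_num at h'
    have hle := Finset.single_le_sum (f := fun i => x.snd i * x.snd i)
      (fun i _ => mul_self_nonneg (x.snd i)) (Finset.mem_univ 0)
    obtain ⟨j, hj⟩ := (hi 0).exists_fin_three (by linarith)
    rw [hj]
    fin_cases j <;> norm_num [h0, hg]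
  · simp [h, hg]
  · have h0 := h 0
    rw [sq, h0]
    norm_num

/-- The degree 2 and 4 moments of the norm 4 vectors of `E` along a vector of norm 3. -/
lemma IsGlue.moments (hEm : IsGlue N c E) (hN : SelfDual N) (hE : SelfDual E) (hEe : Even E)
    (hk : Module.finrank ℝ V = 25) (hc : c ∈ N) (h3 : ∀ u ∈ N, u ≠ 0 → 3 ≤ ⟪u, u⟫)
    {y : V} (hy : ⟪y, y⟫ = (3 : ℝ)) :
    ∑ x ∈ halfShell E, ⟪x.fst, y⟫ ^ 2 = 27 / 100 * (halfShell E).card ∧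
    ∑ x ∈ axisShell E, (⟪x.fst, y⟫ ^ 4 - ⟪x.fst, y⟫ ^ 2) +
      1 / 4 * ∑ x ∈ halfShell E, (⟪x.fst, y⟫ ^ 4 - 3 / 4 * ⟪x.fst, y⟫ ^ 2) = 0 := by
  have : Nontrivial V := Module.nontrivial_of_finrank_pos (R := ℝ) (by omega)
  have e := fun (u u' : V) (hu : ⟪u, u⟫ = ⟪u', u'⟫) => hEm.sum_mixed_eq hE hEe hk hc h3 hu
  constructor
  · have hh : ∀ u : V, ∑ x ∈ shell E 2, x.snd 0 ^ 2 * (1 - x.snd 0 ^ 2) * ⟪x.fst, u⟫ ^ 2 =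
        3 / 16 * ∑ x ∈ halfShell E, ⟪x.fst, u⟫ ^ 2 := fun u => by
      rw [hEm.sum_split hN hE hEe hc h3 (fun s => s * (1 - s)) (by simp) (fun v => ⟪v, u⟫ ^ 2)
        (by simp)]
      ring
    obtain ⟨A, hA⟩ := exists_moment_const (halfShell E) (fun _ => (1 : ℝ)) (fun x => x.fst) 1
      (fun u u' hu => by
        have := (e u u' hu).1
        rw [hh, hh] at this
        simp only [one_mul, mul_one]
        linarith)
    have h1 := moment_step (halfShell E) (fun _ => (1 : ℝ)) (fun x => x.fst) A 0
      (by simpa using hA) y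
    have h2 := hA y
    rw [Finset.sum_congr rfl fun x hx => by
      rw [(hEm.of_mem_halfShell hN hE hEe hc h3 hx).2]] at h1
    rw [hk] at h1
    simp only [hy, one_mul, mul_zero, pow_zero, mul_one, Finset.sum_const, nsmul_eq_mul,
      Nat.cast_zero, zero_add, add_zero, pow_one] at h1 h2
    push_cast at h1
    rw [h2]
    linarith
  · obtain ⟨K, hK⟩ := exists_moment_const (shell E 2) (fun x => x.snd 0 ^ 2) (fun x => x.fst) 2
      (fun u u' hu => (e u u' hu).2)
    have h1 := moment_step (shell E 2) (fun x => x.snd 0 ^ 2) (fun x => x.fst) K 1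
      (by simpa using hK) y
    have h2 := hK y
    rw [hk, hy] at h1
    rw [hy] at h2
    have s1 := hEm.sum_split hN hE hEe hc h3 (fun s => s) rfl (fun v => ⟪v, y⟫ ^ 4)
        (by simp)
    have s2 := hEm.sum_split hN hE hEe hc h3 (fun s => s) rfl (fun v => ⟪v, v⟫ * ⟪v, y⟫ ^ 2)
        (by simp)
    simp only [← mul_assoc] at s2
    norm_num [-inner_self_eq_norm_sq_to_K] at h1 h2 s1 s2
    rw [s1] at h2
    rw [s2, Finset.sum_congr rfl fun x hx => by
        rw [(hEm.of_mem_axisShell hN hE hEe hc h3 hx).2.1],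
      Finset.sum_congr (rfl : halfShell E = _) fun x hx => by
        rw [(hEm.of_mem_halfShell hN hE hEe hc h3 hx).2], ← Finset.mul_sum, ← Finset.mul_sum] at h1
    rw [Finset.sum_sub_distrib, Finset.sum_sub_distrib, ← Finset.mul_sum]
    linarith

end SDLattice

namespace SDLattice

variable {V : Type} [NormedAddCommGroup V] [InnerProductSpace ℝ V] [FiniteDimensional ℝ V]
variable {N : AddSubgroup V} {c : V}
  {E : AddSubgroup (WithLp 2 (V × EuclideanSpace ℝ (Fin 7)))}

/-- Vectors of the two types occurring in `axisShell` have inner product `0, ±1, ±3` with a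
norm 3 vector. -/
lemma SelfDual.inner_of_norm_three (hN : SelfDual N) (h3 : ∀ u ∈ N, u ≠ 0 → 3 ≤ ⟪u, u⟫) {u y : V}
    (hu : u ∈ N) (hu3 : ⟪u, u⟫ = (3 : ℝ)) (hy : y ∈ N) (hy3 : ⟪y, y⟫ = (3 : ℝ)) :
    ⟪u, y⟫ = (0 : ℝ) ∨ ⟪u, y⟫ = (1 : ℝ) ∨ ⟪u, y⟫ = (-1 : ℝ) ∨ u = y ∨ u = -y := by
  obtain ⟨k, hk⟩ := hN.isInt hu hy
  have e1 : ⟪u - y, u - y⟫ = 6 - 2 * (k : ℝ) := by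
    rw [inner_sub_left, inner_sub_right, inner_sub_right, real_inner_comm u y, hk, hu3, hy3]; ring
  have e2 : ⟪u + y, u + y⟫ = 6 + 2 * (k : ℝ) := by
    rw [inner_add_left, inner_add_right, inner_add_right, real_inner_comm u y, hk, hu3, hy3]; ring
  by_cases h1 : u = y
  · exact Or.inr (Or.inr (Or.inr (Or.inl h1)))
  by_cases h2 : u = -y
  · exact Or.inr (Or.inr (Or.inr (Or.inr h2)))
  have l1 := h3 _ (N.sub_mem hu hy) (sub_ne_zero.2 h1)
  have l2 := h3 _ (N.add_mem hu hy) (fun h => h2 (eq_neg_of_add_eq_zero_left h))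
  rw [e1] at l1
  rw [e2] at l2
  have k1 : ((2 * k : ℤ) : ℝ) ≤ (3 : ℤ) := by push_cast; linarith
  have k2 : ((-3 : ℤ) : ℝ) ≤ (2 * k : ℤ) := by push_cast; linarith
  have k1 : 2 * k ≤ 3 := by exact_mod_cast k1
  have k2 : -3 ≤ 2 * k := by exact_mod_cast k2
  rw [hk]
  have : k = 0 ∨ k = 1 ∨ k = -1 := by omega
  rcases this with rfl | rfl | rfl <;> simp

/-- Vectors occurring in `halfShell` have inner product `±1/2, ±3/2` with a norm 3 vector. -/
lemma SelfDual.inner_of_half (hN : SelfDual N) (h3 : ∀ u ∈ N, u ≠ 0 → 3 ≤ ⟪u, u⟫)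
    (hc : c ∈ N) (hch : ∀ u ∈ N, ∃ k : ℤ, ⟪u, u⟫ - ⟪u, c⟫ = 2 * (k : ℝ)) {v y : V}
    (hv : v - (1 / 2 : ℝ) • c ∈ N) (hv9 : ⟪v, v⟫ = (9 / 4 : ℝ)) (hy : y ∈ N)
    (hy3 : ⟪y, y⟫ = (3 : ℝ)) :
    ⟪v, y⟫ ^ 2 = 1 / 4 ∨ ⟪v, y⟫ = 3 / 2 ∨ ⟪v, y⟫ = -(3 / 2) := by
  have hvv : v + v ∈ N := by
    have := N.add_mem (N.add_mem hv hv) hc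
    rwa [show v - (1 / 2 : ℝ) • c + (v - (1 / 2 : ℝ) • c) + c =
      v + v + (c - ((1 / 2 : ℝ) • c + (1 / 2 : ℝ) • c)) by abel, ← add_smul, add_halves,
      one_smul, sub_self, add_zero] at this
  obtain ⟨k, hk⟩ := hN.isInt hv hy
  obtain ⟨j, hj⟩ := hch y hy
  rw [inner_sub_left, real_inner_smul_left] at hk
  rw [hy3] at hj
  have ha : ⟪v, y⟫ = ((2 * (k - j) + 3 : ℤ) : ℝ) / 2 := by
    push_cast
    linarith [real_inner_comm c y]
  have e1 : ⟪v + v - (y + y), v + v - (y + y)⟫ = 21 - 8 * ⟪v, y⟫ := by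
    simp only [inner_sub_left, inner_sub_right, inner_add_left, inner_add_right,
      real_inner_comm v y, hv9, hy3]; ring
  have e2 : ⟪v + v + (y + y), v + v + (y + y)⟫ = 21 + 8 * ⟪v, y⟫ := by
    simp only [inner_add_left, inner_add_right, real_inner_comm v y, hv9, hy3]; ring
  have hyy := N.add_mem hy hy
  set n := 2 * (k - j) + 3 with hn
  have odd : n % 2 = 1 := by omega
  have n1 : v + v - (y + y) ≠ 0 := fun h => by
    rw [h, inner_zero_left, ha] at e1
    have : ((4 * n : ℤ) : ℝ) = (21 : ℤ) := by push_cast; linarith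
    have : 4 * n = 21 := by exact_mod_cast this
    omega
  have n2 : v + v + (y + y) ≠ 0 := fun h => by
    rw [h, inner_zero_left, ha] at e2
    have : ((4 * n : ℤ) : ℝ) = (-21 : ℤ) := by push_cast; linarith
    have : 4 * n = -21 := by exact_mod_cast this
    omega
  have l1 := h3 _ (N.sub_mem hvv hyy) n1
  have l2 := h3 _ (N.add_mem hvv hyy) n2
  rw [e1, ha] at l1
  rw [e2, ha] at l2
  have k1 : ((4 * n : ℤ) : ℝ) ≤ (18 : ℤ) := by push_cast; linarith
  have k2 : ((-18 : ℤ) : ℝ) ≤ (4 * n : ℤ) := by push_cast; linarith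
  have k1 : 4 * n ≤ 18 := by exact_mod_cast k1
  have k2 : -18 ≤ 4 * n := by exact_mod_cast k2
  rw [ha]
  have : n = 1 ∨ n = -1 ∨ n = 3 ∨ n = -3 := by omega
  rcases this with h | h | h | h <;> rw [h] <;> norm_num

/-- Vectors of norm `9/4` in the half coset extend to norm 4 vectors of `E` with all but the last
sign prescribed. -/
lemma IsGlue.exists_mem_halfShell (hEm : IsGlue N c E) (hN : SelfDual N) (hE : SelfDual E)
    (hc : c ∈ N) (hcc : ∃ k : ℤ, ⟪c, c⟫ = 25 + 8 * (k : ℝ))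
    {v : V} (hv : v - (1 / 2 : ℝ) • c ∈ N) (hv9 : ⟪v, v⟫ = (9 / 4 : ℝ)) (b : Fin 6 → Bool) :
    ∃ x ∈ halfShell E, x.fst = v ∧
      ∀ i, x.snd (Fin.castSucc i) = if b i then (1 / 2 : ℝ) else -(1 / 2) := by
  classical
  set f : Fin 6 → ℝ := fun i => if b i then (1 / 2 : ℝ) else -(1 / 2) with hf
  have hfi : ∀ i, IsInt (f i - 1 / 2) := fun i => by
    simp only [hf]; split_ifs
    · exact ⟨0, by norm_num⟩
    · exact ⟨-1, by norm_num⟩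
  have hff : ∀ i, f i * f i = 1 / 4 := fun i => by
    simp only [hf]; split_ifs <;> norm_num
  obtain ⟨l, hl⟩ : ∃ l : ℤ, ⟪v, c⟫ + ∑ i, f i + 1 / 2 = l := by
    obtain ⟨k, hk⟩ := hcc
    obtain ⟨j, hj⟩ := hN.isInt hv hc
    obtain ⟨n, hn⟩ := isInt_sum Finset.univ _ fun i _ => hfi i
    rw [inner_sub_left, real_inner_smul_left, hk] at hj
    simp only [Finset.sum_sub_distrib, Finset.sum_const, Finset.card_univ, Fintype.card_fin,
      nsmul_eq_mul] at hn
    refine ⟨j + n + 16 + 4 * k, ?_⟩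
    push_cast at hn ⊢
    linarith
  have mk : ∀ s : ℝ, IsInt (s - 1 / 2) → s * s = 1 / 4 →
      (∃ k : ℤ, ⟪v, c⟫ + ∑ i, f i + s = 2 * (k : ℝ)) → pair v (Fin.snoc f s : Fin 7 → ℝ) ∈
        halfShell E := fun s hs hss hk => by
    refine Finset.mem_filter.2 ⟨hE.mem_shell_two.2 ⟨(hEm _).2 ⟨?_, Or.inr ⟨hv, fun i => ?_⟩⟩, ?_⟩, ?_⟩
    · simp only [pair_fst, pair_snd, Fin.sum_univ_castSucc (n := 6), Fin.snoc_castSucc,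
        Fin.snoc_last, ← add_assoc]
      exact hk
    · rw [pair_snd]
      refine Fin.lastCases ?_ (fun i => ?_) i
      · rw [Fin.snoc_last]; exact hs
      · rw [Fin.snoc_castSucc]; exact hfi i
    · rw [inner_eq_add_sum]
      simp only [pair_fst, pair_snd, Fin.sum_univ_castSucc (n := 6), Fin.snoc_castSucc,
        Fin.snoc_last, hv9, hff, hss]
      norm_num
    · exact hff 0
  rcases Int.even_or_odd' l with ⟨k, hk | hk⟩
  · refine ⟨_, mk (1 / 2) ⟨0, by norm_num⟩ (by norm_num) ⟨k, ?_⟩, rfl, fun i => ?_⟩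
    · rw [hl, hk]; push_cast; ring
    · rw [pair_snd, Fin.snoc_castSucc]
  · refine ⟨_, mk (-(1 / 2)) ⟨-1, by norm_num⟩ (by norm_num) ⟨k, ?_⟩, rfl, fun i => ?_⟩
    · have : ((l : ℤ) : ℝ) = 2 * k + 1 := by rw [hk]; push_cast; ring
      linarith
    · rw [pair_snd, Fin.snoc_castSucc]

/-- There is no unimodular lattice of rank 25 and minimum at least 3. -/
theorem SelfDual.false_of_finrank_eq_twenty_five (hN : SelfDual N)
    (hk : Module.finrank ℝ V = 25) (h3 : ∀ u ∈ N, u ≠ 0 → 3 ≤ ⟪u, u⟫) : False := by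
  classical
  obtain ⟨c, hc, hch⟩ := hN.exists_char
  obtain ⟨j, hj⟩ := hN.char_norm hc hch
  rw [hk] at hj
  push_cast at hj
  obtain ⟨E, hE, hEe, hEm⟩ := hN.exists_even_glue hc hch 7 ⟨4 + j, by rw [hj]; push_cast; ring⟩
  change IsGlue N c E at hEm
  obtain ⟨y, hy, hy3⟩ := hEm.exists_norm_three hN hE hEe hk hc h3
  obtain ⟨m1, m2⟩ := hEm.moments hN hE hEe hk hc h3 hy3
  set P := (axisShell E).filter fun x => x.fst = y ∨ x.fst = -y with hP
  set Q := (halfShell E).filter fun x => ⟪x.fst, y⟫ = (3 / 2 : ℝ) ∨ ⟪x.fst, y⟫ = (-(3 / 2) : ℝ)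
    with hQ
  have eP : ∑ x ∈ axisShell E, (⟪x.fst, y⟫ ^ 4 - ⟪x.fst, y⟫ ^ 2) = 72 * P.card := by
    rw [hP, Finset.card_filter, Nat.cast_sum, Finset.mul_sum]
    refine Finset.sum_congr rfl fun x hx => ?_
    obtain ⟨hxN, hx3, -⟩ := hEm.of_mem_axisShell hN hE hEe hc h3 hx
    split_ifs with h
    · rcases h with h | h <;> rw [h] <;> simp only [inner_neg_left, hy3] <;> norm_num
    · rcases hN.inner_of_norm_three h3 hxN hx3 hy hy3 with h' | h' | h' | h' | h'
      · rw [h']; norm_num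
      · rw [h']; norm_num
      · rw [h']; norm_num
      · exact absurd (Or.inl h') h
      · exact absurd (Or.inr h') h
  have hcase : ∀ x ∈ halfShell E, ⟪x.fst, y⟫ ^ 2 = (1 / 4 : ℝ) ∨
      ⟪x.fst, y⟫ = (3 / 2 : ℝ) ∨ ⟪x.fst, y⟫ = (-(3 / 2) : ℝ) := fun x hx => by
    obtain ⟨h1, h2⟩ := hEm.of_mem_halfShell hN hE hEe hc h3 hx
    exact hN.inner_of_half h3 hc hch h1 h2 hy hy3
  have eQ : ∀ a b : ℝ, ∑ x ∈ halfShell E, (a * (⟪x.fst, y⟫ ^ 2) ^ 2 + b * ⟪x.fst, y⟫ ^ 2) =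
      (a / 16 + b / 4) * (halfShell E).card + (5 * a + 2 * b) * Q.card := fun a b => by
    rw [hQ, Finset.card_filter, Nat.cast_sum, Finset.mul_sum, Finset.card_eq_sum_ones,
      Nat.cast_sum, Finset.mul_sum, ← Finset.sum_add_distrib]
    refine Finset.sum_congr rfl fun x hx => ?_
    split_ifs with h
    · have : ⟪x.fst, y⟫ ^ 2 = (9 / 4 : ℝ) := by rcases h with h | h <;> rw [h] <;> norm_num
      rw [this]; push_cast; ring
    · rcases hcase x hx with h' | h'
      · rw [h']; push_cast; ring
      · exact absurd h' h
  have q1 := eQ 0 1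
  simp only [zero_mul, one_mul, zero_add] at q1
  rw [m1] at q1
  have q2 : ∑ x ∈ halfShell E, (⟪x.fst, y⟫ ^ 4 - 3 / 4 * ⟪x.fst, y⟫ ^ 2) = _ :=
    (Finset.sum_congr rfl fun x _ => by ring).trans (eQ 1 (-(3 / 4)))
  rw [eP, q2] at m2
  have hPQ : (Q.card : ℝ) = 32 * P.card := by linarith
  have hPQ : Q.card = 32 * P.card := by exact_mod_cast hPQ
  have hP4 : P.card ≤ 4 := by
    have : P ⊆ (Finset.univ : Finset (Bool × Bool)).image fun p =>
        pair (if p.1 then y else -y) (Pi.single 0 (if p.2 then (1 : ℝ) else -1)) := fun x hx => by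
      obtain ⟨hx, hxy⟩ := Finset.mem_filter.1 hx
      obtain ⟨-, -, h1, h0⟩ := hEm.of_mem_axisShell hN hE hEe hc h3 hx
      refine Finset.mem_image.2 ⟨(decide (x.fst = y), decide (x.snd 0 = 1)), Finset.mem_univ _,
        ext_pair ?_ fun i => ?_⟩
      · rw [pair_fst]
        by_cases h : x.fst = y
        · simp [h]
        · simp only [h, decide_false]
          exact (hxy.resolve_left h).symm
      · rw [pair_snd]
        rcases eq_or_ne i 0 with rfl | hi
        · rw [Pi.single_eq_same]
          by_cases h : x.snd 0 = 1
          · simp [h]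
          · simp only [h, decide_false]
            exact ((mul_self_eq_one_iff.1 h1).resolve_left h).symm
        · rw [h0 i hi]; simp [hi]
    refine (Finset.card_le_card this).trans (Finset.card_image_le.trans ?_)
    simp
  have hP1 : 0 < P.card := by
    obtain ⟨k, hk⟩ := hch y hy
    rw [hy3] at hk
    refine Finset.card_pos.2 ⟨pair y (Pi.single 0 1), Finset.mem_filter.2
      ⟨Finset.mem_filter.2 ⟨hE.mem_shell_two.2 ⟨(hEm _).2 ⟨⟨2 - k, ?_⟩, Or.inl ⟨hy, fun i => ?_⟩⟩,
        ?_⟩, ?_, ?_⟩, Or.inl rfl⟩⟩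
    · simp only [pair_fst, pair_snd, Finset.sum_pi_single', Finset.mem_univ, if_true]
      push_cast
      linarith
    · rw [pair_snd, Pi.single_apply]; split_ifs
      exacts [isInt_one, isInt_zero]
    · rw [inner_pair]
      simp only [pair_fst, pair_snd, hy3, Pi.single_apply]
      simp; norm_num
    · intro h
      rw [pair_fst] at h
      rw [h, inner_zero_left] at hy3; norm_num at hy3
    · simp
  obtain ⟨x, hx⟩ : Q.Nonempty := Finset.card_pos.1 (by omega)
  obtain ⟨hx, hxy⟩ := Finset.mem_filter.1 hx
  obtain ⟨hxc, hx9⟩ := hEm.of_mem_halfShell hN hE hEe hc h3 hx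
  have hneg : ∀ v : V, v - (1 / 2 : ℝ) • c ∈ N → -v - (1 / 2 : ℝ) • c ∈ N := fun v hv => by
    have := N.sub_mem (N.neg_mem hv) hc
    rwa [show -(v - (1 / 2 : ℝ) • c) - c =
      -v - (1 / 2 : ℝ) • c + (((1 / 2 : ℝ) • c + (1 / 2 : ℝ) • c) - c) by abel, ← add_smul,
      add_halves, one_smul, sub_self, add_zero] at this
  obtain ⟨s, hsc, hs9, hsy⟩ : ∃ s : V, s - (1 / 2 : ℝ) • c ∈ N ∧ ⟪s, s⟫ = (9 / 4 : ℝ) ∧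
      ⟪s, y⟫ = (3 / 2 : ℝ) := by
    rcases hxy with h | h
    · exact ⟨_, hxc, hx9, h⟩
    · exact ⟨-x.fst, hneg _ hxc, by rw [inner_neg_neg, hx9], by rw [inner_neg_left, h]; norm_num⟩
  have hys9 : ⟪y - s, y - s⟫ = (9 / 4 : ℝ) := by
    rw [inner_sub_left, inner_sub_right, inner_sub_right, real_inner_comm s y, hsy, hy3, hs9]
    norm_num
  have hysy : ⟪y - s, y⟫ = (3 / 2 : ℝ) := by
    rw [inner_sub_left, hsy, hy3]; norm_num
  have hysc : y - s - (1 / 2 : ℝ) • c ∈ N := by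
    have := N.add_mem hy (hneg s hsc)
    rwa [show y + (-s - (1 / 2 : ℝ) • c) = y - s - (1 / 2 : ℝ) • c by abel] at this
  have d1 : s ≠ -s := fun h => by
    have := congrArg (fun v => ⟪v, y⟫) h
    simp only [inner_neg_left, hsy] at this
    norm_num at this
  have d2 : s ≠ y - s := fun h => by
    have h' := congrArg (fun v => ⟪s, v⟫) h
    simp only [inner_sub_right, hsy, hs9] at h'
    norm_num at h'
  have d3 : -s ≠ y - s := fun h => by
    have := congrArg (fun v => ⟪v, y⟫) h
    simp only [inner_neg_left, hsy, hysy] at this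
    norm_num at this
  have hw : ∀ i : Fin 3, ![s, -s, y - s] i - (1 / 2 : ℝ) • c ∈ N ∧
      ⟪![s, -s, y - s] i, ![s, -s, y - s] i⟫ = (9 / 4 : ℝ) ∧
      (⟪![s, -s, y - s] i, y⟫ = (3 / 2 : ℝ) ∨ ⟪![s, -s, y - s] i, y⟫ = (-(3 / 2) : ℝ)) := by
    intro i
    fin_cases i
    · exact ⟨hsc, hs9, Or.inl hsy⟩
    · exact ⟨hneg s hsc, (inner_neg_neg s s).trans hs9,
        Or.inr ((inner_neg_left s y).trans (by rw [hsy]))⟩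
    · exact ⟨hysc, hys9, Or.inl hysy⟩
  have hinj : Function.Injective ![s, -s, y - s] := by
    intro i i' h
    fin_cases i <;> fin_cases i' <;> first
      | rfl
      | exact absurd h d1
      | exact absurd h d2
      | exact absurd h d3
      | exact absurd h.symm d1
      | exact absurd h.symm d2
      | exact absurd h.symm d3
  choose g hg1 hg2 hg3 using fun p : Fin 3 × (Fin 6 → Bool) =>
    hEm.exists_mem_halfShell hN hE hc ⟨j, hj⟩ (hw p.1).1 (hw p.1).2.1 p.2
  have hcard := Finset.card_le_card_of_injOn (s := Finset.univ) (t := Q) g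
    (fun p _ => Finset.mem_coe.2 (Finset.mem_filter.2 ⟨hg1 p, by rw [hg2]; exact (hw p.1).2.2⟩))
    (fun p _ p' _ h => by
      refine Prod.ext (hinj (by rw [← hg2, ← hg2, h])) ?_
      ext i
      have := hg3 p i
      rw [h, hg3 p' i] at this
      revert this
      cases p.2 i <;> cases p'.2 i <;> norm_num)
  have : (Finset.univ : Finset (Fin 3 × (Fin 6 → Bool))).card = 192 := by
    simp
  omega

end SDLattice

namespace SDLattice

variable {V : Type} [NormedAddCommGroup V] [InnerProductSpace ℝ V]

/-- An integral lattice `Q` all of whose dual vectors in `M ⊇ Q` have integral norm lies in a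
self-dual lattice contained in `M`. -/
lemma exists_selfDual_between {Q M : AddSubgroup V} (hQM : Q ≤ M)
    (hQ : ∀ x ∈ Q, ∀ y ∈ Q, IsInt ⟪x, y⟫) (hd : ∀ x, (∀ y ∈ Q, IsInt ⟪x, y⟫) → x ∈ M)
    (hM : ∀ x ∈ M, IsInt ⟪x, x⟫) : ∃ N : AddSubgroup V, SelfDual N ∧ Q ≤ N ∧ N ≤ M := by
  obtain ⟨N, hQN, ⟨hNM, hNi⟩, hmax⟩ := zorn_le_nonempty₀
    {N : AddSubgroup V | N ≤ M ∧ ∀ x ∈ N, ∀ y ∈ N, IsInt ⟪x, y⟫} (fun C hC hch N₀ hN₀ => by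
      refine ⟨sSup C, ⟨sSup_le fun N hN => (hC hN).1, fun x hx y hy => ?_⟩, fun N hN => le_sSup hN⟩
      rw [AddSubgroup.mem_sSup_of_directedOn ⟨N₀, hN₀⟩ hch.directedOn] at hx hy
      obtain ⟨N₁, h1, hx⟩ := hx
      obtain ⟨N₂, h2, hy⟩ := hy
      rcases hch.total h1 h2 with h | h
      · exact (hC h2).2 x (h hx) y hy
      · exact (hC h1).2 x hx y (h hy)) Q ⟨hQM, hQ⟩
  refine ⟨N, fun x => ⟨fun hx y hy => hNi x hx y hy, fun hx => ?_⟩, hQN, hNM⟩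
  have hxM : x ∈ M := hd x fun y hy => hx y (hQN hy)
  refine hmax (y := N ⊔ AddSubgroup.zmultiples x) ⟨sup_le hNM ?_, ?_⟩ le_sup_left
    (AddSubgroup.mem_sup_right (AddSubgroup.mem_zmultiples x))
  · rw [AddSubgroup.zmultiples_le]; exact hxM
  · intro u hu v hv
    obtain ⟨a, ha, _, ⟨k, rfl⟩, rfl⟩ := AddSubgroup.mem_sup.1 hu
    obtain ⟨b, hb, _, ⟨l, rfl⟩, rfl⟩ := AddSubgroup.mem_sup.1 hv
    simp only [inner_add_left, inner_add_right, ← Int.cast_smul_eq_zsmul ℝ, real_inner_smul_left,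
      real_inner_smul_right]
    have hax : IsInt ⟪a, x⟫ := by rw [real_inner_comm]; exact hx a ha
    exact ((hNi a ha b hb).add ((isInt_intCast k).mul (hx b hb))).add
      (((isInt_intCast l).mul hax).add
        ((isInt_intCast l).mul ((isInt_intCast k).mul (hM x hxM))))

/-- An involutive isometry preserving the lattice `L`. -/
structure IsInvol (L : AddSubgroup V) (s : V →ₗ[ℝ] V) : Prop where
  invol : ∀ x, s (s x) = x
  inner : ∀ x y, ⟪s x, s y⟫ = ⟪x, y⟫
  map : ∀ x ∈ L, s x ∈ L

variable {L : AddSubgroup V} {s : V →ₗ[ℝ] V} {W W' : Submodule ℝ V}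

lemma IsInvol.neg (h : IsInvol L s) : IsInvol L (-s) where
  invol x := by simp [h.invol]
  inner x y := by simp [h.inner]
  map x hx := by simpa using h.map x hx

lemma IsInvol.finrank_add [FiniteDimensional ℝ V] (h : IsInvol L s) (hW : ∀ x, x ∈ W ↔ s x = x)
    (hW' : ∀ x, x ∈ W' ↔ s x = -x) :
    Module.finrank ℝ W + Module.finrank ℝ W' = Module.finrank ℝ V := by
  refine Submodule.finrank_add_eq_of_isCompl ⟨?_, ?_⟩
  · rw [Submodule.disjoint_def]
    intro x hx hx'
    rw [hW] at hx
    rw [hW', hx] at hx'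
    have : (2 : ℝ) • x = 0 := by rw [two_smul]; nth_rw 1 [hx']; exact neg_add_cancel x
    exact (smul_eq_zero.1 this).resolve_left two_ne_zero
  · rw [codisjoint_iff, eq_top_iff]
    intro x _
    refine Submodule.mem_sup.2 ⟨(1 / 2 : ℝ) • (x + s x), ?_, (1 / 2 : ℝ) • (x - s x), ?_, ?_⟩
    · rw [hW, map_smul, map_add, h.invol, add_comm]
    · rw [hW', map_smul, map_sub, h.invol, ← smul_neg, neg_sub]
    · rw [← smul_add, show x + s x + (x - s x) = x + x by abel, smul_add, ← add_smul, add_halves,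
        one_smul]

/-- The rescaled fixed lattice `{u ∈ W | √2 u ∈ L}`. -/
def scaled (L : AddSubgroup V) (W : Submodule ℝ V) : AddSubgroup W where
  carrier := {u | √2 • (u : V) ∈ L}
  zero_mem' := by simp
  add_mem' {u v} hu hv := by
    change √2 • ((u : V) + v) ∈ L
    rw [smul_add]; exact L.add_mem hu hv
  neg_mem' {u} hu := by
    change √2 • (-(u : V)) ∈ L
    rw [smul_neg]; exact L.neg_mem hu

lemma mem_scaled {u : W} : u ∈ scaled L W ↔ √2 • (u : V) ∈ L := Iff.rfl

/-- The rescaled projection of `L` to `W`. -/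
def scaledProj (L : AddSubgroup V) (s : V →ₗ[ℝ] V) (W : Submodule ℝ V) : AddSubgroup W where
  carrier := {u | ∃ x ∈ L, √2 • (u : V) = x + s x}
  zero_mem' := ⟨0, L.zero_mem, by simp⟩
  add_mem' {u v} hu hv := by
    obtain ⟨x, hx, hux⟩ := hu
    obtain ⟨y, hy, hvy⟩ := hv
    refine ⟨x + y, L.add_mem hx hy, ?_⟩
    rw [Submodule.coe_add, smul_add, hux, hvy, map_add]; abel
  neg_mem' {u} hu := by
    obtain ⟨x, hx, hux⟩ := hu
    refine ⟨-x, L.neg_mem hx, ?_⟩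
    rw [Submodule.coe_neg, smul_neg, hux, map_neg]; abel

lemma two_mul_inner (u v : V) : 2 * ⟪u, v⟫ = ⟪√2 • u, √2 • v⟫ := by
  rw [real_inner_smul_left, real_inner_smul_right, ← mul_assoc, Real.mul_self_sqrt (by norm_num)]

lemma IsInvol.inner_left (h : IsInvol L s) (x y : V) : ⟪s x, y⟫ = ⟪x, s y⟫ := by
  rw [← h.inner, h.invol]

lemma scaled_norm (hLe : Even L) (h6 : ∀ x ∈ L, x ≠ 0 → 6 ≤ ⟪x, x⟫) (u : W)
    (hu : u ∈ scaled L W) : IsInt ⟪u, u⟫ ∧ (u ≠ 0 → 3 ≤ ⟪u, u⟫) := by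
  rw [mem_scaled] at hu
  rw [Submodule.coe_inner]
  have h2 := two_mul_inner (u : V) u
  constructor
  · obtain ⟨k, hk⟩ := hLe _ hu
    exact ⟨k, by linarith⟩
  · intro h0
    have := h6 _ hu (smul_ne_zero (by norm_num) (by simpa using h0))
    linarith

lemma IsInvol.exists_selfDual (h : IsInvol L s) (hL : SelfDual L) (hLe : Even L)
    (h6 : ∀ x ∈ L, x ≠ 0 → 6 ≤ ⟪x, x⟫) (hW : ∀ x, x ∈ W ↔ s x = x) :
    ∃ N : AddSubgroup W, SelfDual N ∧ N ≤ scaled L W ∧ ∀ u ∈ scaled L W, u + u ∈ N := by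
  obtain ⟨N, hN, h1, h2⟩ := exists_selfDual_between (Q := scaledProj L s W) (M := scaled L W)
    (fun u hu => by
      obtain ⟨x, hx, hux⟩ := hu
      rw [mem_scaled, hux]
      exact L.add_mem hx (h.map x hx))
    (fun u hu v hv => by
      obtain ⟨x, hx, hux⟩ := hu
      obtain ⟨y, hy, hvy⟩ := hv
      obtain ⟨k, hk⟩ := hL.isInt hx hy
      obtain ⟨l, hl⟩ := hL.isInt hx (h.map y hy)
      have h2 := two_mul_inner (u : V) v
      rw [hux, hvy, inner_add_left, inner_add_right, inner_add_right, h.inner, h.inner_left, hk,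
        hl] at h2
      refine ⟨k + l, ?_⟩
      rw [Submodule.coe_inner]; push_cast; linarith)
    (fun u hu => (hL _).2 fun x hx => by
      have hW' : (1 / √2 : ℝ) • (x + s x) ∈ W := by
        rw [hW, map_smul, map_add, h.invol, add_comm]
      have h2 : √2 ≠ 0 := by norm_num
      have := hu ⟨_, hW'⟩ ⟨x, hx, by
        rw [smul_smul, mul_one_div_cancel h2, one_smul]⟩
      rw [Submodule.coe_inner, real_inner_smul_right, inner_add_right, ← h.inner_left,
        (hW _).1 u.2] at this
      rw [real_inner_smul_left]
      convert this using 1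
      field_simp
      rw [Real.sq_sqrt (by norm_num)]; ring)
    (fun u hu => (scaled_norm hLe h6 u hu).1)
  refine ⟨N, hN, h2, fun u hu => h1 ⟨_, hu, ?_⟩⟩
  rw [map_smul, (hW _).1 u.2, Submodule.coe_add, smul_add]

lemma IsInvol.finrank_eq [FiniteDimensional ℝ V] (h : IsInvol L s) (hL : SelfDual L)
    (hLe : Even L) (h6 : ∀ x ∈ L, x ≠ 0 → 6 ≤ ⟪x, x⟫) (hk : Module.finrank ℝ V = 48)
    (hW : ∀ x, x ∈ W ↔ s x = x) (hW' : ∀ x, x ∈ W' ↔ s x = -x) (h0 : W ≠ ⊥) (h0' : W' ≠ ⊥) :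
    Module.finrank ℝ W = 24 ∧ Module.finrank ℝ W' = 24 := by
  have hadd := h.finrank_add hW hW'
  rw [hk] at hadd
  have p : 1 ≤ Module.finrank ℝ W := Submodule.one_le_finrank_iff.2 h0
  have p' : 1 ≤ Module.finrank ℝ W' := Submodule.one_le_finrank_iff.2 h0'
  have key : ∀ {t : V →ₗ[ℝ] V} {X : Submodule ℝ V}, IsInvol L t → (∀ x, x ∈ X ↔ t x = x) →
      1 ≤ Module.finrank ℝ X → 23 ≤ Module.finrank ℝ X ∧ Module.finrank ℝ X ≠ 25 :=
    fun {t X} ht hX hp => by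
      obtain ⟨N, hN, hNM, -⟩ := ht.exists_selfDual hL hLe h6 hX
      have h3 : ∀ u ∈ N, u ≠ 0 → 3 ≤ ⟪u, u⟫ := fun u hu => (scaled_norm hLe h6 u (hNM hu)).2
      constructor
      · by_contra hlt
        exact hN.false_of_finrank_le h3 (n := 22 - Module.finrank ℝ X) (by omega) hp
      · exact fun h25 => hN.false_of_finrank_eq_twenty_five h25 h3
  have k1 := key h hW p
  have k2 := key h.neg (X := W') (fun x => by
    rw [hW', LinearMap.neg_apply, neg_eq_iff_eq_neg]) p'
  omega

lemma IsInvol.selfDual_scaled [FiniteDimensional ℝ V] (h : IsInvol L s) (hL : SelfDual L)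
    (hLe : Even L) (h6 : ∀ x ∈ L, x ≠ 0 → 6 ≤ ⟪x, x⟫) (hW : ∀ x, x ∈ W ↔ s x = x)
    (hk : Module.finrank ℝ W = 24) : SelfDual (scaled L W) := by
  obtain ⟨N, hN, hNM, h2⟩ := h.exists_selfDual hL hLe h6 hW
  rwa [le_antisymm (hN.overlattice_le hk hNM (scaled_norm hLe h6) h2) hNM]

lemma IsInvol.span_eq [FiniteDimensional ℝ V] (h : IsInvol L s) (hL : SelfDual L)
    (hW : ∀ x, x ∈ W ↔ s x = x) :
    Submodule.span ℝ ((L ⊓ W.toAddSubgroup : AddSubgroup V) : Set V) = W := by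
  apply le_antisymm
  · rw [Submodule.span_le]; exact fun x hx => hx.2
  · intro w hw
    have hw2 : w = (1 / 2 : ℝ) • (LinearMap.id + s : V →ₗ[ℝ] V) w := by
      rw [LinearMap.add_apply, (hW w).1 hw, LinearMap.id_apply, smul_add, ← add_smul, add_halves,
        one_smul]
    rw [hw2]
    apply Submodule.smul_mem
    have : (LinearMap.id + s : V →ₗ[ℝ] V) w ∈ (Submodule.span ℝ (L : Set V)).map (LinearMap.id + s : V →ₗ[ℝ] V) :=
      Submodule.mem_map_of_mem (by rw [hL.span_eq_top]; trivial)
    rw [Submodule.map_span] at this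
    refine Submodule.span_mono ?_ this
    rintro _ ⟨x, hx, rfl⟩
    refine ⟨L.add_mem hx (h.map x hx), (hW _).2 ?_⟩
    simp [h.invol, add_comm]

/-- The quotient of a group by the preimage of `2ℤⁿ` under a surjection to `ℤⁿ`. -/
lemma nonempty_quotient_equiv {G ι : Type} [AddCommGroup G] (H : AddSubgroup G)
    (f : G →+ (ι → ℤ)) (hf : Function.Surjective f) (hH : ∀ x, x ∈ H ↔ ∀ i, (2 : ℤ) ∣ f x i) :
    Nonempty (G ⧸ H ≃+ (ι → ZMod 2)) := by
  let g : G →+ (ι → ZMod 2) := ((Int.castAddHom (ZMod 2)).compLeft ι).comp f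
  have hg : Function.Surjective g := by
    have : Function.Surjective ((Int.castAddHom (ZMod 2)).compLeft ι) := fun t =>
      ⟨fun i => (ZMod.intCast_surjective (t i)).choose,
        funext fun i => (ZMod.intCast_surjective (t i)).choose_spec⟩
    exact this.comp hf
  have hker : H = g.ker := by
    ext x
    rw [hH, AddMonoidHom.mem_ker, funext_iff]
    exact forall_congr' fun i => (ZMod.intCast_zmod_eq_zero_iff_dvd (f x i) 2).symm
  exact ⟨(QuotientAddGroup.quotientAddEquivOfEq hker).trans
    (QuotientAddGroup.quotientKerEquivOfSurjective g hg)⟩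

/-- A self-dual lattice modulo `2`, seen through an isomorphic group. -/
lemma SelfDual.nonempty_quotient_equiv [FiniteDimensional ℝ V] {N : AddSubgroup V}
    (hN : SelfDual N) {n : ℕ} (hk : Module.finrank ℝ V = n) {G : Type} [AddCommGroup G]
    (H : AddSubgroup G) (φ : G →+ V) (hφ : ∀ v, v ∈ N ↔ ∃ x, φ x = v)
    (hH : ∀ x, x ∈ H ↔ (1 / 2 : ℝ) • φ x ∈ N) :
    Nonempty (G ⧸ H ≃+ (Fin n → ZMod 2)) := by
  obtain ⟨b, hb⟩ := hN.exists_basis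
  subst hk
  have hc : ∀ x i, IsInt (⟪φ x, b i⟫) := fun x i =>
    (hN.mem_iff_basis hb (φ x)).1 ((hφ _).2 ⟨x, rfl⟩) i
  have hfl : ∀ x i, ((⌊⟪φ x, b i⟫⌋ : ℤ) : ℝ) = ⟪φ x, b i⟫ := fun x i => by
    obtain ⟨k, hk⟩ := hc x i
    rw [hk, Int.floor_intCast]
  refine SDLattice.nonempty_quotient_equiv H
    (AddMonoidHom.mk' (fun x i => ⌊⟪φ x, b i⟫⌋) fun x y => funext fun i => ?_)
    (fun t => ?_) fun x => ?_
  · have : ((⌊⟪φ (x + y), b i⟫⌋ : ℤ) : ℝ) =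
        ((⌊⟪φ x, b i⟫⌋ + ⌊⟪φ y, b i⟫⌋ : ℤ) : ℝ) := by
      rw [Int.cast_add, hfl, hfl, hfl, map_add, inner_add_left]
    exact_mod_cast this
  · obtain ⟨c, hc⟩ := exists_inner_basis b fun i => (t i : ℝ)
    obtain ⟨x, rfl⟩ := (hφ c).1 ((hN.mem_iff_basis hb _).2 fun i => ⟨t i, by
      rw [real_inner_comm, hc]⟩)
    refine ⟨x, funext fun i => ?_⟩
    simp only [AddMonoidHom.mk'_apply]
    rw [real_inner_comm, hc, Int.floor_intCast]
  · rw [hH, hN.mem_iff_basis hb]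
    refine forall_congr' fun i => ?_
    rw [AddMonoidHom.mk'_apply, real_inner_smul_left]
    constructor
    · rintro ⟨k, hk⟩
      refine ⟨k, ?_⟩
      have : ((⌊⟪φ x, b i⟫⌋ : ℤ) : ℝ) = ((2 * k : ℤ) : ℝ) := by
        rw [hfl]; push_cast; linarith
      exact_mod_cast this
    · rintro ⟨k, hk⟩
      refine ⟨k, ?_⟩
      rw [← hfl, hk]; push_cast; ring

end SDLattice

/-! ### The fixed lattices of an involution -/

namespace SDLattice

variable {L : Submodule ℤ (Eu 48)} {W : Submodule ℝ (Eu 48)} {s : Eu 48 →ₗ[ℝ] Eu 48}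

lemma nonempty_discQuot_equiv (h : IsInvol L.toAddSubgroup s) (hL : SelfDual L.toAddSubgroup)
    (hLe : Even L.toAddSubgroup) (h6 : ∀ x ∈ L.toAddSubgroup, x ≠ 0 → 6 ≤ ⟪x, x⟫)
    (hW : ∀ x, x ∈ W ↔ s x = x) (hk : Module.finrank ℝ W = 24) :
    Nonempty (discQuot L W ≃+ (Fin 24 → ZMod 2)) := by
  have hspan : Submodule.span ℝ ((latIn L W) : Set (Eu 48)) = W := h.span_eq hL hW
  have hS : SelfDual (scaled L.toAddSubgroup W) := h.selfDual_scaled hL hLe h6 hW hk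
  have h22 : √2 * √2 = (2 : ℝ) := Real.mul_self_sqrt (by norm_num)
  have h20 : √2 ≠ (0 : ℝ) := by positivity
  set G := dualIn (Submodule.span ℝ ((latIn L W) : Set (Eu 48))) ((latIn L W) : Set (Eu 48))
    with hG
  have hGW : ∀ x : G, (x : Eu 48) ∈ W := fun x => hspan ▸ x.2.1
  let φ : G →+ W :=
    { toFun := fun x => √2 • (⟨x, hGW x⟩ : W)
      map_zero' := by ext1; simp
      map_add' := fun x y => by ext1; simp }
  have hφ : ∀ x : G, ((φ x : W) : Eu 48) = √2 • (x : Eu 48) := fun x => rfl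
  have hmem : ∀ u : W, u ∈ scaled L.toAddSubgroup W ↔
      ∀ y ∈ latIn L W, IsInt ⟪(√2)⁻¹ • (u : Eu 48), y⟫ := by
    intro u
    rw [hS u]
    constructor
    · intro hu y hy
      have h1 := hu ((√2)⁻¹ • (⟨y, (AddSubgroup.mem_inf.1 hy).2⟩ : W)) (by
        rw [mem_scaled, Submodule.coe_smul, smul_smul, mul_inv_cancel₀ h20, one_smul]
        exact (AddSubgroup.mem_inf.1 hy).1)
      rwa [real_inner_smul_right, Submodule.coe_inner, ← real_inner_smul_left] at h1
    · intro hu v hv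
      have h1 := hu (√2 • (v : Eu 48)) ⟨hv, W.smul_mem _ v.2⟩
      rwa [real_inner_smul_left, real_inner_smul_right, inv_mul_cancel_left₀ h20,
        ← Submodule.coe_inner] at h1
  refine hS.nonempty_quotient_equiv hk ((latIn L W).addSubgroupOf G) φ (fun v => ?_) fun x => ?_
  · rw [hmem]
    constructor
    · intro hv
      refine ⟨⟨(√2)⁻¹ • (v : Eu 48), by rw [hspan]; exact W.smul_mem _ v.2, hv⟩, ?_⟩
      ext1
      rw [hφ, smul_smul, mul_inv_cancel₀ h20, one_smul]
    · rintro ⟨x, rfl⟩ y hy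
      rw [hφ, smul_smul, inv_mul_cancel₀ h20, one_smul]
      exact x.2.2 y hy
  · rw [mem_scaled, Submodule.coe_smul, hφ, smul_smul, smul_smul,
      show √2 * (1 / 2) * √2 = (1 : ℝ) by linear_combination h22 / 2, one_smul,
      AddSubgroup.mem_addSubgroupOf]
    exact ⟨fun hx => (AddSubgroup.mem_inf.1 hx).1, fun hx => AddSubgroup.mem_inf.2 ⟨hx, hGW x⟩⟩

lemma finrank_span_latIn (h : IsInvol L.toAddSubgroup s) (hL : SelfDual L.toAddSubgroup)
    (hW : ∀ x, x ∈ W ↔ s x = x) :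
    Module.finrank ℝ (Submodule.span ℝ ((latIn L W) : Set (Eu 48))) = Module.finrank ℝ W := by
  rw [show Submodule.span ℝ ((latIn L W) : Set (Eu 48)) = W from h.span_eq hL hW]

end SDLattice

/-- If `L` is an even unimodular lattice of dimension 48 with minimum 6 and
`σ ∈ Aut(L)` has order 2 with `σ ≠ -1`, then the fixed lattices of `σ` and of `-σ` are
both 24-dimensional, each with discriminant group `(ℤ/2ℤ)^24`. -/
theorem stmt9 (L : Submodule ℤ (Eu 48)) (hL : IsExtremal48 L)
    (σ : Eu 48 ≃ₗ[ℝ] Eu 48) (hσ : IsAutoOf σ L) (hord : orderOf σ = 2)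
    (hneg : σ ≠ LinearEquiv.neg ℝ) :
    Module.finrank ℝ (Submodule.span ℝ ((latIn L (fixSpace σ)) : Set (Eu 48))) = 24 ∧
    Module.finrank ℝ (Submodule.span ℝ ((latIn L (negFixSpace σ)) : Set (Eu 48))) = 24 ∧
    Nonempty (discQuot L (fixSpace σ) ≃+ (Fin 24 → ZMod 2)) ∧
    Nonempty (discQuot L (negFixSpace σ) ≃+ (Fin 24 → ZMod 2)) := by
  obtain ⟨-, hLe, hdual, h6, -⟩ := hL
  have hSD : SDLattice.SelfDual L.toAddSubgroup := fun x => (Set.ext_iff.1 hdual x).symm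
  have hσσ : ∀ x, σ (σ x) = x := fun x => by
    have h := pow_orderOf_eq_one σ
    rw [hord, pow_two] at h
    exact LinearEquiv.congr_fun h x
  have hs : SDLattice.IsInvol L.toAddSubgroup σ.toLinearMap :=
    ⟨hσσ, hσ.1, fun x hx => (Set.ext_iff.1 hσ.2 (σ x)).1 ⟨x, hx, rfl⟩⟩
  have hW : ∀ x, x ∈ fixSpace σ ↔ σ.toLinearMap x = x := fun x => by
    rw [fixSpace, LinearMap.mem_ker, LinearMap.sub_apply, LinearMap.id_apply, sub_eq_zero]
  have hW' : ∀ x, x ∈ negFixSpace σ ↔ σ.toLinearMap x = -x := fun x => by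
    rw [negFixSpace, LinearMap.mem_ker, LinearMap.add_apply, LinearMap.id_apply,
      add_eq_zero_iff_eq_neg]
  have hWn : ∀ x, x ∈ negFixSpace σ ↔ (-σ.toLinearMap) x = x := fun x => by
    rw [hW', LinearMap.neg_apply, neg_eq_iff_eq_neg]
  have h0 : fixSpace σ ≠ ⊥ := fun h => hneg <| LinearEquiv.ext fun x => by
    have hx : x + σ x ∈ fixSpace σ := (hW _).2 <| by
      simp only [LinearEquiv.coe_coe, map_add, hσσ]
      exact add_comm _ _
    rw [h, Submodule.mem_bot] at hx
    exact (neg_eq_of_add_eq_zero_right hx).symm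
  have h0' : negFixSpace σ ≠ ⊥ := fun h => by
    have h1 : σ = 1 := LinearEquiv.ext fun x => by
      have hx : σ x - x ∈ negFixSpace σ := (hW' _).2 <| by
        simp only [LinearEquiv.coe_coe, map_sub, hσσ, neg_sub]
      rw [h, Submodule.mem_bot] at hx
      exact sub_eq_zero.1 hx
    rw [h1, orderOf_one] at hord
    exact absurd hord (by norm_num)
  obtain ⟨h24, h24'⟩ := hs.finrank_eq hSD hLe h6 finrank_euclideanSpace_fin hW hW' h0 h0'
  exact ⟨(SDLattice.finrank_span_latIn hs hSD hW).trans h24,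
    (SDLattice.finrank_span_latIn hs.neg hSD hWn).trans h24',
    SDLattice.nonempty_discQuot_equiv hs hSD hLe h6 hW h24,
    SDLattice.nonempty_discQuot_equiv hs.neg hSD hLe h6 hWn h24'⟩
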